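/- arXiv:1901.01055 — 10 statements merged into one kernel-verified Lean document; each statement's English description precedes it below -/
import Mathlib

section
/- Let d = 4 or d = 5. Then there exist an integer N_d, a constant K > 0, and a function c : ℕ → ℝ with c(n) → ∞ as n → ∞, such that the following holds: for all real numbers t_1, t_2 ≥ 1, every integer n ≥ N_d, and every separated set {P_1, ..., P_n} of n points in Euclidean space R^d, the number of unordered pairs {i, j} (i ≠ j) with dist(P_i, P_j) ∈ [t_1, t_1 + c(n)] ∪ [t_2, t_2 + c(n)] is at most (n²/2)·(1 − 1/m_{d−1} + K/log n). -/
open scoped Classical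

/-- `twoDistMax j` is the maximal cardinality of a finite subset of Euclidean
space `ℝ^j` whose set of distances between pairs of distinct points has at most
2 elements (a two-distance set). -/
noncomputable def twoDistMax (j : ℕ) : ℕ :=
  sSup {n : ℕ | ∃ s : Finset (EuclideanSpace ℝ (Fin j)), s.card = n ∧
    ({d : ℝ | ∃ x ∈ s, ∃ y ∈ s, x ≠ y ∧ d = dist x y}).ncard ≤ 2}

section CliqueTuples

variable {V : Type*} [Fintype V] (G : SimpleGraph V)

/-- The ordered `r`-tuples of pairwise adjacent vertices. -/
noncomputable def cliqueTuples (r : ℕ) : Finset (Fin r → V) :=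
  Finset.univ.filter fun x => ∀ i j, i ≠ j → G.Adj (x i) (x j)

/-- The vertices adjacent to all entries of a tuple. -/
noncomputable def commonNbrs {r : ℕ} (y : Fin r → V) : Finset V :=
  Finset.univ.filter fun v => ∀ j, G.Adj v (y j)

variable {G}

lemma mem_cliqueTuples {r : ℕ} {x : Fin r → V} :
    x ∈ cliqueTuples G r ↔ ∀ i j, i ≠ j → G.Adj (x i) (x j) := by
  simp [cliqueTuples]

lemma mem_commonNbrs {r : ℕ} {y : Fin r → V} {v : V} :
    v ∈ commonNbrs G y ↔ ∀ j, G.Adj v (y j) := by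
  simp [commonNbrs]

lemma insertNth_mem_cliqueTuples {r : ℕ} (i : Fin (r + 1)) (v : V) (y : Fin r → V) :
    (i.insertNth v y : Fin (r + 1) → V) ∈ cliqueTuples G (r + 1) ↔
      y ∈ cliqueTuples G r ∧ v ∈ commonNbrs G y := by
  simp only [mem_cliqueTuples, mem_commonNbrs]
  constructor
  · intro h
    refine ⟨fun a b hab => ?_, fun j => ?_⟩
    · simpa using h (i.succAbove a) (i.succAbove b) (by simpa using hab)
    · simpa using h i (i.succAbove j) (Fin.succAbove_ne i j).symm
  · rintro ⟨h1, h2⟩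
    rw [Fin.forall_iff_succAbove i]
    constructor
    · rw [Fin.forall_iff_succAbove i]
      exact ⟨fun h => (h rfl).elim, fun j _ => by simpa using h2 j⟩
    · intro a
      rw [Fin.forall_iff_succAbove i]
      refine ⟨fun _ => by simpa using (h2 a).symm, fun b hab => ?_⟩
      simpa using h1 a b (fun h => hab (by rw [h]))

lemma sum_cliqueTuples_removeNth {r : ℕ} (i : Fin (r + 1)) (F : (Fin r → V) → ℝ) :
    ∑ x ∈ cliqueTuples G (r + 1), F (i.removeNth x) =
      ∑ y ∈ cliqueTuples G r, ((commonNbrs G y).card : ℝ) * F y := by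
  have h : ∀ y : Fin r → V, ∑ v : V, (if (i.insertNth v y : Fin (r + 1) → V) ∈
      cliqueTuples G (r + 1) then F (i.removeNth (i.insertNth v y : Fin (r + 1) → V)) else 0) =
      if y ∈ cliqueTuples G r then ((commonNbrs G y).card : ℝ) * F y else 0 := by
    intro y
    by_cases hy : y ∈ cliqueTuples G r
    · simp [insertNth_mem_cliqueTuples, hy]
    · simp [insertNth_mem_cliqueTuples, hy]
  rw [← Finset.univ_inter (cliqueTuples G (r + 1)), ← Finset.univ_inter (cliqueTuples G r),
    ← Finset.sum_ite_mem, ← Finset.sum_ite_mem, ← Finset.sum_congr rfl fun y _ => h y,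
    ← (Fin.insertNthEquiv (fun _ => V) i).sum_comp, Fintype.sum_prod_type_right]
  rfl

lemma card_cliqueTuples_succ (r : ℕ) :
    ((cliqueTuples G (r + 1)).card : ℝ) =
      ∑ y ∈ cliqueTuples G r, ((commonNbrs G y).card : ℝ) := by
  simpa using sum_cliqueTuples_removeNth (G := G) (0 : Fin (r + 1)) fun _ => 1

lemma sum_card_commonNbrs_removeNth_le {r : ℕ} (x : Fin (r + 1) → V) :
    ∑ i : Fin (r + 1), ((commonNbrs G (i.removeNth x)).card : ℝ) ≤
      Fintype.card V + r * (commonNbrs G x).card := by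
  have hcard : ∀ {s : ℕ} (y : Fin s → V), ((commonNbrs G y).card : ℝ) =
      ∑ v : V, if ∀ j, G.Adj v (y j) then 1 else 0 := by
    intro s y
    simp [commonNbrs]
  simp only [hcard]
  rw [Finset.sum_comm, Finset.mul_sum, ← Finset.card_univ, Finset.cast_card,
    ← Finset.sum_add_distrib]
  refine Finset.sum_le_sum fun v _ => ?_
  by_cases hv : ∀ j, G.Adj v (x j)
  · have : ∀ i : Fin (r + 1), ∀ j, G.Adj v (i.removeNth x j) := fun i j => hv _
    simp [hv, this, add_comm]
  · obtain ⟨j, hj⟩ := not_forall.1 hv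
    have : ∀ i ≠ j, ¬ ∀ l, G.Adj v (i.removeNth x l) := by
      intro i hij h
      obtain ⟨l, rfl⟩ := Fin.exists_succAbove_eq hij.symm
      exact hj (h l)
    rw [Finset.sum_eq_single j (fun i _ hi => if_neg (this i hi)) (by simp), if_neg hv]
    split_ifs <;> simp

/-- The Moon–Moser inequality for ordered cliques. -/
theorem moon_moser (r : ℕ) :
    (r + 1 : ℝ) * ((cliqueTuples G (r + 1)).card : ℝ) ^ 2 ≤
      (cliqueTuples G r).card *
        (Fintype.card V * (cliqueTuples G (r + 1)).card + r * (cliqueTuples G (r + 2)).card) := by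
  set S : ℝ := ∑ y ∈ cliqueTuples G r, ((commonNbrs G y).card : ℝ) ^ 2 with hS
  have h1 : ((cliqueTuples G (r + 1)).card : ℝ) ^ 2 ≤ (cliqueTuples G r).card * S := by
    rw [card_cliqueTuples_succ]
    exact sq_sum_le_card_mul_sum_sq
  have h2 : (r + 1 : ℝ) * S ≤
      Fintype.card V * (cliqueTuples G (r + 1)).card + r * (cliqueTuples G (r + 2)).card := by
    calc (r + 1 : ℝ) * S = ∑ i : Fin (r + 1), ∑ x ∈ cliqueTuples G (r + 1),
          ((commonNbrs G (i.removeNth x)).card : ℝ) := by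
          simp_rw [sum_cliqueTuples_removeNth _ fun y => ((commonNbrs G y).card : ℝ)]
          simp [hS, sq]
      _ = ∑ x ∈ cliqueTuples G (r + 1), ∑ i : Fin (r + 1),
          ((commonNbrs G (i.removeNth x)).card : ℝ) := Finset.sum_comm
      _ ≤ ∑ x ∈ cliqueTuples G (r + 1), (Fintype.card V + r * ((commonNbrs G x).card : ℝ)) :=
          Finset.sum_le_sum fun x _ => sum_card_commonNbrs_removeNth_le x
      _ = _ := by
          rw [Finset.sum_add_distrib, ← Finset.mul_sum, ← card_cliqueTuples_succ]
          simp [mul_comm]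
  calc _ ≤ (r + 1 : ℝ) * ((cliqueTuples G r).card * S) := by gcongr
    _ = (cliqueTuples G r).card * ((r + 1 : ℝ) * S) := by ring
    _ ≤ _ := by gcongr

lemma card_cliqueTuples_one : (cliqueTuples G 1).card = Fintype.card V := by
  rw [cliqueTuples, Finset.filter_true_of_mem fun x _ i j h => (h (Subsingleton.elim i j)).elim]
  simp

/-- Supersaturated Turán theorem: slightly more edges than in a Turán graph force a positive
proportion of all tuples to be cliques. -/
theorem le_card_cliqueTuples [Nonempty V] {m : ℕ} (hm : 0 < m) {γ : ℝ} (hγ : 0 < γ)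
    (h : (1 - 1 / m + γ) * (Fintype.card V : ℝ) ^ 2 ≤ (cliqueTuples G 2).card) :
    γ * (Fintype.card V : ℝ) ^ (m + 1) ≤ m ^ m * (cliqueTuples G (m + 1)).card := by
  have hn : (0 : ℝ) < Fintype.card V := by exact_mod_cast Fintype.card_pos
  have hm' : (0 : ℝ) < m := by exact_mod_cast hm
  generalize hN : (Fintype.card V : ℝ) = n at *
  have key : ∀ r : ℕ, r + 1 ≤ m → n ^ (r + 1) ≤ m ^ r * (cliqueTuples G (r + 1)).card ∧
      (1 - (r + 1) * (1 / m - γ)) * n * (cliqueTuples G (r + 1)).card ≤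
        (cliqueTuples G (r + 2)).card := by
    intro r
    induction r with
    | zero =>
      intro _
      rw [zero_add, card_cliqueTuples_one, hN]
      refine ⟨by simp, le_of_eq_of_le (by push_cast; ring) h⟩
    | succ r ih =>
      intro hr
      obtain ⟨h1, h2⟩ := ih (by omega)
      have hr' : (r + 1 + 1 : ℝ) ≤ m := by exact_mod_cast hr
      have hmm := moon_moser (G := G) (r + 1)
      rw [hN] at hmm
      set a : ℝ := ((cliqueTuples G (r + 1)).card : ℝ)
      set b : ℝ := ((cliqueTuples G (r + 1 + 1)).card : ℝ) with hb
      set c : ℝ := ((cliqueTuples G (r + 1 + 2)).card : ℝ)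
      have ha : 0 < a := by
        have : 0 < (m : ℝ) ^ r * a := lt_of_lt_of_le (by positivity) h1
        exact pos_of_mul_pos_right this (by positivity)
      have h2' : (1 - (r + 1) * (1 / m - γ)) * n * a ≤ b := h2
      have hfrac : (1 : ℝ) / m ≤ 1 - (r + 1) * (1 / m - γ) := by
        have : (r + 1 + 1 : ℝ) * (1 / m) ≤ 1 := by
          rw [mul_one_div, div_le_one hm']; exact hr'
        have : (0 : ℝ) ≤ (r + 1) * γ := by positivity
        linarith
      have hab : 1 / m * n * a ≤ b := le_trans (by gcongr) h2'
      have hbpos : 0 < b := lt_of_lt_of_le (by positivity) hab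
      constructor
      · calc n ^ (r + 1 + 1) = n * n ^ (r + 1) := by ring
          _ ≤ n * (m ^ r * a) := by gcongr
          _ = m ^ (r + 1) * (1 / m * n * a) := by rw [pow_succ (m : ℝ)]; field_simp
          _ ≤ m ^ (r + 1) * b := by gcongr
      · push_cast at hmm ⊢
        have h3 : (r + 1 + 1) * ((1 - (r + 1) * (1 / m - γ)) * n * a) * b ≤
            a * (n * b + (r + 1) * c) := by
          calc _ ≤ (r + 1 + 1 : ℝ) * b * b := by gcongr
            _ = (r + 1 + 1 : ℝ) * b ^ 2 := by ring
            _ ≤ _ := hmm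
        have h4 : (r + 1 : ℝ) * a * ((1 - (r + 1 + 1) * (1 / m - γ)) * n * b) ≤
            (r + 1 : ℝ) * a * c := by linarith
        exact le_of_mul_le_mul_left h4 (by positivity)
  obtain ⟨k, rfl⟩ : ∃ k, m = k + 1 := ⟨m - 1, by omega⟩
  obtain ⟨h1, h2⟩ := key k le_rfl
  have h3 : (1 - (k + 1 : ℝ) * (1 / ((k + 1 : ℕ) : ℝ) - γ)) = (k + 1) * γ := by
    push_cast
    field_simp
    ring
  rw [h3] at h2
  push_cast at h1 ⊢
  calc γ * n ^ (k + 1 + 1) = γ * n * n ^ (k + 1) := by ring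
    _ ≤ γ * n * ((k + 1) ^ k * (cliqueTuples G (k + 1)).card) := by gcongr
    _ = (k + 1) ^ k * (γ * n * (cliqueTuples G (k + 1)).card) := by ring
    _ ≤ (k + 1) ^ k * ((k + 1) * (cliqueTuples G (k + 2)).card) := by
        have h4 : γ * n * (cliqueTuples G (k + 1)).card ≤ (cliqueTuples G (k + 2)).card := by
          refine le_trans ?_ h2
          rw [mul_assoc, mul_assoc, mul_assoc]
          exact le_mul_of_one_le_left (by positivity) (by simp)
        exact mul_le_mul_of_nonneg_left
          (h4.trans (le_mul_of_one_le_left (by positivity) (by simp))) (by positivity)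
    _ = _ := by ring

/-- If the edges of a graph with more edges than a Turán graph are coloured, then some colour
pattern of cliques has many realizations differing in a single vertex, whose position may
depend on the pattern. -/
theorem exists_pattern_many_extensions [Nonempty V] {Γ : Type*} (κ : V → V → Γ) (K : Finset Γ)
    (hK : ∀ a b, a = b ∨ G.Adj a b → κ a b ∈ K) {m : ℕ} (hm : 0 < m) {γ : ℝ} (hγ : 0 < γ)
    (h : (1 - 1 / m + γ) * (Fintype.card V : ℝ) ^ 2 ≤ (cliqueTuples G 2).card)
    (pos : (Fin (m + 1) → Fin (m + 1) → Γ) → Fin (m + 1)) :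
    ∃ (χ : Fin (m + 1) → Fin (m + 1) → Γ) (y : Fin m → V) (s : Finset V),
      γ * Fintype.card V ≤ m ^ m * (K.card : ℝ) ^ ((m + 1) * (m + 1)) * s.card ∧
      ∀ a ∈ s, ((pos χ).insertNth a y : Fin (m + 1) → V) ∈ cliqueTuples G (m + 1) ∧
        ∀ i j, κ ((pos χ).insertNth (α := fun _ => V) a y i)
          ((pos χ).insertNth (α := fun _ => V) a y j) = χ i j := by
  have hn : (0 : ℝ) < Fintype.card V := by exact_mod_cast Fintype.card_pos
  have hKpos : 0 < K.card := Finset.card_pos.2 ⟨_, hK (Classical.arbitrary V) _ (Or.inl rfl)⟩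
  have hcl := le_card_cliqueTuples hm hγ h
  set n : ℝ := (Fintype.card V : ℝ)
  set L : ℝ := (K.card : ℝ) ^ ((m + 1) * (m + 1)) with hL
  have hLpos : 0 < L := by positivity
  set T : Finset (Fin (m + 1) → Fin (m + 1) → Γ) :=
    Fintype.piFinset fun _ => Fintype.piFinset fun _ => K with hT
  have hTcard : (T.card : ℝ) = L := by
    simp [hT, hL, Fintype.card_piFinset, pow_mul]
  obtain ⟨χ, -, hχ⟩ := Finset.exists_le_card_fiber_of_nsmul_le_card_of_maps_to
    (s := cliqueTuples G (m + 1)) (t := T) (f := fun x i j => κ (x i) (x j))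
    (b := ((cliqueTuples G (m + 1)).card : ℝ) / L)
    (by
      intro x hx
      simp only [hT, Fintype.mem_piFinset]
      intro i j
      by_cases hij : i = j
      · exact hK _ _ (Or.inl (by rw [hij]))
      · exact hK _ _ (Or.inr (mem_cliqueTuples.1 hx i j hij)))
    (by rw [← Finset.card_pos]; exact_mod_cast hTcard ▸ hLpos)
    (by rw [nsmul_eq_mul, hTcard, mul_div_cancel₀ _ hLpos.ne'])
  set W := {x ∈ cliqueTuples G (m + 1) | (fun i j => κ (x i) (x j)) = χ} with hW
  obtain ⟨y, -, hy⟩ := Finset.exists_le_card_fiber_of_nsmul_le_card_of_maps_to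
    (s := W) (t := Finset.univ) (f := fun x => (pos χ).removeNth x)
    (b := (W.card : ℝ) / n ^ m) (fun _ _ => Finset.mem_univ _)
    ⟨fun _ => Classical.arbitrary V, Finset.mem_univ _⟩
    (by
      rw [nsmul_eq_mul, Finset.card_univ, Fintype.card_fun, Fintype.card_fin, Nat.cast_pow,
        mul_div_cancel₀ _ (by positivity)])
  refine ⟨χ, y, Finset.univ.filter fun a => ((pos χ).insertNth a y : Fin (m + 1) → V) ∈ W,
    ?_, ?_⟩
  · have hle : {x ∈ W | (pos χ).removeNth x = y}.card ≤
        (Finset.univ.filter fun a => ((pos χ).insertNth a y : Fin (m + 1) → V) ∈ W).card := by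
      refine Finset.card_le_card_of_injOn (fun x => x (pos χ)) ?_ ?_
      · intro x hx
        obtain ⟨hx, rfl⟩ := Finset.mem_filter.1 hx
        simpa using hx
      · intro x hx x' hx' hxx
        have e : (pos χ).removeNth x = (pos χ).removeNth x' :=
          (Finset.mem_filter.1 hx).2.trans (Finset.mem_filter.1 hx').2.symm
        rw [← Fin.insertNth_self_removeNth (pos χ) x, e]
        simp only at hxx
        rw [hxx, Fin.insertNth_self_removeNth]
    have hle' : (W.card : ℝ) / n ^ m ≤ (Finset.univ.filter fun a =>
        ((pos χ).insertNth a y : Fin (m + 1) → V) ∈ W).card :=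
      hy.trans (by exact_mod_cast hle)
    rw [div_le_iff₀ (by positivity)] at hle' hχ
    refine le_of_mul_le_mul_right (a := n ^ m) ?_ (by positivity)
    calc γ * n * n ^ m = γ * n ^ (m + 1) := by ring
      _ ≤ m ^ m * (cliqueTuples G (m + 1)).card := hcl
      _ ≤ m ^ m * (W.card * L) := by gcongr
      _ ≤ m ^ m * (_ * n ^ m * L) := by gcongr
      _ = _ := by ring
  · intro a ha
    obtain ⟨h1, h2⟩ := Finset.mem_filter.1 (Finset.mem_filter.1 ha).2
    exact ⟨h1, fun i j => congrFun (congrFun h2 i) j⟩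

end CliqueTuples

section NearlyTwoDistance

open Filter Topology

variable {E : Type*} [NormedAddCommGroup E] {ι : Type*}

/-- The distances between the points `p i` are, up to an additive error `C`, equal to `T true` or
`T false` as prescribed by `τ`, and `q` is a point near `p o`, at distance much larger than `C`
from it, with nearly the same distances to the other points. Here `e` bounds the relative
errors. -/
structure IsNearlyTwoDistance (τ : ι → ι → Bool) (o : ι) (e : ℝ) (p : ι → E) (q : E)
    (T : Bool → ℝ) (C : ℝ) : Prop where
  pos : 0 < T true
  le : T true ≤ T false
  nonneg : 0 ≤ C
  error_le : C ≤ e * T true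
  norm_mem : ∀ i j, i ≠ j → ‖p i - p j‖ ∈ Set.Icc (T (τ i j)) (T (τ i j) + C)
  norm_mem' : ∀ j, j ≠ o → ‖p j - q‖ ∈ Set.Icc (T (τ o j)) (T (τ o j) + C)
  ne : q ≠ p o
  error_le' : C ≤ e * ‖q - p o‖
  norm_le : ∀ j, j ≠ o → ‖q - p o‖ ≤ e * T (τ o j)

namespace IsNearlyTwoDistance

variable {τ : ι → ι → Bool} {o : ι} {e : ℝ} {p : ι → E} {q : E} {T : Bool → ℝ} {C : ℝ}

lemma pos_apply (h : IsNearlyTwoDistance τ o e p q T C) : ∀ b, 0 < T b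
  | true => h.pos
  | false => h.pos.trans_le h.le

lemma le_apply (h : IsNearlyTwoDistance τ o e p q T C) : ∀ b, T true ≤ T b
  | true => le_rfl
  | false => h.le

lemma apply_le (h : IsNearlyTwoDistance τ o e p q T C) : ∀ b, T b ≤ T false
  | true => h.le
  | false => le_rfl

lemma norm_div_mem (h : IsNearlyTwoDistance τ o e p q T C) (he : 0 ≤ e) (b : Bool) {i j : ι}
    (hij : i ≠ j) :
    ‖p i - p j‖ / T b ∈ Set.Icc (T (τ i j) / T b) (T (τ i j) / T b + e) := by
  have hpos := h.pos_apply b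
  obtain ⟨h1, h2⟩ := h.norm_mem i j hij
  refine ⟨by gcongr, ?_⟩
  rw [div_add' _ _ _ hpos.ne']
  gcongr
  have : e * T true ≤ e * T b := mul_le_mul_of_nonneg_left (h.le_apply b) he
  linarith [h.error_le]

end IsNearlyTwoDistance

variable [InnerProductSpace ℝ E]

lemma abs_inner_le_of_norm_mem_Icc {a b : E} {T C : ℝ} (hT : 0 ≤ T)
    (hb : ‖b‖ ∈ Set.Icc T (T + C)) (hba : ‖b - a‖ ∈ Set.Icc T (T + C)) :
    |inner ℝ a b| ≤ C * (T + C) + ‖a‖ ^ 2 / 2 := by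
  have h := norm_sub_sq_real b a
  rw [real_inner_comm] at h
  obtain ⟨h1, h2⟩ := hb
  obtain ⟨h3, h4⟩ := hba
  rw [abs_le]
  constructor <;> nlinarith [sq_nonneg ‖a‖]

lemma exists_tendsto_of_norm_le {F α : Type*} [NormedAddCommGroup F] [ProperSpace F]
    (U : Ultrafilter α) {f : α → F} {B : ℝ} (h : ∀ᶠ k in (U : Filter α), ‖f k‖ ≤ B) :
    ∃ x, Tendsto f U (𝓝 x) := by
  obtain ⟨x, -, hx⟩ := (isCompact_closedBall (0 : F) B).ultrafilter_le_nhds (U.map f) (by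
    rw [le_principal_iff, Ultrafilter.coe_map, Filter.mem_map]
    filter_upwards [h] with k hk
    simpa using hk)
  exact ⟨x, hx⟩

lemma norm_inv_smul_sub_inv_smul {t : ℝ} (ht : 0 < t) (a b c : E) :
    ‖t⁻¹ • (a - c) - t⁻¹ • (b - c)‖ = ‖a - b‖ / t := by
  rw [← smul_sub, norm_smul, norm_inv, Real.norm_of_nonneg ht.le, sub_sub_sub_cancel_right,
    div_eq_inv_mul]

namespace IsNearlyTwoDistance

variable {τ : ι → ι → Bool} {o : ι} {e : ℝ} {p : ι → E} {q : E} {T : Bool → ℝ} {C : ℝ}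

lemma abs_inner_le (h : IsNearlyTwoDistance τ o e p q T C) (he : 0 ≤ e) {j : ι} (hj : j ≠ o)
    {b : Bool} (hb : T (τ o j) ≤ T b) :
    |inner ℝ (‖q - p o‖⁻¹ • (q - p o)) ((T b)⁻¹ • (p j - p o))| ≤ e * (1 + e) + e / 2 := by
  have hq : 0 < ‖q - p o‖ := norm_pos_iff.2 (sub_ne_zero.2 h.ne)
  have hT := h.pos_apply (τ o j)
  have hT' := h.pos_apply b
  have h0 := abs_inner_le_of_norm_mem_Icc (a := q - p o) (b := p j - p o) hT.le
    (by rw [norm_sub_rev]; exact h.norm_mem o j hj.symm)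
    (by rw [sub_sub_sub_cancel_right]; exact h.norm_mem' j hj)
  have hn := h.norm_le j hj
  have h1 := h.error_le'
  have h2 : C ≤ e * T (τ o j) := h.error_le.trans (mul_le_mul_of_nonneg_left (h.le_apply _) he)
  have h4 := h.nonneg
  rw [real_inner_smul_left, real_inner_smul_right, abs_mul, abs_mul,
    abs_of_pos (inv_pos.2 hq), abs_of_pos (inv_pos.2 hT'), ← mul_assoc, ← mul_inv,
    inv_mul_le_iff₀ (by positivity)]
  generalize ‖q - p o‖ = a at *
  generalize T (τ o j) = t at *
  generalize T b = s at *
  calc _ ≤ C * (t + C) + a ^ 2 / 2 := h0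
    _ ≤ e * a * (t + e * t) + a * (e * t) / 2 := by
        rw [sq]
        gcongr
    _ = a * t * (e * (1 + e) + e / 2) := by ring
    _ ≤ _ := by gcongr

lemma abs_inner_le' (h : IsNearlyTwoDistance τ o e p q T C) (he : 0 ≤ e) {i j : ι} (hi : i ≠ o)
    (hij : i ≠ j) (hj : j ≠ o) (hoi : τ o i = true) (hoj : τ o j = false) (hτ : τ i j = false) :
    |inner ℝ ((T true)⁻¹ • (p i - p o)) ((T false)⁻¹ • (p j - p o))| ≤
      e * (1 + e) + T true / T false * (1 + e) ^ 2 / 2 := by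
  have hT := h.pos
  have hT' := h.pos_apply false
  have h0 := abs_inner_le_of_norm_mem_Icc (a := p i - p o) (b := p j - p o) hT'.le
    (by rw [norm_sub_rev, ← hoj]; exact h.norm_mem o j hj.symm)
    (by rw [sub_sub_sub_cancel_right, norm_sub_rev, ← hτ]; exact h.norm_mem i j hij)
  have hn := (h.norm_mem o i hi.symm).2
  rw [norm_sub_rev, hoi] at hn
  have h1 := h.error_le
  have h2 : C ≤ e * T false := h.error_le.trans (mul_le_mul_of_nonneg_left h.le he)
  have h4 := h.nonneg
  rw [real_inner_smul_left, real_inner_smul_right, abs_mul, abs_mul,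
    abs_of_pos (inv_pos.2 hT), abs_of_pos (inv_pos.2 hT'), ← mul_assoc, ← mul_inv,
    inv_mul_le_iff₀ (by positivity)]
  have hn' : ‖p i - p o‖ ≤ T true * (1 + e) := by linarith
  generalize hN : ‖p i - p o‖ = N at *
  have hN0 : 0 ≤ N := hN ▸ norm_nonneg _
  generalize T true = t at *
  generalize T false = s at *
  calc _ ≤ C * (s + C) + N ^ 2 / 2 := h0
    _ ≤ e * t * (s + e * s) + (t * (1 + e)) ^ 2 / 2 := by gcongr
    _ = _ := by field_simp

end IsNearlyTwoDistance

/-- If there is no two-distance set indexed by `ι` in a hyperplane, then there are no nearly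
two-distance configurations with sufficiently small errors, provided that the base point `o` has
the largest number of neighbours at the smaller distance. -/
theorem eventually_not_isNearlyTwoDistance [ProperSpace E] [Fintype ι]
    (H : ∀ (f : ι → E) (u : E) (a b : ℝ), u ≠ 0 → 0 < a → 0 < b → (∀ j, inner ℝ u (f j) = 0) →
      ¬ ∀ i j, i ≠ j → ‖f i - f j‖ = a ∨ ‖f i - f j‖ = b)
    (τ : ι → ι → Bool) (o : ι) (hτ : ∀ i j, τ i j = τ j i)
    (ho : ∀ i, (Finset.univ.filter fun j => j = i ∨ τ i j = true).card ≤
      (Finset.univ.filter fun j => j = o ∨ τ o j = true).card) :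
    ∀ᶠ e in 𝓝[>] (0 : ℝ), ∀ (p : ι → E) (q : E) (T : Bool → ℝ) (C : ℝ),
      ¬ IsNearlyTwoDistance τ o e p q T C := by
  by_contra hfreq
  obtain ⟨e, he, hc⟩ := exists_seq_forall_of_frequently (not_eventually.1 hfreq)
  push Not at hc
  choose p q T C hc using hc
  set U := hyperfilter ℕ
  have he' := he.mono_left Nat.hyperfilter_le_atTop
  have he0 : Tendsto e U (𝓝 0) := he'.mono_right nhdsWithin_le_nhds
  have hepos : ∀ᶠ k in (U : Filter ℕ), 0 ≤ e k :=
    (he'.eventually self_mem_nhdsWithin).mono fun k hk => (Set.mem_Ioi.1 hk).le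
  have hele : ∀ᶠ k in (U : Filter ℕ), e k ≤ 1 := he0.eventually (ge_mem_nhds one_pos)
  have hpos := fun k => (hc k).pos_apply
  -- the ratio of the two distances
  obtain ⟨r, hr⟩ := exists_tendsto_of_norm_le U (f := fun k => T k true / T k false) (B := 1)
    (Eventually.of_forall fun k => by
      rw [Real.norm_of_nonneg (div_pos (hpos k _) (hpos k _)).le, div_le_one (hpos k _)]
      exact (hc k).le)
  have hr0 : 0 ≤ r := ge_of_tendsto' hr fun k => (div_pos (hpos k _) (hpos k _)).le
  -- normalized distances
  have squeeze : ∀ (b : Bool) (i j : ι) (x : ℝ), i ≠ j →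
      Tendsto (fun k => T k (τ i j) / T k b) U (𝓝 x) →
      Tendsto (fun k => ‖p k i - p k j‖ / T k b) U (𝓝 x) := by
    intro b i j x hij hx
    refine tendsto_of_tendsto_of_tendsto_of_le_of_le' hx (by simpa using hx.add he0) ?_ ?_
    · filter_upwards [hepos] with k hk using ((hc k).norm_div_mem hk b hij).1
    · filter_upwards [hepos] with k hk using ((hc k).norm_div_mem hk b hij).2
  have hdist₂ : ∀ i j, i ≠ j → Tendsto (fun k => ‖p k i - p k j‖ / T k false) U
      (𝓝 (if τ i j = true then r else 1)) := by
    intro i j hij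
    refine squeeze _ i j _ hij ?_
    split_ifs with h
    · simpa [h] using hr
    · simp [Bool.eq_false_iff.2 h, div_self (hpos _ _).ne']
  have hdist₁ : ∀ i j, i ≠ j → τ i j = true →
      Tendsto (fun k => ‖p k i - p k j‖ / T k true) U (𝓝 1) := by
    intro i j hij h
    refine squeeze _ i j _ hij ?_
    simp [h, div_self (hpos _ _).ne']
  -- limits of the normalized vectors
  have hlim : ∀ (b : Bool) (i : ι) (x : ℝ),
      Tendsto (fun k => ‖p k i - p k o‖ / T k b) U (𝓝 x) →
      ∃ y, Tendsto (fun k => (T k b)⁻¹ • (p k i - p k o)) U (𝓝 y) := by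
    intro b i x hx
    refine exists_tendsto_of_norm_le U (B := x + 1) ?_
    filter_upwards [hx.eventually (ge_mem_nhds (lt_add_one x))] with k hk
    rwa [norm_smul, norm_inv, Real.norm_of_nonneg (hpos k b).le, inv_mul_eq_div]
  have hlim₂ : ∀ i, ∃ y, Tendsto (fun k => (T k false)⁻¹ • (p k i - p k o)) U (𝓝 y) := by
    intro i
    by_cases hi : i = o
    · exact ⟨0, by simp [hi]⟩
    · exact hlim _ i _ (hdist₂ i o hi)
  choose x₂ hx₂ using hlim₂
  have hlim₁ : ∀ i, ∃ y, (i = o ∨ τ o i = true) →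
      Tendsto (fun k => (T k true)⁻¹ • (p k i - p k o)) U (𝓝 y) := by
    intro i
    by_cases hi : i = o
    · exact ⟨0, by simp [hi]⟩
    · by_cases hi' : τ o i = true
      · obtain ⟨y, hy⟩ := hlim true i _ (hdist₁ i o hi (hτ o i ▸ hi'))
        exact ⟨y, fun _ => hy⟩
      · exact ⟨0, fun h => by simp [hi, hi'] at h⟩
  choose x₁ hx₁ using hlim₁
  obtain ⟨u, hu⟩ := exists_tendsto_of_norm_le U
    (f := fun k => ‖q k - p k o‖⁻¹ • (q k - p k o)) (B := 1) (Eventually.of_forall fun k => by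
      rw [norm_smul, norm_inv, norm_norm,
        inv_mul_cancel₀ (norm_ne_zero_iff.2 (sub_ne_zero.2 (hc k).ne))])
  have hu0 : u ≠ 0 := by
    have : Tendsto (fun k => ‖‖q k - p k o‖⁻¹ • (q k - p k o)‖) U (𝓝 1) := by
      refine tendsto_const_nhds.congr fun k => ?_
      rw [norm_smul, norm_inv, norm_norm,
        inv_mul_cancel₀ (norm_ne_zero_iff.2 (sub_ne_zero.2 (hc k).ne))]
    have h1 := tendsto_nhds_unique hu.norm this
    rintro rfl
    simp at h1
  have hnorm₂ : ∀ i j, i ≠ j → ‖x₂ i - x₂ j‖ = if τ i j = true then r else 1 := by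
    intro i j hij
    refine tendsto_nhds_unique ((hx₂ i).sub (hx₂ j)).norm ((hdist₂ i j hij).congr fun k => ?_)
    rw [norm_inv_smul_sub_inv_smul (hpos k _)]
  have hux₂ : ∀ j, inner ℝ u (x₂ j) = 0 := by
    intro j
    refine tendsto_nhds_unique (hu.inner (hx₂ j)) ?_
    by_cases hj : j = o
    · simp [hj]
    · refine squeeze_zero_norm' (a := fun k => e k * (1 + e k) + e k / 2) ?_ ?_
      · filter_upwards [hepos] with k hk using (hc k).abs_inner_le hk hj ((hc k).apply_le _)
      · simpa using (he0.mul (he0.const_add 1)).add (he0.div_const 2)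
  rcases hr0.lt_or_eq with hr0 | rfl
  · refine H x₂ u r 1 hu0 hr0 one_pos hux₂ fun i j hij => ?_
    rw [hnorm₂ i j hij]
    split_ifs <;> simp
  -- the smaller distance is negligible, so being at the smaller distance is transitive
  have htrans : ∀ i j l, τ i j = true → τ j l = true → i ≠ l → τ i l = true := by
    intro i j l hij hjl hil
    by_cases h1 : i = j
    · rwa [h1]
    by_cases h2 : j = l
    · rwa [← h2]
    by_contra h
    have := le_of_tendsto_of_tendsto' (hdist₂ i l hil)
      ((hdist₂ i j h1).add (hdist₂ j l h2)) fun k => by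
        rw [← add_div]
        exact div_le_div_of_nonneg_right (norm_sub_le_norm_sub_add_norm_sub _ _ _) (hpos k _).le
    simp only [hij, hjl, h, if_true] at this
    norm_num at this
  have hnorm₁ : ∀ i j, (i = o ∨ τ o i = true) → (j = o ∨ τ o j = true) → i ≠ j →
      ‖x₁ i - x₁ j‖ = 1 := by
    intro i j hi hj hij
    have h : τ i j = true := by
      rcases hi with rfl | hi
      · exact hj.resolve_left hij.symm
      · rw [hτ] at hi
        rcases hj with rfl | hj
        · exact hi
        · exact htrans i o j hi hj hij
    refine tendsto_nhds_unique ((hx₁ i hi).sub (hx₁ j hj)).norm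
      ((hdist₁ i j hij h).congr fun k => ?_)
    rw [norm_inv_smul_sub_inv_smul (hpos k _)]
  have hx₁o : x₁ o = 0 := tendsto_nhds_unique (hx₁ o (Or.inl rfl)) (by simp)
  have hx₂o : x₂ o = 0 := tendsto_nhds_unique (hx₂ o) (by simp)
  have hux₁ : ∀ j, (j = o ∨ τ o j = true) → inner ℝ u (x₁ j) = 0 := by
    intro j hj
    by_cases hjo : j = o
    · simp [hjo, hx₁o]
    · refine tendsto_nhds_unique (hu.inner (hx₁ j hj)) ?_
      refine squeeze_zero_norm' (a := fun k => e k * (1 + e k) + e k / 2) ?_ ?_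
      · filter_upwards [hepos] with k hk
        exact (hc k).abs_inner_le hk hjo (by rw [hj.resolve_left hjo])
      · simpa using (he0.mul (he0.const_add 1)).add (he0.div_const 2)
  have hx₁x₂ : ∀ i, (i = o ∨ τ o i = true) → ∀ j, inner ℝ (x₁ i) (x₂ j) = 0 := by
    intro i hi j
    by_cases hio : i = o
    · simp [hio, hx₁o]
    by_cases hjo : j = o
    · simp [hjo, hx₂o]
    have hi := hi.resolve_left hio
    by_cases hoj : τ o j = true
    · have : x₂ j = 0 := by
        have := hnorm₂ j o hjo
        rwa [hτ, if_pos hoj, hx₂o, sub_zero, norm_eq_zero] at this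
      simp [this]
    have hij : i ≠ j := by
      rintro rfl
      exact hoj hi
    have hτij : τ i j = false := by
      by_contra h
      exact hoj (htrans o i j hi (by simpa using h) (Ne.symm hjo))
    refine tendsto_nhds_unique ((hx₁ i (Or.inr hi)).inner (hx₂ j)) ?_
    refine squeeze_zero_norm' (a := fun k => e k * (1 + e k) +
      T k true / T k false * (1 + e k) ^ 2 / 2) ?_ ?_
    · filter_upwards [hepos] with k hk using
        (hc k).abs_inner_le' hk hio hij hjo hi (by simpa using hoj) hτij
    · simpa using (he0.mul (he0.const_add 1)).add
        ((hr.mul ((he0.const_add 1).pow 2)).div_const 2)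
  -- embed every class into the class of `o`
  set cls : ι → Finset ι := fun i => Finset.univ.filter fun j => j = i ∨ τ i j = true with hcls
  have hemb : ∀ S : Finset ι, ∃ g : ι → ι, S.card ≤ (cls o).card →
      Set.MapsTo g S (cls o) ∧ Set.InjOn g S := by
    intro S
    by_cases hS : S.card ≤ (cls o).card
    · obtain ⟨f⟩ : Nonempty (S ↪ cls o) := Function.Embedding.nonempty_of_card_le (by simpa using hS)
      refine ⟨fun i => if h : i ∈ S then f ⟨i, h⟩ else i, fun _ => ⟨fun i hi => ?_, ?_⟩⟩
      · simp [Finset.mem_coe.1 hi]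
      · intro i hi j hj hij
        simpa [Finset.mem_coe.1 hi, Finset.mem_coe.1 hj] using hij
    · exact ⟨id, fun h => (hS h).elim⟩
  choose g hg using hemb
  have hcls_sub : ∀ i j, τ i j = true → cls j ⊆ cls i := by
    intro i j hij l hl
    simp only [hcls, Finset.mem_filter, Finset.mem_univ, true_and] at hl ⊢
    rcases hl with rfl | hl
    · exact Or.inr hij
    · exact or_iff_not_imp_left.2 fun h => htrans i j l hij hl (Ne.symm h)
  have hcls_eq : ∀ i j, τ i j = true → cls i = cls j := fun i j hij =>
    (hcls_sub j i (hτ i j ▸ hij)).antisymm (hcls_sub i j hij)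
  have hgo : ∀ i, g (cls i) i = o ∨ τ o (g (cls i) i) = true := by
    intro i
    have := (hg (cls i) (ho i)).1 (show i ∈ (cls i : Set ι) by simp [hcls])
    simpa [hcls] using this
  refine H (fun i => x₁ (g (cls i) i) + x₂ i) u 1 √2 hu0 one_pos (by simp)
    (fun i => by rw [inner_add_right, hux₁ _ (hgo i), hux₂, add_zero]) fun i j hij => ?_
  have hsq : ‖x₁ (g (cls i) i) + x₂ i - (x₁ (g (cls j) j) + x₂ j)‖ ^ 2 =
      ‖x₁ (g (cls i) i) - x₁ (g (cls j) j)‖ ^ 2 + ‖x₂ i - x₂ j‖ ^ 2 := by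
    rw [add_sub_add_comm, norm_add_sq_real]
    simp [inner_sub_left, inner_sub_right, hx₁x₂ _ (hgo _)]
  by_cases hτij : τ i j = true
  · left
    have hne : g (cls i) i ≠ g (cls j) j := by
      rw [← hcls_eq i j hτij]
      intro h
      exact hij ((hg (cls i) (ho i)).2 (by simp [hcls]) (by simp [hcls, hτij]) h)
    rw [hnorm₁ _ _ (hgo i) (hgo j) hne, hnorm₂ i j hij, if_pos hτij] at hsq
    refine (sq_eq_sq₀ (norm_nonneg _) zero_le_one).1 ?_
    rw [hsq]
    norm_num
  · rw [hnorm₂ i j hij, if_neg hτij] at hsq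
    by_cases hgg : g (cls i) i = g (cls j) j
    · left
      refine (sq_eq_sq₀ (norm_nonneg _) zero_le_one).1 ?_
      rw [hsq, hgg]
      simp
    · right
      rw [hnorm₁ _ _ (hgo i) (hgo j) hgg] at hsq
      refine (sq_eq_sq₀ (norm_nonneg _) (Real.sqrt_nonneg 2)).1 ?_
      rw [hsq, Real.sq_sqrt zero_le_two]
      norm_num

end NearlyTwoDistance

section Grid

variable {D : ℕ}

lemma EuclideanSpace.norm_le_card_mul {v : EuclideanSpace ℝ (Fin D)} {s : ℝ} (hs : 0 ≤ s)
    (h : ∀ i, |v i| ≤ s) : ‖v‖ ≤ D * s := by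
  refine le_of_sq_le_sq ?_ (by positivity)
  rw [EuclideanSpace.norm_sq_eq]
  calc ∑ i, ‖v i‖ ^ 2 ≤ ∑ _i : Fin D, s ^ 2 := by
        refine Finset.sum_le_sum fun i _ => ?_
        have := h i
        rw [Real.norm_eq_abs]
        gcongr
    _ = D * s ^ 2 := by simp
    _ ≤ (D * s) ^ 2 := by
        rw [mul_pow]
        gcongr
        exact_mod_cast Nat.le_self_pow two_ne_zero D

/-- The cell containing `v` of the cubic grid with side length `s`. -/
noncomputable def gridCell (s : ℝ) (v : EuclideanSpace ℝ (Fin D)) : Fin D → ℤ :=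
  fun i => ⌊v i / s⌋

lemma norm_sub_le_of_gridCell_eq {s : ℝ} (hs : 0 < s) {v w : EuclideanSpace ℝ (Fin D)}
    (h : gridCell s v = gridCell s w) : ‖v - w‖ ≤ D * s := by
  refine EuclideanSpace.norm_le_card_mul hs.le fun i => ?_
  have := Int.abs_sub_lt_one_of_floor_eq_floor (congrFun h i)
  rw [← sub_div, abs_div, abs_of_pos hs, div_lt_one hs] at this
  exact this.le

lemma gridCell_mem {s : ℝ} (hs : 0 < s) {k : ℕ} {v : EuclideanSpace ℝ (Fin D)}
    (h : ‖v‖ ≤ k * s) : gridCell s v ∈ Fintype.piFinset fun _ => Finset.Icc (-k : ℤ) k := by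
  rw [Fintype.mem_piFinset]
  intro i
  have h1 : |v i / s| ≤ k := by
    rw [abs_div, abs_of_pos hs, div_le_iff₀ hs]
    exact (PiLp.norm_apply_le v i).trans h
  rw [abs_le] at h1
  rw [Finset.mem_Icc]
  constructor
  · rw [gridCell, Int.le_floor]
    push_cast
    exact h1.1
  · have : ((gridCell s v i : ℤ) : ℝ) ≤ ((k : ℤ) : ℝ) := by
      push_cast
      exact (Int.floor_le (v i / s)).trans h1.2
    exact_mod_cast this

/-- A separated family has polynomially many points in a ball. -/
lemma card_le_of_separated {ι : Type*} (P : ι → EuclideanSpace ℝ (Fin D))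
    (hP : ∀ i j, i ≠ j → 1 ≤ dist (P i) (P j)) (S : Finset ι) (x : EuclideanSpace ℝ (Fin D))
    {k : ℕ} {R : ℝ} (hR : (D + 1) * R ≤ k) (hS : ∀ i ∈ S, dist (P i) x ≤ R) :
    S.card ≤ (2 * k + 1) ^ D := by
  have hs : (0 : ℝ) < ((D : ℝ) + 1)⁻¹ := by positivity
  have hcard : (Fintype.piFinset fun _ : Fin D => Finset.Icc (-k : ℤ) k).card =
      (2 * k + 1) ^ D := by
    rw [Fintype.card_piFinset]
    simp only [Int.card_Icc, Finset.prod_const, Finset.card_univ, Fintype.card_fin]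
    congr 1
    omega
  rw [← hcard]
  refine Finset.card_le_card_of_injOn (fun i => gridCell ((D : ℝ) + 1)⁻¹ (P i - x)) ?_ ?_
  · intro i hi
    refine gridCell_mem hs ?_
    rw [← dist_eq_norm, ← div_eq_mul_inv, le_div_iff₀ (by positivity), mul_comm]
    exact (mul_le_mul_of_nonneg_left (hS i hi) (by positivity)).trans hR
  · intro i _ j _ hij
    by_contra hne
    have h1 := norm_sub_le_of_gridCell_eq hs hij
    rw [sub_sub_sub_cancel_right, ← dist_eq_norm] at h1
    have h2 : (D : ℝ) * ((D : ℝ) + 1)⁻¹ < 1 := by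
      rw [← div_eq_mul_inv, div_lt_one (by positivity)]
      linarith
    linarith [hP i j hne]

end Grid

/-- A hyperplane of `ℝ^(k+1)` contains no two-distance set with more than `twoDistMax k`
points. -/
lemma not_two_distance_of_twoDistMax_lt {k M : ℕ} (h0 : 0 < twoDistMax k)
    (hM : twoDistMax k < M) (f : Fin M → EuclideanSpace ℝ (Fin (k + 1)))
    (u : EuclideanSpace ℝ (Fin (k + 1))) (a b : ℝ) (hu : u ≠ 0) (ha : 0 < a) (hb : 0 < b)
    (hf : ∀ j, inner ℝ u (f j) = 0) :
    ¬ ∀ i j, i ≠ j → ‖f i - f j‖ = a ∨ ‖f i - f j‖ = b := by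
  intro h
  have : Fact (Module.finrank ℝ (EuclideanSpace ℝ (Fin (k + 1))) = k + 1) := ⟨by simp⟩
  let φ := (OrthonormalBasis.fromOrthogonalSpanSingleton (𝕜 := ℝ) k hu).repr
  let g : Fin M → EuclideanSpace ℝ (Fin k) := fun i =>
    φ ⟨f i, Submodule.mem_orthogonal_singleton_iff_inner_right.2 (hf i)⟩
  have hg : ∀ i j, dist (g i) (g j) = ‖f i - f j‖ := by
    intro i j
    rw [φ.dist_map, Subtype.dist_eq, dist_eq_norm]
  have hinj : Function.Injective g := by
    intro i j hij
    by_contra hne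
    have h1 := hg i j
    rw [hij, dist_self] at h1
    rcases h i j hne with h2 | h2 <;> linarith
  have hbdd : BddAbove {n : ℕ | ∃ s : Finset (EuclideanSpace ℝ (Fin k)), s.card = n ∧
      ({d : ℝ | ∃ x ∈ s, ∃ y ∈ s, x ≠ y ∧ d = dist x y}).ncard ≤ 2} := by
    by_contra hb
    rw [twoDistMax, Nat.sSup_of_not_bddAbove hb] at h0
    exact h0.ne rfl
  refine hM.not_ge (le_csSup hbdd ⟨Finset.univ.image g, ?_, ?_⟩)
  · rw [Finset.card_image_of_injective _ hinj, Finset.card_univ, Fintype.card_fin]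
  · refine (Set.ncard_le_ncard (t := {a, b}) ?_ (by simp)).trans (Set.ncard_insert_le _ _ |>.trans
      (by simp))
    rintro d ⟨x, hx, y, hy, hxy, rfl⟩
    obtain ⟨i, -, rfl⟩ := Finset.mem_image.1 hx
    obtain ⟨j, -, rfl⟩ := Finset.mem_image.1 hy
    rw [hg]
    exact h i j fun e => hxy (by rw [e])

/-- If the distances along the edges of a graph lie in two short intervals and the graph has more
edges than a Turán graph, then many of its vertices are close to each other. -/
theorem exists_large_cluster {k : ℕ} (h0 : 0 < twoDistMax k) :
    ∃ ε > (0 : ℝ), ∃ Λ > (0 : ℝ), ∀ (V : Type) [Fintype V] [Nonempty V]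
      (P : V → EuclideanSpace ℝ (Fin (k + 1))) (G : SimpleGraph V) (t₁ t₂ c γ : ℝ),
      0 < c → c ≤ ε * t₁ → t₁ ≤ t₂ → 0 < γ →
      (∀ a b, G.Adj a b → dist (P a) (P b) ∈ Set.Icc t₁ (t₁ + c) ∨
        dist (P a) (P b) ∈ Set.Icc t₂ (t₂ + c)) →
      (1 - 1 / (twoDistMax k : ℝ) + γ) * (Fintype.card V : ℝ) ^ 2 ≤ (cliqueTuples G 2).card →
      ∃ S : Finset V, γ * Fintype.card V ≤ Λ * S.card ∧
        ∀ a ∈ S, ∀ b ∈ S, ε * dist (P a) (P b) < c := by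
  set m := twoDistMax k
  have hev := Filter.eventually_all.2 fun τ : Fin (m + 1) → Fin (m + 1) → Bool =>
    Filter.eventually_all.2 fun o => Filter.eventually_all.2 fun hτ =>
    Filter.eventually_all.2 fun ho => eventually_not_isNearlyTwoDistance
      (fun f u a b hu ha hb => not_two_distance_of_twoDistMax_lt h0 (Nat.lt_succ_self _)
        f u a b hu ha hb) τ o hτ ho
  obtain ⟨ε, ⟨hε, hε1⟩, hε0⟩ := ((hev.and
    (nhdsWithin_le_nhds (ge_mem_nhds one_pos))).and self_mem_nhdsWithin).exists
  set h : ℝ := ε / (k + 1 : ℕ) with hh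
  have hhpos : 0 < h := by positivity
  set N : ℕ := ⌈2 / h⌉₊
  set K : Finset (Bool × (Fin (k + 1) → ℤ)) :=
    Finset.univ ×ˢ Fintype.piFinset fun _ => Finset.Icc (-N : ℤ) N with hK
  have hKpos : 0 < K.card := Finset.card_pos.2 ⟨(true, 0), by simp [hK]⟩
  refine ⟨ε, hε0, m ^ m * (K.card : ℝ) ^ ((m + 1) * (m + 1)), by positivity, ?_⟩
  intro V _ _ P G t₁ t₂ c γ hc hct ht hγ hadj hcard
  have ht₁ : 0 < t₁ := pos_of_mul_pos_right (hc.trans_le hct) hε0.le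
  set T : Bool → ℝ := fun b => if b = true then t₁ else t₂ with hT
  have hTle : ∀ b, t₁ ≤ T b := by rintro (_ | _) <;> simp [hT, ht]
  have hTpos : ∀ b, 0 < T b := fun b => ht₁.trans_le (hTle b)
  set σ : V → V → Bool := fun a b => decide (dist (P a) (P b) ∈ Set.Icc t₁ (t₁ + c)) with hσ
  have hσ_comm : ∀ a b, σ a b = σ b a := fun a b => by simp only [hσ, dist_comm]
  set κ : V → V → Bool × (Fin (k + 1) → ℤ) := fun a b =>
    (σ a b, gridCell (h * T (σ a b)) (P a - P b)) with hκ
  have hadj' : ∀ a b, G.Adj a b → ‖P a - P b‖ ∈ Set.Icc (T (σ a b)) (T (σ a b) + c) := by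
    intro a b hab
    rw [← dist_eq_norm]
    by_cases hd : dist (P a) (P b) ∈ Set.Icc t₁ (t₁ + c)
    · rw [show σ a b = true from decide_eq_true hd]
      exact hd
    · rw [show σ a b = false from decide_eq_false hd]
      exact (hadj a b hab).resolve_left hd
  have hκK : ∀ a b, a = b ∨ G.Adj a b → κ a b ∈ K := by
    intro a b hab
    refine Finset.mem_product.2 ⟨Finset.mem_univ _, gridCell_mem (mul_pos hhpos (hTpos _)) ?_⟩
    have h1 : ‖P a - P b‖ ≤ 2 * T (σ a b) := by
      rcases hab with rfl | hab
      · simpa using (hTpos _).le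
      · have h2 := (hadj' a b hab).2
        have h3 : ε * t₁ ≤ 1 * t₁ := by gcongr
        linarith [hTle (σ a b)]
    calc _ ≤ 2 * T (σ a b) := h1
      _ = 2 / h * (h * T (σ a b)) := by field_simp
      _ ≤ _ := by
        have := (hTpos (σ a b)).le
        gcongr
        exact Nat.le_ceil _
  choose pos hpos using fun χ : Fin (m + 1) → Fin (m + 1) → Bool × (Fin (k + 1) → ℤ) =>
    Finite.exists_max fun i =>
      (Finset.univ.filter fun j => j = i ∨ (χ i j).1 = true).card
  obtain ⟨χ, y, S, hS, hSχ⟩ := exists_pattern_many_extensions κ K hκK h0 hγ hcard pos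
  refine ⟨S, hS, fun a ha b hb => ?_⟩
  by_contra! hab
  obtain ⟨hxa, hχa⟩ := hSχ a ha
  obtain ⟨hxb, hχb⟩ := hSχ b hb
  rw [mem_cliqueTuples] at hxa hxb
  set o := pos χ
  have hdist : 0 < dist (P a) (P b) := pos_of_mul_pos_right (hc.trans_le hab) hε0.le
  set x : Fin (m + 1) → V := o.insertNth a y with hx
  set z : Fin (m + 1) → V := o.insertNth b y with hz
  have hσχ : ∀ i j, σ (x i) (x j) = (χ i j).1 := fun i j => by rw [← hχa]
  have hxo : x o = a := by simp [hx]
  have hzo : z o = b := by simp [hz]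
  have hxz : ∀ j, j ≠ o → x j = z j := by
    intro j hj
    obtain ⟨l, rfl⟩ := Fin.exists_succAbove_eq hj
    simp [hx, hz]
  refine hε (fun i j => (χ i j).1) o (fun i j => by rw [← hσχ, ← hσχ, hσ_comm])
    (fun i => by convert hpos χ i; rfl)
    (fun i => P (x i)) (P b) T c ⟨ht₁, hTle _, hc.le, hct, ?_, ?_, ?_, ?_, ?_⟩
  · intro i j hij
    rw [← hσχ]
    exact hadj' _ _ (hxa i j hij)
  · intro j hj
    have h1 := hadj' _ _ (hxb o j hj.symm)
    have h2 : σ (z o) (z j) = (χ o j).1 := by rw [← hχb]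
    rw [h2, hzo, norm_sub_rev, ← hxz j hj] at h1
    exact h1
  · rw [hxo]
    exact (dist_pos.1 hdist).symm
  · rwa [hxo, ← dist_eq_norm, dist_comm]
  · intro j hj
    have h1 : κ (x o) (x j) = κ (z o) (z j) := (hχa o j).trans (hχb o j).symm
    have h2 : gridCell (h * T (σ (x o) (x j))) (P (x o) - P (x j)) =
        gridCell (h * T (σ (z o) (z j))) (P (z o) - P (z j)) := congrArg Prod.snd h1
    have h3 : σ (x o) (x j) = σ (z o) (z j) := congrArg Prod.fst h1
    rw [← h3, hσχ, hxo, hzo, ← hxz j hj] at h2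
    have h4 := norm_sub_le_of_gridCell_eq (mul_pos hhpos (hTpos _)) h2
    rw [sub_sub_sub_cancel_right, norm_sub_rev, ← mul_assoc, hh, mul_div_cancel₀ _
      (by positivity)] at h4
    simpa [hxo] using h4

section Counting

variable {n : ℕ}

lemma card_union_swap {A : Finset (Fin n × Fin n)} (hA : ∀ q ∈ A, q.1 < q.2) :
    (A ∪ A.map (Equiv.prodComm _ _).toEmbedding).card = 2 * A.card := by
  have hdisj : Disjoint A (A.map (Equiv.prodComm _ _).toEmbedding) := by
    rw [Finset.disjoint_left]
    intro q hq hq'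
    obtain ⟨q', hmem, rfl⟩ := Finset.mem_map.1 hq'
    exact (hA _ hq).asymm (hA q' hmem)
  rw [Finset.card_union_of_disjoint hdisj, Finset.card_map, two_mul]

lemma two_mul_card_le_sq {A : Finset (Fin n × Fin n)} (hA : ∀ q ∈ A, q.1 < q.2) :
    2 * A.card ≤ n ^ 2 := by
  rw [← card_union_swap hA]
  refine (Finset.card_le_univ _).trans_eq ?_
  rw [Fintype.card_prod, Fintype.card_fin, sq]

lemma two_mul_card_le_card_cliqueTuples {G : SimpleGraph (Fin n)} {A : Finset (Fin n × Fin n)}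
    (hA : ∀ q ∈ A, q.1 < q.2) (hG : ∀ q ∈ A, G.Adj q.1 q.2) :
    2 * A.card ≤ (cliqueTuples G 2).card := by
  rw [← card_union_swap hA]
  refine Finset.card_le_card_of_injOn (fun q => ![q.1, q.2]) ?_ ?_
  · intro q hq
    have hadj : G.Adj q.1 q.2 := by
      rcases Finset.mem_union.1 hq with hq | hq
      · exact hG q hq
      · obtain ⟨q', hq', rfl⟩ := Finset.mem_map.1 hq
        exact (hG q' hq').symm
    rw [Finset.mem_coe, mem_cliqueTuples]
    intro i j hij
    fin_cases i <;> fin_cases j <;> first | exact absurd rfl hij | exact hadj | exact hadj.symm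
  · intro q _ q' _ h
    exact Prod.ext (congrFun h 0) (congrFun h 1)

end Counting

/-- A fixed power of `log n` is eventually smaller than `n / log n`. -/
lemma eventually_mul_pow_mul_log_lt (A L : ℝ) (D : ℕ) :
    ∀ᶠ n : ℕ in Filter.atTop, L * (A * Real.log n) ^ D * Real.log n < n := by
  have h := (Real.isLittleO_pow_log_id_atTop (n := D + 1)).const_mul_left (L * A ^ D)
  have h' := (h.comp_tendsto tendsto_natCast_atTop_atTop).bound (half_pos one_pos)
  filter_upwards [h', Filter.eventually_gt_atTop 0] with n hn hn0
  have hn0' : (0 : ℝ) < n := by exact_mod_cast hn0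
  simp only [Function.comp_apply, id, Real.norm_eq_abs, Nat.abs_cast] at hn
  calc _ = L * A ^ D * Real.log n ^ (D + 1) := by ring
    _ ≤ _ := le_abs_self _
    _ ≤ _ := hn
    _ < n := by linarith

/-- A separated family of `n` points in `ℝ^(k+1)` has few pairs at distance in two intervals of
length `log n`. -/
theorem two_nearly_equal_distances_upper_bound (k : ℕ) :
    ∃ N : ℕ, ∀ (t₁ t₂ : ℝ), ∀ n : ℕ, N ≤ n →
      ∀ P : Fin n → EuclideanSpace ℝ (Fin (k + 1)),
        (∀ i j, i ≠ j → 1 ≤ dist (P i) (P j)) →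
        ((Finset.univ.filter fun q : Fin n × Fin n => q.1 < q.2 ∧
            (dist (P q.1) (P q.2) ∈ Set.Icc t₁ (t₁ + Real.log n) ∨
             dist (P q.1) (P q.2) ∈ Set.Icc t₂ (t₂ + Real.log n))).card : ℝ)
          ≤ (n : ℝ) ^ 2 / 2 * (1 - 1 / (twoDistMax k : ℝ) + 3 / Real.log n) := by
  rcases Nat.eq_zero_or_pos (twoDistMax k) with h0 | h0
  · refine ⟨1, fun t₁ t₂ n hn P _ => ?_⟩
    have h2 : 0 ≤ 3 / Real.log n := div_nonneg (by norm_num) (Real.log_natCast_nonneg n)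
    rw [h0, Nat.cast_zero, div_zero, sub_zero]
    refine le_trans ?_ (le_mul_of_one_le_right (by positivity) (by linarith))
    rw [le_div_iff₀ two_pos, mul_comm]
    norm_cast
    exact two_mul_card_le_sq fun q hq => (Finset.mem_filter.1 hq).2.1
  obtain ⟨ε, hε, Λ, hΛ, hcluster⟩ := exists_large_cluster h0
  set A : ℝ := 2 * ((k + 2) / ε + 1) + 1 with hA
  have hlog : Filter.Tendsto (fun n : ℕ => Real.log n) Filter.atTop Filter.atTop :=
    Real.tendsto_log_atTop.comp tendsto_natCast_atTop_atTop
  obtain ⟨N, hN⟩ := Filter.eventually_atTop.1 ((hlog.eventually_ge_atTop 1).and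
    ((eventually_mul_pow_mul_log_lt A 1 (k + 1)).and
      ((eventually_mul_pow_mul_log_lt A Λ (k + 1)).and (Filter.eventually_gt_atTop 0))))
  refine ⟨N, fun t₁ t₂ n hn P hP => ?_⟩
  obtain ⟨hc1, hB1, hBΛ, hn0⟩ := hN n hn
  have hn0' : (0 : ℝ) < n := by exact_mod_cast hn0
  have : Nonempty (Fin n) := ⟨⟨0, hn0⟩⟩
  set c := Real.log n with hc
  have hc0 : 0 < c := one_pos.trans_le hc1
  set R := c / ε with hR
  have hR0 : 0 < R := div_pos hc0 hε
  set l : ℕ := ⌈((k + 1 : ℕ) + 1) * R⌉₊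
  have hball : ∀ (S : Finset (Fin n)) (x), (∀ i ∈ S, dist (P i) x ≤ R) →
      (S.card : ℝ) ≤ (A * c) ^ (k + 1) := by
    intro S x hS
    have h1 : (S.card : ℝ) ≤ (2 * l + 1) ^ (k + 1) := by
      have := card_le_of_separated P hP S x (k := l) (Nat.le_ceil _) hS
      exact_mod_cast this
    have h2 : (l : ℝ) < ((k + 1 : ℕ) + 1) * R + 1 := Nat.ceil_lt_add_one (by positivity)
    refine h1.trans (pow_le_pow_left₀ (by positivity) ?_ _)
    have h3 : ((k + 1 : ℕ) + 1 : ℝ) * R = (k + 2) / ε * c := by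
      rw [hR]
      push_cast
      ring
    rw [h3] at h2
    rw [hA]
    linarith
  by_contra! hcount
  let G : SimpleGraph (Fin n) :=
    { Adj := fun i j => R < dist (P i) (P j) ∧ (dist (P i) (P j) ∈ Set.Icc t₁ (t₁ + c) ∨
        dist (P i) (P j) ∈ Set.Icc t₂ (t₂ + c))
      symm := ⟨fun i j h => by rwa [dist_comm]⟩
      loopless := ⟨fun i h => by simpa using hR0.trans h.1⟩ }
  set E := Finset.univ.filter fun q : Fin n × Fin n => q.1 < q.2 ∧
    (dist (P q.1) (P q.2) ∈ Set.Icc t₁ (t₁ + c) ∨ dist (P q.1) (P q.2) ∈ Set.Icc t₂ (t₂ + c))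
  have hclose : ((E.filter fun q => ¬ G.Adj q.1 q.2).card : ℝ) ≤ n * (A * c) ^ (k + 1) := by
    have h1 : (E.filter fun q => ¬ G.Adj q.1 q.2).card ≤
        ∑ i, (Finset.univ.filter fun j => dist (P j) (P i) ≤ R).card := by
      rw [← Finset.card_sigma]
      refine Finset.card_le_card_of_injOn (fun q => ⟨q.1, q.2⟩) ?_ ?_
      · intro q hq
        obtain ⟨hqE, hqG⟩ := Finset.mem_filter.1 hq
        refine Finset.mem_sigma.2 ⟨Finset.mem_univ _, Finset.mem_filter.2 ⟨Finset.mem_univ _, ?_⟩⟩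
        rw [dist_comm]
        exact not_lt.1 fun h => hqG ⟨h, (Finset.mem_filter.1 hqE).2.2⟩
      · rintro ⟨i, j⟩ _ ⟨i', j'⟩ _ h
        simpa using h
    refine (Nat.cast_le.2 h1).trans ?_
    rw [Nat.cast_sum]
    calc _ ≤ ∑ _i : Fin n, (A * c) ^ (k + 1) := Finset.sum_le_sum fun i _ =>
          hball _ (P i) fun j hj => (Finset.mem_filter.1 hj).2
      _ = _ := by simp
  have hedges : 2 * ((E.filter fun q => G.Adj q.1 q.2).card : ℝ) ≤ (cliqueTuples G 2).card := by
    norm_cast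
    exact two_mul_card_le_card_cliqueTuples
      (fun q hq => (Finset.mem_filter.1 (Finset.mem_filter.1 hq).1).2.1)
      fun q hq => (Finset.mem_filter.1 hq).2
  have hsplit : ((E.filter fun q => G.Adj q.1 q.2).card : ℝ) +
      (E.filter fun q => ¬ G.Adj q.1 q.2).card = E.card := by
    exact_mod_cast Finset.card_filter_add_card_filter_not _
  have hmany : (1 - 1 / (twoDistMax k : ℝ) + 1 / c) * (Fintype.card (Fin n) : ℝ) ^ 2 ≤
      (cliqueTuples G 2).card := by
    rw [Fintype.card_fin]
    have h1 : n * (A * c) ^ (k + 1) ≤ n ^ 2 / c := by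
      rw [le_div_iff₀ hc0]
      nlinarith
    have h2 : (n : ℝ) ^ 2 / 2 * (1 - 1 / (twoDistMax k : ℝ) + 3 / c) =
      ((1 - 1 / (twoDistMax k : ℝ) + 1 / c) * n ^ 2) / 2 + n ^ 2 / c := by ring
    linarith
  have hfinal : ∀ s₁ s₂ : ℝ, s₁ ≤ s₂ → c ≤ ε * s₁ →
      (∀ a b, G.Adj a b → dist (P a) (P b) ∈ Set.Icc s₁ (s₁ + c) ∨
        dist (P a) (P b) ∈ Set.Icc s₂ (s₂ + c)) → False := by
    intro s₁ s₂ hs hcs hG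
    obtain ⟨S, hS, hSP⟩ := hcluster (Fin n) P G s₁ s₂ c (1 / c) hc0 hcs hs (by positivity) hG hmany
    rw [Fintype.card_fin, one_div_mul_eq_div, div_le_iff₀ hc0] at hS
    have hne : S.Nonempty := by
      rw [Finset.nonempty_iff_ne_empty]
      rintro rfl
      simp only [Finset.card_empty, Nat.cast_zero, mul_zero, zero_mul] at hS
      linarith
    obtain ⟨a, ha⟩ := hne
    have h1 := hball S (P a) fun i hi => by
      rw [hR, le_div_iff₀ hε, mul_comm]
      exact (hSP i hi a ha).le
    have h2 : Λ * S.card * c ≤ Λ * (A * c) ^ (k + 1) * c := by gcongr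
    linarith
  have hRε : c = ε * R := by rw [hR, mul_div_cancel₀ _ hε.ne']
  have hmax : ∀ t a b, R < dist (P a) (P b) → dist (P a) (P b) ∈ Set.Icc t (t + c) →
      dist (P a) (P b) ∈ Set.Icc (max t R) (max t R + c) := fun t a b h h' =>
    ⟨max_le h'.1 h.le, h'.2.trans (by gcongr; exact le_max_left _ _)⟩
  have hlarge : ∀ t, c ≤ ε * max t R := fun t => by
    nth_rewrite 1 [hRε]
    gcongr
    exact le_max_right _ _
  rcases le_total (max t₁ R) (max t₂ R) with h | h
  · exact hfinal _ _ h (hlarge _) fun a b hab => hab.2.imp (hmax _ _ _ hab.1) (hmax _ _ _ hab.1)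
  · exact hfinal _ _ h (hlarge _) fun a b hab =>
      (hab.2.imp (hmax _ _ _ hab.1) (hmax _ _ _ hab.1)).symm

theorem two_nearly_equal_distances_upper_bound_dim_four_five
    (d : ℕ) (hd : d = 4 ∨ d = 5) :
    ∃ (N : ℕ) (K : ℝ) (c : ℕ → ℝ), 0 < K ∧
      Filter.Tendsto c Filter.atTop Filter.atTop ∧
      ∀ (t₁ t₂ : ℝ), 1 ≤ t₁ → 1 ≤ t₂ →
        ∀ (n : ℕ), N ≤ n →
          ∀ P : Fin n → EuclideanSpace ℝ (Fin d),
            (∀ i j, i ≠ j → 1 ≤ dist (P i) (P j)) →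
            ((Finset.univ.filter fun q : Fin n × Fin n => q.1 < q.2 ∧
                (dist (P q.1) (P q.2) ∈ Set.Icc t₁ (t₁ + c n) ∨
                 dist (P q.1) (P q.2) ∈ Set.Icc t₂ (t₂ + c n))).card : ℝ)
              ≤ (n : ℝ) ^ 2 / 2 *
                  (1 - 1 / (twoDistMax (d - 1) : ℝ) + K / Real.log n) := by
  have hlog : Filter.Tendsto (fun n : ℕ => Real.log n) Filter.atTop Filter.atTop :=
    Real.tendsto_log_atTop.comp tendsto_natCast_atTop_atTop
  obtain ⟨k, rfl⟩ : ∃ k, d = k + 1 := ⟨d - 1, by omega⟩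
  obtain ⟨N, hN⟩ := two_nearly_equal_distances_upper_bound k
  exact ⟨N, 3, fun n => Real.log n, by norm_num, hlog, fun t₁ t₂ _ _ n hn => hN t₁ t₂ n hn⟩
end

section
/- For every integer d ≥ 2 and every integer n ≥ 1 there exist real numbers t_1, t_2 ≥ 1 and a separated set {P_1, ..., P_n} of n points in Euclidean space R^d such that the number of unordered pairs {i, j} (i ≠ j) with dist(P_i, P_j) ∈ [t_1, t_1 + 1] ∪ [t_2, t_2 + 1] is at least the Turán number T(n, m_{d−1} + 1). In other words, the upper bound T(n, m_{d−1} + 1) of the main theorem cannot be reduced to T(n, m_{d−1} + 1) − 1. -/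
open scoped Classical

/-- The Turán number `T(n, r)`: the number of edges of the Turán graph on `n`
vertices with `r - 1` parts (the maximum number of edges of a `Kᵣ`-free graph
on `n` vertices). -/
noncomputable def turanNum (n r : ℕ) : ℕ :=
  (SimpleGraph.turanGraph n (r - 1)).edgeFinset.card

/-- If every edge `{i, j}` of `G` with `i < j` satisfies `p`, then `G` has at most as many edges as
there are increasing pairs satisfying `p`. -/
theorem card_edgeFinset_le_card_filter_lt {n : ℕ} (G : SimpleGraph (Fin n)) [Fintype G.edgeSet]
    (p : Fin n → Fin n → Prop) (h : ∀ i j, i < j → G.Adj i j → p i j) :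
    G.edgeFinset.card ≤
      (Finset.univ.filter fun q : Fin n × Fin n => q.1 < q.2 ∧ p q.1 q.2).card := by
  refine (Finset.card_le_card (t := (Finset.univ.filter fun q : Fin n × Fin n =>
    q.1 < q.2 ∧ p q.1 q.2).image fun q => s(q.1, q.2)) ?_).trans Finset.card_image_le
  intro e he
  rw [SimpleGraph.mem_edgeFinset] at he
  induction e using Sym2.ind with
  | _ i j =>
    rw [SimpleGraph.mem_edgeSet] at he
    rw [Finset.mem_image]
    rcases lt_or_gt_of_ne he.ne with hij | hij
    · exact ⟨(i, j), by simpa [hij] using h i j hij he, rfl⟩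
    · exact ⟨(j, i), by simpa [hij] using h j i hij he.symm, Sym2.eq_swap⟩

/-- A set of positive reals with at most two elements is contained in a pair of positive reals. -/
theorem exists_pos_pair_of_ncard_le_two {D : Set ℝ} (hfin : D.Finite) (hpos : ∀ x ∈ D, 0 < x)
    (hcard : D.ncard ≤ 2) : ∃ a b : ℝ, 0 < a ∧ 0 < b ∧ ∀ x ∈ D, x = a ∨ x = b := by
  have hc : D.ncard = 0 ∨ D.ncard = 1 ∨ D.ncard = 2 := by omega
  rcases hc with hc | hc | hc
  · rw [Set.ncard_eq_zero hfin] at hc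
    exact ⟨1, 1, one_pos, one_pos, by simp [hc]⟩
  · obtain ⟨a, rfl⟩ := Set.ncard_eq_one.mp hc
    exact ⟨a, a, hpos a rfl, hpos a rfl, fun x hx => Or.inl hx⟩
  · obtain ⟨a, b, -, rfl⟩ := Set.ncard_eq_two.mp hc
    exact ⟨a, b, hpos a (by simp), hpos b (by simp), fun x hx => by simpa using hx⟩

/-- The set whose supremum is `twoDistMax j` contains a positive `k` such that vertices adjacent in
the Turán graph with `twoDistMax j` parts are incongruent modulo `k`. This does not require that
supremum to be finite. -/
theorem exists_two_distance_set_turanGraph (j n : ℕ) :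
    ∃ s : Finset (EuclideanSpace ℝ (Fin j)), 0 < s.card ∧
      ({d : ℝ | ∃ x ∈ s, ∃ y ∈ s, x ≠ y ∧ d = dist x y}).ncard ≤ 2 ∧
      ∀ v w : Fin n, (SimpleGraph.turanGraph n (twoDistMax j)).Adj v w →
        (v : ℕ) % s.card ≠ w % s.card := by
  set S : Set ℕ := {n : ℕ | ∃ s : Finset (EuclideanSpace ℝ (Fin j)), s.card = n ∧
    ({d : ℝ | ∃ x ∈ s, ∃ y ∈ s, x ≠ y ∧ d = dist x y}).ncard ≤ 2}
  have h1 : 1 ∈ S := by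
    refine ⟨{0}, Finset.card_singleton _, ?_⟩
    have : {d : ℝ | ∃ x ∈ ({0} : Finset (EuclideanSpace ℝ (Fin j))),
        ∃ y ∈ ({0} : Finset (EuclideanSpace ℝ (Fin j))), x ≠ y ∧ d = dist x y} = ∅ := by
      ext d
      simp +contextual
    rw [this]
    simp
  by_cases hb : BddAbove S
  · obtain ⟨s, hs, hD⟩ := Nat.sSup_mem ⟨1, h1⟩ hb
    have hle : 1 ≤ sSup S := le_csSup hb h1
    refine ⟨s, by omega, hD, fun v w hvw => ?_⟩
    rw [hs]
    exact hvw
  · rw [not_bddAbove_iff] at hb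
    obtain ⟨k, ⟨s, rfl, hD⟩, hk⟩ := hb n
    refine ⟨s, by omega, hD, fun v w hvw => ?_⟩
    rw [Nat.mod_eq_of_lt (v.2.trans hk), Nat.mod_eq_of_lt (w.2.trans hk)]
    exact Fin.val_ne_of_ne hvw.ne

/-- The point of `ℝ^(e+1)` with first coordinate `c` and remaining coordinates `x`. -/
noncomputable def consPoint {e : ℕ} (c : ℝ) (x : EuclideanSpace ℝ (Fin e)) :
    EuclideanSpace ℝ (Fin (e + 1)) :=
  WithLp.toLp 2 (Fin.cons c x)

theorem dist_consPoint {e : ℕ} (c c' : ℝ) (x y : EuclideanSpace ℝ (Fin e)) :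
    dist (consPoint c x) (consPoint c' y) = √((c - c') ^ 2 + dist x y ^ 2) := by
  rw [EuclideanSpace.dist_eq, EuclideanSpace.dist_eq x y,
    Real.sq_sqrt (Finset.sum_nonneg fun _ _ => sq_nonneg _), Fin.sum_univ_succ]
  simp [consPoint, Real.dist_eq]

theorem sqrt_add_sq_mem_Icc {u r : ℝ} (hr : 0 ≤ r) (hu : u ^ 2 ≤ 2 * r) :
    √(u ^ 2 + r ^ 2) ∈ Set.Icc r (r + 1) := by
  constructor
  · exact Real.le_sqrt_of_sq_le (by nlinarith [sq_nonneg u])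
  · exact Real.sqrt_le_iff.mpr ⟨by linarith, by nlinarith⟩

theorem two_nearly_equal_distances_lower_bound
    (d : ℕ) (hd : 2 ≤ d) (n : ℕ) (hn : 1 ≤ n) :
    ∃ (t₁ t₂ : ℝ), 1 ≤ t₁ ∧ 1 ≤ t₂ ∧
      ∃ P : Fin n → EuclideanSpace ℝ (Fin d),
        (∀ i j, i ≠ j → 1 ≤ dist (P i) (P j)) ∧
        turanNum n (twoDistMax (d - 1) + 1) ≤
          (Finset.univ.filter fun q : Fin n × Fin n => q.1 < q.2 ∧
              (dist (P q.1) (P q.2) ∈ Set.Icc t₁ (t₁ + 1) ∨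
               dist (P q.1) (P q.2) ∈ Set.Icc t₂ (t₂ + 1))).card := by
  obtain ⟨e, rfl⟩ : ∃ e, d = e + 1 := ⟨d - 1, by omega⟩
  simp only [Nat.add_sub_cancel]
  obtain ⟨s, hs, hD, hadj⟩ := exists_two_distance_set_turanGraph e n
  obtain ⟨a, b, ha, hb, hab⟩ := exists_pos_pair_of_ncard_le_two
    (D := {d : ℝ | ∃ x ∈ s, ∃ y ∈ s, x ≠ y ∧ d = dist x y})
    (((s ×ˢ s).image fun q => dist q.1 q.2).finite_toSet.subset (by
      rintro _ ⟨x, hx, y, hy, -, rfl⟩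
      exact Finset.mem_coe.mpr
        (Finset.mem_image.mpr ⟨(x, y), Finset.mk_mem_product hx hy, rfl⟩)))
    (by
      rintro _ ⟨x, -, y, -, hxy, rfl⟩
      exact dist_pos.mpr hxy) hD
  obtain ⟨c, hc, hca, hcb⟩ :
      ∃ c : ℝ, 0 < c ∧ (n : ℝ) ^ 2 + 1 ≤ c * a ∧ (n : ℝ) ^ 2 + 1 ≤ c * b := by
    have hm : 0 < min a b := lt_min ha hb
    have hc : 0 < ((n : ℝ) ^ 2 + 1) / min a b := by positivity
    refine ⟨_, hc, ?_, ?_⟩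
    · calc (n : ℝ) ^ 2 + 1 = ((n : ℝ) ^ 2 + 1) / min a b * min a b := by field_simp
        _ ≤ _ := by gcongr; exact min_le_left a b
    · calc (n : ℝ) ^ 2 + 1 = ((n : ℝ) ^ 2 + 1) / min a b * min a b := by field_simp
        _ ≤ _ := by gcongr; exact min_le_right a b
  have hn0 := sq_nonneg (n : ℝ)
  let p : Fin n → EuclideanSpace ℝ (Fin e) := fun i =>
    s.equivFin.symm ⟨(i : ℕ) % s.card, Nat.mod_lt _ hs⟩
  refine ⟨c * a, c * b, by linarith, by linarith,
    fun i => consPoint (i : ℕ) (c • p i), fun i j hij => ?_, ?_⟩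
  · rw [dist_consPoint]
    refine Real.le_sqrt_of_sq_le ?_
    have hz : ((i : ℕ) : ℤ) - (j : ℕ) ≠ 0 := by omega
    have h1 : (1 : ℝ) ≤ |((i : ℕ) : ℝ) - (j : ℕ)| := by exact_mod_cast Int.one_le_abs hz
    rw [← sq_abs (((i : ℕ) : ℝ) - (j : ℕ))]
    nlinarith [sq_nonneg (dist (c • p i) (c • p j))]
  · unfold turanNum
    rw [Nat.add_sub_cancel]
    convert card_edgeFinset_le_card_filter_lt (SimpleGraph.turanGraph n (twoDistMax e))
      (fun i j => dist (consPoint (i : ℕ) (c • p i)) (consPoint (j : ℕ) (c • p j)) ∈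
          Set.Icc (c * a) (c * a + 1) ∨
        dist (consPoint (i : ℕ) (c • p i)) (consPoint (j : ℕ) (c • p j)) ∈
          Set.Icc (c * b) (c * b + 1)) fun i j _ hij => ?_
    have hp : p i ≠ p j := fun h =>
      hadj i j hij (Fin.mk.inj_iff.mp (s.equivFin.symm.injective (Subtype.ext h)))
    have hsq : (((i : ℕ) : ℝ) - (j : ℕ)) ^ 2 ≤ (n : ℝ) ^ 2 := by
      have hi : ((i : ℕ) : ℝ) ≤ n := by exact_mod_cast i.2.le
      have hj : ((j : ℕ) : ℝ) ≤ n := by exact_mod_cast j.2.le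
      have hi0 : (0 : ℝ) ≤ (i : ℕ) := Nat.cast_nonneg _
      have hj0 : (0 : ℝ) ≤ (j : ℕ) := Nat.cast_nonneg _
      exact sq_le_sq' (by linarith) (by linarith)
    simp only [dist_consPoint, dist_smul₀, Real.norm_of_nonneg hc.le]
    rcases hab _ ⟨p i, Subtype.prop _, p j, Subtype.prop _, hp, rfl⟩ with h | h <;> rw [h]
    · exact Or.inl (sqrt_add_sq_mem_Icc (by linarith) (by linarith))
    · exact Or.inr (sqrt_add_sq_mem_Icc (by linarith) (by linarith))
end

section
/- For all integers d ≥ 1 and k ≥ 1 there exists ε_{d,k} > 0 such that for every ε with 0 < ε < ε_{d,k}, every weakly (ε, k)-distance set in Euclidean space R^d has cardinality at most (d + 1)^k. -/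
/-- A finite subset `s` of Euclidean space `ℝ^d` is a weakly `(ε, k)`-distance
set if there exist `t_1, ..., t_k > 0` such that every distance between two
distinct points of `s` lies in `⋃_{p} [t_p, t_p(1 + ε)]`. -/
def IsWeaklyEpsKDistSet (d k : ℕ) (ε : ℝ)
    (s : Finset (EuclideanSpace ℝ (Fin d))) : Prop :=
  ∃ t : Fin k → ℝ, (∀ p, 0 < t p) ∧
    ∀ x ∈ s, ∀ y ∈ s, x ≠ y →
      ∃ p, dist x y ∈ Set.Icc (t p) (t p * (1 + ε))

open scoped Pointwise

/-- The constant function `1` (for `none`) and the coordinate functions (for `some i`). -/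
def affineCoord (d : ℕ) (o : Option (Fin d)) (x : EuclideanSpace ℝ (Fin d)) : ℝ :=
  o.elim 1 fun i => x i

/-- The space of affine functions on `ℝ^d`; its `n`-th power is the space of polynomial functions
of degree at most `n`. -/
def affineFunctions (d : ℕ) : Submodule ℝ (EuclideanSpace ℝ (Fin d) → ℝ) :=
  Submodule.span ℝ (Set.range (affineCoord d))

theorem affineCoord_mem (d : ℕ) (o : Option (Fin d)) : affineCoord d o ∈ affineFunctions d :=
  Submodule.subset_span ⟨o, rfl⟩

theorem one_mem_affineFunctions (d : ℕ) : 1 ∈ affineFunctions d :=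
  affineCoord_mem d none

theorem affineFunctions_pow_mono (d : ℕ) {m n : ℕ} (h : m ≤ n) :
    affineFunctions d ^ m ≤ affineFunctions d ^ n :=
  pow_le_pow_right₀ (Submodule.one_le.2 (one_mem_affineFunctions d)) h

/-- If there are more than `(d + 1) ^ n` points, some nonzero weight on them annihilates all
polynomial functions of degree at most `n`. -/
theorem exists_weight_annihilating {d : ℕ} (n : ℕ) (s : Finset (EuclideanSpace ℝ (Fin d)))
    (hs : (d + 1) ^ n < s.card) :
    ∃ f : s → ℝ, f ≠ 0 ∧ ∀ p ∈ affineFunctions d ^ n, ∑ x, f x * p x = 0 := by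
  let L : (s → ℝ) →ₗ[ℝ] ((Fin n → Option (Fin d)) → ℝ) :=
    LinearMap.pi fun c => ∑ x : s, (∏ j, affineCoord d (c j) x) • LinearMap.proj x
  have hL : LinearMap.ker L ≠ ⊥ := by
    apply LinearMap.ker_ne_bot_of_finrank_lt
    simpa using hs
  obtain ⟨f, hf, hf0⟩ := Submodule.exists_mem_ne_zero_of_ne_bot hL
  refine ⟨f, hf0, fun p hp => ?_⟩
  rw [affineFunctions, Submodule.span_pow] at hp
  induction hp using Submodule.span_induction with
  | mem p hp =>
    obtain ⟨g, rfl⟩ := Set.mem_pow.1 hp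
    choose c hc using fun j => (g j).2
    have := congrFun (LinearMap.mem_ker.1 hf) c
    simp only [L, LinearMap.pi_apply, LinearMap.sum_apply, LinearMap.smul_apply,
      LinearMap.proj_apply, smul_eq_mul, Pi.zero_apply] at this
    rw [← this]
    refine Finset.sum_congr rfl fun x _ => ?_
    rw [List.prod_ofFn, Finset.prod_apply, mul_comm]
    simp only [← hc]
  | zero => simp
  | add p q _ _ hp hq => simp only [Pi.add_apply, mul_add, Finset.sum_add_distrib, hp, hq, add_zero]
  | smul a p _ hp =>
    simp only [Pi.smul_apply, smul_eq_mul, mul_left_comm _ a, ← Finset.mul_sum, hp, mul_zero]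

/-- Products `p x * q y` of polynomial functions with total degree at most `2 * n`. -/
def bipolynomials (d n : ℕ) :
    Set (EuclideanSpace ℝ (Fin d) × EuclideanSpace ℝ (Fin d) → ℝ) :=
  {h | ∃ a b p q, a + b ≤ 2 * n ∧ p ∈ affineFunctions d ^ a ∧ q ∈ affineFunctions d ^ b ∧
    h = fun z => p z.1 * q z.2}

theorem bipolynomials_mul_subset (d m n : ℕ) :
    bipolynomials d m * bipolynomials d n ⊆ bipolynomials d (m + n) := by
  rintro _ ⟨_, ⟨a, b, p, q, hab, hp, hq, rfl⟩, _, ⟨a', b', p', q', hab', hp', hq', rfl⟩, rfl⟩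
  refine ⟨a + a', b + b', p * p', q * q', by omega, ?_, ?_, ?_⟩
  · rw [pow_add]; exact Submodule.mul_mem_mul hp hp'
  · rw [pow_add]; exact Submodule.mul_mem_mul hq hq'
  · ext z
    simp only [Pi.mul_apply]
    ring

theorem dist_sq_sub_mem_span_bipolynomials (d : ℕ) (t : ℝ) :
    (fun z : EuclideanSpace ℝ (Fin d) × EuclideanSpace ℝ (Fin d) => dist z.1 z.2 ^ 2 - t ^ 2) ∈
      Submodule.span ℝ (bipolynomials d 1) := by
  have h0 : (1 : EuclideanSpace ℝ (Fin d) → ℝ) ∈ affineFunctions d ^ 0 := by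
    rw [pow_zero]; exact Submodule.one_le.1 le_rfl
  have h1 (i : Fin d) : affineCoord d (some i) ∈ affineFunctions d ^ 1 := by
    rw [pow_one]; exact affineCoord_mem d _
  have h2 (i : Fin d) :
      affineCoord d (some i) * affineCoord d (some i) ∈ affineFunctions d ^ 2 := by
    rw [pow_two]; exact Submodule.mul_mem_mul (affineCoord_mem d _) (affineCoord_mem d _)
  have key : (fun z : EuclideanSpace ℝ (Fin d) × EuclideanSpace ℝ (Fin d) =>
      dist z.1 z.2 ^ 2 - t ^ 2) =
      (∑ i : Fin d,
        ((fun z => (affineCoord d (some i) * affineCoord d (some i)) z.1 *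
            (1 : EuclideanSpace ℝ (Fin d) → ℝ) z.2) +
          (fun z => (1 : EuclideanSpace ℝ (Fin d) → ℝ) z.1 *
            (affineCoord d (some i) * affineCoord d (some i)) z.2) +
          (-2 : ℝ) • (fun z => affineCoord d (some i) z.1 * affineCoord d (some i) z.2))) +
      (-t ^ 2 : ℝ) • (fun z => (1 : EuclideanSpace ℝ (Fin d) → ℝ) z.1 *
        (1 : EuclideanSpace ℝ (Fin d) → ℝ) z.2) := by
    ext z
    rw [EuclideanSpace.dist_eq, Real.sq_sqrt (by positivity)]
    simp only [Pi.add_apply, Finset.sum_apply, Pi.smul_apply, Pi.mul_apply, affineCoord,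
      Option.elim, Pi.one_apply, smul_eq_mul, Real.dist_eq, sq_abs]
    rw [sub_eq_add_neg]
    congr 1
    · exact Finset.sum_congr rfl fun i _ => by ring
    · ring
  rw [key]
  refine add_mem (sum_mem fun i _ => add_mem (add_mem ?_ ?_) (Submodule.smul_mem _ _ ?_))
    (Submodule.smul_mem _ _ ?_) <;> apply Submodule.subset_span
  · exact ⟨2, 0, _, _, by norm_num, h2 i, h0, rfl⟩
  · exact ⟨0, 2, _, _, by norm_num, h0, h2 i, rfl⟩
  · exact ⟨1, 1, _, _, by norm_num, h1 i, h1 i, rfl⟩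
  · exact ⟨0, 0, _, _, by norm_num, h0, h0, rfl⟩

theorem prod_dist_sq_sub_mem_span_bipolynomials (d : ℕ) (T : Finset ℝ) :
    (∏ t ∈ T, fun z : EuclideanSpace ℝ (Fin d) × EuclideanSpace ℝ (Fin d) =>
      dist z.1 z.2 ^ 2 - t ^ 2) ∈ Submodule.span ℝ (bipolynomials d T.card) := by
  classical
  induction T using Finset.induction_on with
  | empty =>
    refine Submodule.subset_span ⟨0, 0, 1, 1, by simp, ?_, ?_, ?_⟩
    · rw [pow_zero]; exact Submodule.one_le.1 le_rfl
    · rw [pow_zero]; exact Submodule.one_le.1 le_rfl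
    · ext; simp
  | insert t T ht ih =>
    rw [Finset.prod_insert ht, Finset.card_insert_of_notMem ht, add_comm T.card]
    refine Submodule.span_mono (bipolynomials_mul_subset d 1 T.card) ?_
    rw [← Submodule.span_mul_span]
    exact Submodule.mul_mem_mul (dist_sq_sub_mem_span_bipolynomials d t) ih

/-- A weight annihilating polynomial functions of degree at most `n` annihilates two-variable
polynomial functions of total degree at most `2 * n`. -/
theorem sum_weight_eq_zero_of_mem_span_bipolynomials {d n : ℕ}
    {s : Finset (EuclideanSpace ℝ (Fin d))} {f : s → ℝ}
    (hf : ∀ p ∈ affineFunctions d ^ n, ∑ x, f x * p x = 0)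
    {F : EuclideanSpace ℝ (Fin d) × EuclideanSpace ℝ (Fin d) → ℝ}
    (hF : F ∈ Submodule.span ℝ (bipolynomials d n)) :
    ∑ x, ∑ y, f x * f y * F (x, y) = 0 := by
  induction hF using Submodule.span_induction with
  | mem F hF =>
    obtain ⟨a, b, p, q, hab, hp, hq, rfl⟩ := hF
    have : ∑ x, ∑ y, f x * f y * (p x * q y) = (∑ x, f x * p x) * ∑ y, f y * q y := by
      rw [Finset.sum_mul_sum]
      exact Finset.sum_congr rfl fun x _ => Finset.sum_congr rfl fun y _ => by ring
    rw [this]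
    rcases le_or_gt a n with h | h
    · rw [hf p (affineFunctions_pow_mono d h hp), zero_mul]
    · rw [hf q (affineFunctions_pow_mono d (by omega) hq), mul_zero]
  | zero => simp
  | add F G _ _ hF hG => simp only [Pi.add_apply, mul_add, Finset.sum_add_distrib, hF, hG, add_zero]
  | smul a F _ hF =>
    simp only [Pi.smul_apply, smul_eq_mul, mul_left_comm _ a, ← Finset.mul_sum, hF, mul_zero]

/-- A quadratic form whose matrix is strictly dominated by a constant diagonal is definite. -/
theorem eq_zero_of_sum_eq_zero_of_diagonal_dominant {ι : Type*} [Fintype ι] {A : ι → ι → ℝ}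
    {D η : ℝ} (hη : 0 ≤ η) (hdiag : ∀ x, A x x = D) (hoff : ∀ x y, x ≠ y → |A x y| ≤ η)
    (hlt : Fintype.card ι * η < |D|) {f : ι → ℝ} (hf : ∑ x, ∑ y, f x * f y * A x y = 0) :
    f = 0 := by
  classical
  set Q := ∑ x, f x ^ 2 with hQ
  have hQ0 : 0 ≤ Q := Finset.sum_nonneg fun x _ => sq_nonneg _
  have hsplit : D * Q = -∑ x, ∑ y, f x * f y * (if x = y then 0 else A x y) := by
    have : ∑ x, ∑ y, f x * f y * A x y =
        D * Q + ∑ x, ∑ y, f x * f y * (if x = y then 0 else A x y) := by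
      rw [hQ, Finset.mul_sum, ← Finset.sum_add_distrib]
      refine Finset.sum_congr rfl fun x _ => ?_
      have hx : D * f x ^ 2 = ∑ y, if x = y then f x * f y * A x y else 0 := by
        simp [hdiag]; ring
      rw [hx, ← Finset.sum_add_distrib]
      refine Finset.sum_congr rfl fun y _ => ?_
      split_ifs <;> simp
    linarith
  have hbound : |D| * Q ≤ Fintype.card ι * η * Q := by
    calc |D| * Q = |D * Q| := by rw [abs_mul, abs_of_nonneg hQ0]
      _ ≤ ∑ x, ∑ y, |f x * f y * (if x = y then 0 else A x y)| := by
        rw [hsplit, abs_neg]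
        exact (Finset.abs_sum_le_sum_abs _ _).trans
          (Finset.sum_le_sum fun x _ => Finset.abs_sum_le_sum_abs _ _)
      _ ≤ ∑ x, ∑ y, η * |f x| * |f y| := by
        refine Finset.sum_le_sum fun x _ => Finset.sum_le_sum fun y _ => ?_
        have : |if x = y then 0 else A x y| ≤ η := by
          split_ifs with h
          · simpa using hη
          · exact hoff x y h
        rw [abs_mul, abs_mul]
        nlinarith [mul_nonneg (abs_nonneg (f x)) (abs_nonneg (f y))]
      _ = η * (∑ x, |f x|) ^ 2 := by
        simp only [mul_assoc, ← Finset.mul_sum, pow_two, ← Finset.sum_mul]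
      _ ≤ η * (Fintype.card ι * Q) := by
        gcongr
        simpa [hQ] using sq_sum_le_card_mul_sum_sq (s := Finset.univ) (f := fun x => |f x|)
      _ = Fintype.card ι * η * Q := by ring
  have hQz : Q = 0 := by nlinarith
  ext x
  simpa using (Finset.sum_eq_zero_iff_of_nonneg fun x _ => sq_nonneg (f x)).1 hQz x
    (Finset.mem_univ x)

/-- Every distance between distinct points of `s` lies in `[t, t (1 + ε)]` for some `t ∈ T`. -/
def DistancesNear {α : Type*} [Dist α] (ε : ℝ) (T : Finset ℝ) (s : Finset α) : Prop :=
  ∀ x ∈ s, ∀ y ∈ s, x ≠ y → ∃ t ∈ T, dist x y ∈ Set.Icc t (t * (1 + ε))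

theorem abs_prod_sq_sub_le {T : Finset ℝ} {R ε r t : ℝ} (hpos : ∀ t ∈ T, 0 < t) (hR : 1 ≤ R)
    (hratio : ∀ t ∈ T, ∀ u ∈ T, u ≤ R * t) (hε0 : 0 < ε) (hε1 : ε < 1) (ht : t ∈ T)
    (hr : r ∈ Set.Icc t (t * (1 + ε))) :
    |∏ u ∈ T, (r ^ 2 - u ^ 2)| ≤ 3 * ε * (4 * R ^ 2) ^ T.card * ∏ u ∈ T, u ^ 2 := by
  classical
  obtain ⟨hr1, hr2⟩ := hr
  have ht0 := hpos t ht
  have hmain : |r ^ 2 - t ^ 2| ≤ 3 * ε * t ^ 2 := by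
    rw [abs_of_nonneg (by nlinarith)]
    have : r ^ 2 ≤ (t * (1 + ε)) ^ 2 := by gcongr; linarith
    nlinarith [mul_pos hε0 (sq_pos_of_pos ht0)]
  have hrest : ∀ u ∈ T.erase t, |r ^ 2 - u ^ 2| ≤ 4 * R ^ 2 * u ^ 2 := by
    intro u hu
    have hu := Finset.mem_of_mem_erase hu
    have hu0 := hpos u hu
    have h1 : r ≤ 2 * (R * u) := by nlinarith [hratio u hu t ht]
    have h2 : r ^ 2 ≤ (2 * (R * u)) ^ 2 := by gcongr; linarith
    have h3 : u ^ 2 ≤ R ^ 2 * u ^ 2 := by nlinarith [sq_nonneg u, one_le_pow₀ (n := 2) hR]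
    rw [abs_le]
    constructor <;> nlinarith [sq_nonneg r, sq_nonneg u]
  have hR4 : 1 ≤ 4 * R ^ 2 := by nlinarith
  rw [Finset.abs_prod, ← Finset.mul_prod_erase T _ ht, ← Finset.mul_prod_erase T (· ^ 2) ht]
  calc |r ^ 2 - t ^ 2| * ∏ u ∈ T.erase t, |r ^ 2 - u ^ 2|
      ≤ (3 * ε * t ^ 2) * ∏ u ∈ T.erase t, (4 * R ^ 2 * u ^ 2) := by
        gcongr with u hu
        exact hrest u hu
    _ = 3 * ε * (4 * R ^ 2) ^ (T.erase t).card * (t ^ 2 * ∏ u ∈ T.erase t, u ^ 2) := by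
        rw [Finset.prod_mul_distrib, Finset.prod_const]; ring
    _ ≤ 3 * ε * (4 * R ^ 2) ^ T.card * (t ^ 2 * ∏ u ∈ T.erase t, u ^ 2) := by
        gcongr
        exact Finset.erase_subset _ _

theorem DistancesNear.card_le_of_ratio_le {d : ℕ} {T : Finset ℝ} {R ε : ℝ}
    (hpos : ∀ t ∈ T, 0 < t) (hR : 1 ≤ R) (hratio : ∀ t ∈ T, ∀ u ∈ T, u ≤ R * t)
    (hε0 : 0 < ε) (hε1 : ε < 1)
    (hε : ((d + 1 : ℝ) ^ T.card + 1) * (3 * ε * (4 * R ^ 2) ^ T.card) < 1)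
    {s : Finset (EuclideanSpace ℝ (Fin d))} (hs : DistancesNear ε T s) :
    s.card ≤ (d + 1) ^ T.card := by
  by_contra! hcard
  obtain ⟨s', hs's, hs'⟩ := Finset.exists_subset_card_eq (Nat.succ_le_of_lt hcard)
  obtain ⟨f, hf0, hf⟩ := exists_weight_annihilating T.card s' (by omega)
  have hprod : 0 < ∏ u ∈ T, u ^ 2 := Finset.prod_pos fun u hu => pow_pos (hpos u hu) 2
  refine hf0 (eq_zero_of_sum_eq_zero_of_diagonal_dominant
    (D := ∏ u ∈ T, (-u ^ 2)) (η := 3 * ε * (4 * R ^ 2) ^ T.card * ∏ u ∈ T, u ^ 2) (by positivity)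
    (fun x => ?_) (fun x y hxy => ?_) ?_
    (sum_weight_eq_zero_of_mem_span_bipolynomials hf
      (prod_dist_sq_sub_mem_span_bipolynomials d T)))
  · simp
  · obtain ⟨t, ht, hr⟩ := hs x (hs's x.2) y (hs's y.2) fun h => hxy (Subtype.ext h)
    rw [Finset.prod_apply]
    exact abs_prod_sq_sub_le hpos hR hratio hε0 hε1 ht hr
  · have habs : |∏ u ∈ T, (-u ^ 2)| = ∏ u ∈ T, u ^ 2 := by simp [Finset.abs_prod]
    rw [habs, Fintype.card_coe, hs']
    push_cast
    nlinarith

/-- Either a finite set of positive reals is split by a gap `(c, 3 c]`, or its elements have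
bounded ratios. -/
theorem exists_gap_or_ratio_le (T : Finset ℝ) (hpos : ∀ t ∈ T, 0 < t) :
    (∃ c, (∃ t ∈ T, t ≤ c) ∧ (∃ t ∈ T, 3 * c < t) ∧ ∀ t ∈ T, t ≤ c ∨ 3 * c < t) ∨
      ∀ t ∈ T, ∀ u ∈ T, u ≤ 3 ^ T.card * t := by
  classical
  induction T using Finset.induction_on_max with
  | empty => simp
  | insert a T ha ih =>
    have hposT : ∀ t ∈ T, 0 < t := fun t ht => hpos t (Finset.mem_insert_of_mem ht)
    have ha0 : 0 < a := hpos a (Finset.mem_insert_self a T)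
    have haT : a ∉ T := fun h => lt_irrefl a (ha a h)
    have hge (t : ℝ) (ht : 0 < t) : t ≤ 3 ^ (T.card + 1) * t :=
      le_mul_of_one_le_left ht.le (one_le_pow₀ (by norm_num))
    rcases ih hposT with ⟨c, ⟨t, ht, htc⟩, ⟨u, hu, huc⟩, hc⟩ | hT
    · refine .inl ⟨c, ⟨t, Finset.mem_insert_of_mem ht, htc⟩,
        ⟨u, Finset.mem_insert_of_mem hu, huc⟩, fun v hv => ?_⟩
      rcases Finset.mem_insert.1 hv with rfl | hv
      · exact .inr (huc.trans (ha u hu))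
      · exact hc v hv
    · rw [Finset.card_insert_of_notMem haT]
      by_cases hgap : ∃ b ∈ T, a ≤ 3 * b
      · obtain ⟨b, hb, hab⟩ := hgap
        refine .inr fun t ht u hu => ?_
        rcases Finset.mem_insert.1 ht with rfl | htT <;>
          rcases Finset.mem_insert.1 hu with rfl | huT
        · exact hge _ ha0
        · exact (ha u huT).le.trans (hge _ ha0)
        · have := hT t htT b hb
          rw [pow_succ]
          linarith
        · have := hT t htT u huT
          have := hposT u huT
          rw [pow_succ]
          linarith
      · push Not at hgap
        rcases T.eq_empty_or_nonempty with rfl | hne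
        · refine .inr fun t ht u hu => ?_
          simp only [Finset.mem_insert, Finset.notMem_empty, or_false] at ht hu
          subst ht hu
          exact hge _ ha0
        · refine .inl ⟨T.max' hne, ⟨_, Finset.mem_insert_of_mem (T.max'_mem hne), le_rfl⟩,
            ⟨a, Finset.mem_insert_self a T, hgap _ (T.max'_mem hne)⟩, fun v hv => ?_⟩
          rcases Finset.mem_insert.1 hv with rfl | hv
          · exact .inr (hgap _ (T.max'_mem hne))
          · exact .inl (T.le_max' v hv)

/-- A gap in the set of distances splits a finite set into far apart clusters. -/
theorem DistancesNear.card_le_mul_of_gap {α : Type*} [MetricSpace α] {T : Finset ℝ} {ε c : ℝ}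
    (hc : 0 < c) (hε0 : 0 < ε) (hε : ε < 1 / 2) (hgap : ∀ t ∈ T, t ≤ c ∨ 3 * c < t) {m n : ℕ}
    (hm : ∀ s : Finset α, DistancesNear ε {t ∈ T | t ≤ c} s → s.card ≤ m)
    (hn : ∀ s : Finset α, DistancesNear ε {t ∈ T | 3 * c < t} s → s.card ≤ n)
    {s : Finset α} (hs : DistancesNear ε T s) : s.card ≤ n * m := by
  classical
  have hsmall : ∀ x ∈ s, ∀ y ∈ s, dist x y ≤ 3 * c → dist x y ≤ c * (1 + ε) := by
    intro x hx y hy hxy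
    rcases eq_or_ne x y with rfl | hne
    · rw [dist_self]; positivity
    · obtain ⟨t, ht, h1, h2⟩ := hs x hx y hy hne
      have htc : t ≤ c := (hgap t ht).resolve_right (by linarith)
      exact h2.trans (by gcongr)
  obtain ⟨S, hS, hmax⟩ := Finset.exists_max_image
    {S ∈ s.powerset | ∀ x ∈ S, ∀ y ∈ S, x ≠ y → 3 * c < dist x y} Finset.card ⟨∅, by simp⟩
  simp only [Finset.mem_filter, Finset.mem_powerset] at hS hmax
  obtain ⟨hSs, hsep⟩ := hS
  have hcover : s ⊆ S.biUnion fun x => {y ∈ s | dist x y ≤ 3 * c} := by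
    intro y hy
    by_contra hcon
    simp only [Finset.mem_biUnion, Finset.mem_filter, hy, true_and, not_exists, not_and,
      not_le] at hcon
    have hyS : y ∉ S := fun h => by
      have := hcon y h
      rw [dist_self] at this
      linarith
    have := hmax (insert y S) ⟨Finset.insert_subset hy hSs, by
      intro a ha b hb hab
      rcases Finset.mem_insert.1 ha with rfl | haS <;>
        rcases Finset.mem_insert.1 hb with rfl | hbS
      · exact absurd rfl hab
      · rw [dist_comm]; exact hcon b hbS
      · exact hcon a haS
      · exact hsep a haS b hbS hab⟩
    rw [Finset.card_insert_of_notMem hyS] at this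
    omega
  calc s.card ≤ _ := Finset.card_le_card hcover
    _ ≤ S.card * m := by
      refine Finset.card_biUnion_le_card_mul _ _ _ fun x hx => hm _ fun y hy z hz hyz => ?_
      rw [Finset.mem_filter] at hy hz
      obtain ⟨t, ht, h1, h2⟩ := hs y hy.1 z hz.1 hyz
      have hxy := hsmall x (hSs hx) y hy.1 hy.2
      have hxz := hsmall x (hSs hx) z hz.1 hz.2
      have := dist_triangle_left y z x
      exact ⟨t, Finset.mem_filter.2 ⟨ht, (hgap t ht).resolve_right (by nlinarith)⟩, h1, h2⟩
    _ ≤ n * m := by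
      refine Nat.mul_le_mul_right m (hn S fun x hx y hy hxy => ?_)
      obtain ⟨t, ht, h1, h2⟩ := hs x (hSs hx) y (hSs hy) hxy
      have hfar := hsep x hx y hy hxy
      exact ⟨t, Finset.mem_filter.2 ⟨ht, (hgap t ht).resolve_left fun h => by nlinarith⟩, h1, h2⟩

theorem DistancesNear.card_le {d k : ℕ} {ε : ℝ} (hε0 : 0 < ε) (hε1 : ε < 1 / 2)
    (hε : ((d + 1 : ℝ) ^ k + 1) * (3 * ε * (4 * (3 ^ k) ^ 2) ^ k) < 1) (T : Finset ℝ)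
    (hTk : T.card ≤ k) (hpos : ∀ t ∈ T, 0 < t) (s : Finset (EuclideanSpace ℝ (Fin d)))
    (hs : DistancesNear ε T s) : s.card ≤ (d + 1) ^ T.card := by
  classical
  induction T using Finset.strongInduction generalizing s with
  | H T ih =>
    rcases exists_gap_or_ratio_le T hpos with ⟨c, ⟨t, ht, htc⟩, ⟨u, hu, huc⟩, hgap⟩ | hratio
    · have hc : 0 < c := (hpos t ht).trans_le htc
      have key (p : ℝ → Prop) [DecidablePred p] (hp : ∃ t ∈ T, ¬ p t)
          (s : Finset (EuclideanSpace ℝ (Fin d))) (hs : DistancesNear ε {t ∈ T | p t} s) :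
          s.card ≤ (d + 1) ^ (T.filter p).card :=
        ih _ (Finset.filter_ssubset.2 hp) ((Finset.card_filter_le _ _).trans hTk)
          (fun t ht => hpos t (Finset.mem_filter.1 ht).1) s hs
      have hmul := DistancesNear.card_le_mul_of_gap hc hε0 hε1 hgap
        (key (· ≤ c) ⟨u, hu, by linarith⟩) (key (3 * c < ·) ⟨t, ht, by linarith⟩) hs
      rw [← pow_add] at hmul
      refine hmul.trans (Nat.pow_le_pow_right (by omega) ?_)
      rw [← Finset.card_union_of_disjoint]
      · exact Finset.card_le_card (Finset.union_subset (Finset.filter_subset _ _)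
          (Finset.filter_subset _ _))
      · refine Finset.disjoint_filter.2 fun v _ h1 h2 => ?_
        linarith
    · refine hs.card_le_of_ratio_le hpos (R := 3 ^ k) (one_le_pow₀ (by norm_num))
        (fun t ht u hu => (hratio t ht u hu).trans ?_) hε0 (by linarith) (hε.trans_le' ?_)
      · have := hpos t ht
        gcongr
        norm_num
      · have h1 : (1 : ℝ) ≤ 4 * (3 ^ k) ^ 2 := by
          have : (1 : ℝ) ≤ (3 ^ k) ^ 2 := one_le_pow₀ (one_le_pow₀ (by norm_num))
          linarith
        gcongr
        linarith [(Nat.cast_nonneg d : (0 : ℝ) ≤ d)]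

theorem weakly_eps_k_distance_set_card_le
    (d k : ℕ) (hd : 1 ≤ d) (hk : 1 ≤ k) :
    ∃ ε₀ : ℝ, 0 < ε₀ ∧
      ∀ ε : ℝ, 0 < ε → ε < ε₀ →
        ∀ s : Finset (EuclideanSpace ℝ (Fin d)),
          IsWeaklyEpsKDistSet d k ε s → s.card ≤ (d + 1) ^ k := by
  classical
  set C : ℝ := ((d + 1 : ℝ) ^ k + 1) * (3 * (4 * (3 ^ k) ^ 2) ^ k) with hC
  have hC0 : 0 < C := by positivity
  refine ⟨min (1 / 2) (1 / C), by positivity, fun ε hε0 hε s ⟨t, ht, hs⟩ => ?_⟩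
  obtain ⟨hε1, hε2⟩ := lt_min_iff.1 hε
  rw [lt_div_iff₀ hC0] at hε2
  have hcard : (Finset.univ.image t).card ≤ k := by
    simpa using Finset.card_image_le (s := Finset.univ) (f := t)
  refine (DistancesNear.card_le hε0 hε1 ?_ (Finset.univ.image t) hcard ?_ s ?_).trans
    (Nat.pow_le_pow_right (by omega) hcard)
  · calc _ = ε * C := by rw [hC]; ring
      _ < 1 := hε2
  · simpa using ht
  · intro x hx y hy hxy
    obtain ⟨p, hp⟩ := hs x hx y hy hxy
    exact ⟨t p, Finset.mem_image_of_mem t (Finset.mem_univ p), hp⟩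
end

section
/- For all integers d ≥ 1 and k ≥ 1 and every real ε > 0, there exists a weakly (ε, k)-distance set in Euclidean space R^d of cardinality exactly (d + 1)^k. -/
/-- Euclidean space of dimension `d` contains the vertices of a regular simplex of side `√2`. -/
theorem exists_fin_succ_dist_eq_sqrt_two (d : ℕ) (hd : 1 ≤ d) :
    ∃ v : Fin (d + 1) → EuclideanSpace ℝ (Fin d),
      ∀ i j, i ≠ j → dist (v i) (v j) = √2 := by
  classical
  have hd0 : (0 : ℝ) < d := by exact_mod_cast hd
  obtain ⟨a, ha⟩ : ∃ a : ℝ, d * a ^ 2 - 2 * a + 1 = 2 := by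
    refine ⟨(1 + √(1 + d)) / d, ?_⟩
    have hs : √(1 + (d : ℝ)) ^ 2 = 1 + d := Real.sq_sqrt (by positivity)
    field_simp
    linear_combination hs
  have hlast (i : Fin d) :
      dist (WithLp.toLp 2 fun _ => a : EuclideanSpace ℝ (Fin d))
        (EuclideanSpace.single i 1) = √2 := by
    rw [EuclideanSpace.dist_eq, ← ha]
    congr 1
    have h (x : Fin d) : dist a (if x = i then (1 : ℝ) else 0) ^ 2 =
        a ^ 2 + if x = i then 1 - 2 * a else 0 := by
      rw [Real.dist_eq, sq_abs]
      split_ifs <;> ring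
    simp only [PiLp.single_apply, h, Finset.sum_add_distrib, Finset.sum_const, Finset.card_univ,
      Fintype.card_fin, nsmul_eq_mul, Finset.sum_ite_eq', Finset.mem_univ,
      if_true]
    ring
  refine ⟨Fin.cons (WithLp.toLp 2 fun _ => a) fun i => EuclideanSpace.single i 1, fun i j => ?_⟩
  refine Fin.cases ?_ (fun i => ?_) i <;> refine Fin.cases ?_ (fun j => ?_) j <;> intro hij
  · exact absurd rfl hij
  · simpa using hlast j
  · simpa [dist_comm] using hlast i
  · have hij' : i ≠ j := fun h => hij (congrArg Fin.succ h)
    have h := EuclideanSpace.orthonormal_single (𝕜 := ℝ) (ι := Fin d)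
    rw [Fin.cons_succ, Fin.cons_succ, dist_eq_norm, eq_comm, Real.sqrt_eq_iff_mul_self_eq
      (by norm_num) (norm_nonneg _), norm_sub_sq_eq_norm_sq_add_norm_sq_real (h.2 hij')]
    norm_num

/-- Replacing every vertex of a large regular simplex by a copy of a weakly `(ε, k)`-distance set
gives a weakly `(ε, k + 1)`-distance set. -/
theorem IsWeaklyEpsKDistSet.exists_succ {d k : ℕ} (hd : 1 ≤ d) {ε : ℝ} (hε : 0 < ε)
    {s : Finset (EuclideanSpace ℝ (Fin d))} (hs : IsWeaklyEpsKDistSet d k ε s) :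
    ∃ s' : Finset (EuclideanSpace ℝ (Fin d)),
      IsWeaklyEpsKDistSet d (k + 1) ε s' ∧ s'.card = s.card * (d + 1) := by
  classical
  obtain ⟨v, hv⟩ := exists_fin_succ_dist_eq_sqrt_two d hd
  obtain ⟨t, ht, hst⟩ := hs
  set D := Metric.diam (s : Set (EuclideanSpace ℝ (Fin d)))
  have hD : 0 ≤ D := Metric.diam_nonneg
  have hsD {x y} (hx : x ∈ s) (hy : y ∈ s) : ‖x - y‖ ≤ D := by
    rw [← dist_eq_norm]
    exact Metric.dist_le_diam_of_mem s.finite_toSet.isBounded hx hy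
  set t₀ := 1 + 2 * D / ε
  have ht₀ : 0 < t₀ := by positivity
  have ht₀D : t₀ + 2 * D ≤ t₀ * (1 + ε) := by
    have : t₀ * ε = ε + 2 * D := by simp only [t₀]; field_simp
    linarith
  set R := (t₀ + D) / √2
  have hR : 0 ≤ R := by positivity
  have hRv {i j} (hij : i ≠ j) : ‖R • (v i - v j)‖ = t₀ + D := by
    rw [norm_smul, ← dist_eq_norm, hv i j hij, Real.norm_of_nonneg hR]
    exact div_mul_cancel₀ _ (by positivity)
  let f (p : EuclideanSpace ℝ (Fin d) × Fin (d + 1)) := p.1 + R • v p.2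
  have hfar {x y i j} (hx : x ∈ s) (hy : y ∈ s) (hij : i ≠ j) :
      dist (f (x, i)) (f (y, j)) ∈ Set.Icc t₀ (t₀ * (1 + ε)) := by
    have hsub : f (x, i) - f (y, j) = R • (v i - v j) + (x - y) := by
      simp only [f, smul_sub]; abel
    have h₁ := norm_add_le (R • (v i - v j)) (x - y)
    have h₂ := norm_sub_le_norm_add (R • (v i - v j)) (x - y)
    rw [dist_eq_norm, hsub]
    rw [hRv hij] at h₁ h₂
    have := hsD hx hy
    constructor <;> linarith
  refine ⟨(s ×ˢ Finset.univ).image f, ⟨Fin.cons t₀ t, Fin.cases ht₀ ht, ?_⟩, ?_⟩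
  · simp only [Finset.mem_image, Finset.mem_product, Finset.mem_univ, and_true]
    rintro _ ⟨⟨x, i⟩, hx, rfl⟩ _ ⟨⟨y, j⟩, hy, rfl⟩ hne
    by_cases hij : i = j
    · subst hij
      have hxy : x ≠ y := by rintro rfl; exact hne rfl
      obtain ⟨p, hp⟩ := hst x hx y hy hxy
      exact ⟨p.succ, by simpa [f] using hp⟩
    · exact ⟨0, hfar hx hy hij⟩
  · rw [Finset.card_image_of_injOn, Finset.card_product, Finset.card_univ, Fintype.card_fin]
    rintro ⟨x, i⟩ hx ⟨y, j⟩ hy hxy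
    simp only [Finset.coe_product, Set.mem_prod, Finset.mem_coe] at hx hy
    by_cases hij : i = j
    · subst hij
      simpa [f] using hxy
    · have := (hfar hx.1 hy.1 hij).1
      rw [hxy, dist_self] at this
      linarith

theorem exists_weakly_eps_k_distance_set_card_eq
    (d k : ℕ) (hd : 1 ≤ d) (hk : 1 ≤ k) (ε : ℝ) (hε : 0 < ε) :
    ∃ s : Finset (EuclideanSpace ℝ (Fin d)),
      IsWeaklyEpsKDistSet d k ε s ∧ s.card = (d + 1) ^ k := by
  clear hk
  induction k with
  | zero =>
    refine ⟨{0}, ⟨fun _ => 1, fun _ => one_pos, fun x hx y hy hxy => ?_⟩, by simp⟩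
    rw [Finset.mem_singleton] at hx hy
    exact absurd (hx.trans hy.symm) hxy
  | succ k ih =>
    obtain ⟨s, hs, hcard⟩ := ih
    obtain ⟨s', hs', hcard'⟩ := hs.exists_succ hd hε
    exact ⟨s', hs', by rw [hcard', hcard, pow_succ]⟩
end

section
/- For all integers d ≥ 1 and k ≥ 1 there exists ε_{d,k} > 0 such that for every ε with 0 < ε < ε_{d,k} the following holds: for every integer n ≥ 1, any n points P_1, ..., P_n in Euclidean space R^d, and any real numbers t_1, ..., t_k > 0, the number of unordered pairs {i, j} (i ≠ j) with dist(P_i, P_j) ∈ ⋃_{p=1}^{k} [t_p, t_p(1 + ε)] is at most the Turán number T(n, (d + 1)^k + 1). -/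
open scoped Classical

section spanning

variable {R : Type*} [CommRing R] {d : ℕ}

/-- Products of between `1` and `k + 1` of the elements `x i`. -/
noncomputable def coordProducts (x : Fin d → R) : ℕ → Finset R
  | 0 => Finset.univ.image x
  | k + 1 => coordProducts x k ∪
      Finset.univ.biUnion fun i => (coordProducts x k).image (x i * ·)

/-- Products of a positive power of `q` with some of the elements `x i`, with `k + 1` factors in
total. -/
noncomputable def quadricProducts (x : Fin d → R) (q : R) : ℕ → Finset R
  | 0 => {q}
  | k + 1 => insert (q ^ (k + 2))
      (Finset.univ.biUnion fun i => (quadricProducts x q k).image (x i * ·))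

lemma card_biUnion_image_mul_le (x : Fin d → R) (s : Finset R) :
    (Finset.univ.biUnion fun i => s.image (x i * ·)).card ≤ d * s.card := by
  refine (Finset.card_biUnion_le_card_mul _ _ s.card fun i _ => Finset.card_image_le).trans ?_
  simp

lemma card_coordProducts_le (x : Fin d → R) (k : ℕ) :
    (coordProducts x k).card ≤ d * (d + 1) ^ k := by
  induction k with
  | zero => simpa [coordProducts] using Finset.card_image_le (s := Finset.univ) (f := x)
  | succ k ih =>
    calc (coordProducts x (k + 1)).card
        ≤ (coordProducts x k).card + d * (coordProducts x k).card :=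
          (Finset.card_union_le _ _).trans
            (Nat.add_le_add_left (card_biUnion_image_mul_le _ _) _)
      _ = (d + 1) * (coordProducts x k).card := by ring
      _ ≤ (d + 1) * (d * (d + 1) ^ k) := Nat.mul_le_mul_left _ ih
      _ = d * (d + 1) ^ (k + 1) := by ring

lemma card_quadricProducts_le (x : Fin d → R) (q : R) (k : ℕ) :
    (quadricProducts x q k).card ≤ (d + 1) ^ k := by
  induction k with
  | zero => simp [quadricProducts]
  | succ k ih =>
    calc (quadricProducts x q (k + 1)).card
        ≤ d * (quadricProducts x q k).card + 1 :=
          (Finset.card_insert_le _ _).trans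
            (Nat.add_le_add_right (card_biUnion_image_mul_le _ _) _)
      _ ≤ d * (d + 1) ^ k + (d + 1) ^ k :=
          Nat.add_le_add (Nat.mul_le_mul_left _ ih) (Nat.one_le_pow _ _ d.succ_pos)
      _ = (d + 1) ^ (k + 1) := by ring

/-- The union of `coordProducts` and `quadricProducts`. -/
noncomputable def allProducts (x : Fin d → R) (q : R) (k : ℕ) : Finset R :=
  coordProducts x k ∪ quadricProducts x q k

lemma card_allProducts_le (x : Fin d → R) (q : R) (k : ℕ) :
    (allProducts x q k).card ≤ (d + 1) ^ (k + 1) := by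
  refine (Finset.card_union_le _ _).trans ((Nat.add_le_add (card_coordProducts_le x k)
    (card_quadricProducts_le x q k)).trans_eq ?_)
  ring

lemma coord_mul_mem_allProducts {x : Fin d → R} {q : R} (i : Fin d) {k : ℕ} {a : R} (ha : a ∈ allProducts x q k) :
    x i * a ∈ allProducts x q (k + 1) := by
  simp only [allProducts, coordProducts, quadricProducts, Finset.mem_union, Finset.mem_insert,
    Finset.mem_biUnion, Finset.mem_univ, Finset.mem_image, true_and] at ha ⊢
  rcases ha with ha | ha
  · exact Or.inl (Or.inr ⟨i, a, ha, rfl⟩)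
  · exact Or.inr (Or.inr ⟨i, a, ha, rfl⟩)

variable [Algebra ℝ R]

lemma mul_mem_of_mem_span {s : Set R} {M : Submodule ℝ R} {r f : R}
    (h : ∀ a ∈ s, r * a ∈ M) (hf : f ∈ Submodule.span ℝ s) : r * f ∈ M := by
  have : Submodule.span ℝ s ≤ M.comap (LinearMap.mulLeft ℝ r) :=
    Submodule.span_le.2 fun a ha => h a ha
  exact this hf

/-- The span of `allProducts`. -/
noncomputable def productSpan (x : Fin d → R) (q : R) (k : ℕ) : Submodule ℝ R :=
  Submodule.span ℝ (allProducts x q k : Set R)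

variable {x : Fin d → R} {q : R}

lemma coord_mul_mem_productSpan (i : Fin d) {k : ℕ} {a : R} (ha : a ∈ productSpan x q k) :
    x i * a ∈ productSpan x q (k + 1) :=
  mul_mem_of_mem_span (fun _ h => Submodule.subset_span (coord_mul_mem_allProducts i h)) ha

lemma pow_mem_productSpan (k : ℕ) : q ^ (k + 1) ∈ productSpan x q k := by
  refine Submodule.subset_span (Finset.mem_coe.2 (Finset.mem_union_right _ ?_))
  cases k <;> simp [quadricProducts]

lemma coordProducts_subset_productSpan {k : ℕ} {a : R} (ha : a ∈ coordProducts x k) :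
    a ∈ productSpan x q k :=
  Submodule.subset_span (Finset.mem_coe.2 (Finset.mem_union_left _ ha))

lemma productSpan_le_succ (hq : q = ∑ i, x i * x i) (k : ℕ) :
    productSpan x q k ≤ productSpan x q (k + 1) := by
  have hquad : ∀ k, ∀ a ∈ quadricProducts x q k, a ∈ productSpan x q (k + 1) := by
    intro k
    induction k with
    | zero =>
      intro a ha
      obtain rfl : a = q := by simpa [quadricProducts] using ha
      nth_rewrite 2 [hq]
      refine Submodule.sum_mem _ fun i _ => coord_mul_mem_productSpan i ?_
      exact coordProducts_subset_productSpan (by simp [coordProducts])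
    | succ k ih =>
      intro a ha
      simp only [quadricProducts, Finset.mem_insert, Finset.mem_biUnion, Finset.mem_univ,
        Finset.mem_image, true_and] at ha
      rcases ha with rfl | ⟨i, b, hb, rfl⟩
      · have : q ^ (k + 2) = ∑ i, x i * (x i * q ^ (k + 1)) := by
          simp_rw [← mul_assoc, ← Finset.sum_mul, ← hq]
          ring
        rw [this]
        exact Submodule.sum_mem _ fun i _ => coord_mul_mem_productSpan i
          (coord_mul_mem_productSpan i (pow_mem_productSpan k))
      · exact coord_mul_mem_productSpan i (ih b hb)
  refine Submodule.span_le.2 fun a ha => ?_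
  rcases Finset.mem_union.1 (Finset.mem_coe.1 ha) with ha | ha
  · exact coordProducts_subset_productSpan (Finset.mem_union_left _ ha)
  · exact hquad k a ha

lemma quadric_mul_mem_productSpan (hq : q = ∑ i, x i * x i) {k : ℕ} {a : R}
    (ha : a ∈ productSpan x q k) : q * a ∈ productSpan x q (k + 1) := by
  refine mul_mem_of_mem_span (fun b hb => ?_) ha
  clear ha
  induction k generalizing b with
  | zero =>
    simp only [allProducts, coordProducts, quadricProducts, Finset.mem_coe, Finset.mem_union,
      Finset.mem_image, Finset.mem_univ, true_and, Finset.mem_singleton] at hb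
    rcases hb with ⟨i, rfl⟩ | rfl
    · rw [mul_comm]
      exact coord_mul_mem_productSpan i (by simpa using pow_mem_productSpan (x := x) (q := q) 0)
    · simpa [pow_two] using pow_mem_productSpan (x := x) (q := b) 1
  | succ k ih =>
    simp only [allProducts, coordProducts, quadricProducts, Finset.mem_coe, Finset.mem_union,
      Finset.mem_insert, Finset.mem_biUnion, Finset.mem_univ, Finset.mem_image, true_and] at hb ih
    rcases hb with (hb | ⟨i, b, hb, rfl⟩) | rfl | ⟨i, b, hb, rfl⟩
    · exact productSpan_le_succ hq _ (ih b (Or.inl hb))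
    · rw [mul_left_comm]
      exact coord_mul_mem_productSpan i (ih b (Or.inl hb))
    · rw [← pow_succ']
      exact pow_mem_productSpan (k + 2)
    · rw [mul_left_comm]
      exact coord_mul_mem_productSpan i (ih b (Or.inr hb))

lemma coord_mem_productSpan (hq : q = ∑ i, x i * x i) (i : Fin d) (k : ℕ) :
    x i ∈ productSpan x q k :=
  monotone_nat_of_le_succ (productSpan_le_succ hq) k.zero_le
    (coordProducts_subset_productSpan (by simp [coordProducts]))

lemma quadric_mem_productSpan (hq : q = ∑ i, x i * x i) (k : ℕ) : q ∈ productSpan x q k :=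
  monotone_nat_of_le_succ (productSpan_le_succ hq) k.zero_le
    (by simpa using pow_mem_productSpan (x := x) (q := q) 0)

/-- A product of `k + 1` linear combinations of `1`, the `x i`, and `q = ∑ i, x i ^ 2` lies in the
span of `1` and `allProducts x q k`. -/
lemma prod_mem_span_insert_one {κ : Type*} (hq : q = ∑ i, x i * x i) (a c : κ → ℝ)
    (b : κ → Fin d → ℝ) (T : Finset κ) (hT : T.Nonempty) :
    ∏ p ∈ T, (a p • (1 : R) + ∑ i, b p i • x i + c p • q) ∈
      Submodule.span ℝ (insert 1 (allProducts x q (T.card - 1)) : Finset R) := by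
  have hsup : ∀ k, Submodule.span ℝ (insert 1 (allProducts x q k) : Finset R) =
      Submodule.span ℝ {1} ⊔ productSpan x q k := fun k => by
    rw [Finset.coe_insert, Submodule.span_insert, productSpan]
  have hfactor : ∀ k p, ∑ i, b p i • x i + c p • q ∈ productSpan x q k := fun k p =>
    add_mem (sum_mem fun i _ => Submodule.smul_mem _ _ (coord_mem_productSpan hq i k))
      (Submodule.smul_mem _ _ (quadric_mem_productSpan hq k))
  have hone : ∀ k p, (a p • (1 : R) + ∑ i, b p i • x i + c p • q) ∈
      Submodule.span ℝ {1} ⊔ productSpan x q k := fun k p => by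
    rw [add_assoc]
    exact Submodule.add_mem_sup (Submodule.smul_mem _ _ (Submodule.mem_span_singleton_self 1))
      (hfactor k p)
  rw [hsup]
  induction hT using Finset.Nonempty.cons_induction with
  | singleton p => simpa using hone 0 p
  | cons p T hp hT ih =>
    rw [Finset.prod_cons, Finset.card_cons, Nat.add_sub_cancel]
    obtain ⟨k, hk⟩ : ∃ k, T.card = k + 1 := Nat.exists_eq_succ_of_ne_zero hT.card_ne_zero
    rw [hk] at ih ⊢
    rw [Nat.add_sub_cancel] at ih
    obtain ⟨u, hu, v, hv, huv⟩ := Submodule.mem_sup.1 ih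
    obtain ⟨r, rfl⟩ := Submodule.mem_span_singleton.1 hu
    rw [← huv, mul_add, mul_smul_comm, mul_one]
    refine add_mem (Submodule.smul_mem _ _ (hone _ p)) (Submodule.mem_sup_right ?_)
    rw [add_mul, add_mul, smul_mul_assoc, one_mul, Finset.sum_mul, smul_mul_assoc]
    refine add_mem (add_mem (Submodule.smul_mem _ _ (productSpan_le_succ hq _ hv))
      (sum_mem fun i _ => ?_)) (Submodule.smul_mem _ _ (quadric_mul_mem_productSpan hq hv))
    rw [smul_mul_assoc]
    exact Submodule.smul_mem _ _ (coord_mul_mem_productSpan i hv)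

end spanning

section distanceSets

open Filter Topology

variable {d : ℕ}

/-- The polynomial function vanishing at all points whose distance from `y` is one of the `t p`. -/
noncomputable def annihilator {κ : Type*} [Fintype κ] (t : κ → ℝ) (y : EuclideanSpace ℝ (Fin d)) :
    EuclideanSpace ℝ (Fin d) → ℝ :=
  fun z => ∏ p, (1 - dist z y ^ 2 / t p ^ 2)

lemma annihilator_mem_span {κ : Type*} [Fintype κ] [Nonempty κ] (t : κ → ℝ)
    (y : EuclideanSpace ℝ (Fin d)) :
    annihilator t y ∈ Submodule.span ℝ (insert 1 (allProducts
      (fun i (z : EuclideanSpace ℝ (Fin d)) => z i) (fun z => ‖z‖ ^ 2) (Fintype.card κ - 1)) :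
        Finset (EuclideanSpace ℝ (Fin d) → ℝ)) := by
  have hq : (fun z : EuclideanSpace ℝ (Fin d) => ‖z‖ ^ 2) =
      ∑ i, (fun z : EuclideanSpace ℝ (Fin d) => z i) * fun z => z i := by
    ext z
    rw [EuclideanSpace.real_norm_sq_eq]
    simp [pow_two]
  have hmem := prod_mem_span_insert_one hq (fun p => 1 - ‖y‖ ^ 2 / t p ^ 2)
    (fun p => -(1 / t p ^ 2)) (fun p i => 2 * y i / t p ^ 2) (Finset.univ : Finset κ)
    Finset.univ_nonempty
  rw [Finset.card_univ] at hmem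
  convert hmem using 1
  clear hmem
  ext z
  simp only [annihilator, Finset.prod_apply, Pi.add_apply, Pi.smul_apply, Finset.sum_apply,
    Pi.one_apply, smul_eq_mul]
  refine Finset.prod_congr rfl fun p _ => ?_
  have h : ∑ i, 2 * y i / t p ^ 2 * z i = 2 * inner ℝ z y / t p ^ 2 := by
    rw [PiLp.inner_apply, Finset.mul_sum, Finset.sum_div]
    refine Finset.sum_congr rfl fun i _ => ?_
    simp
    ring
  rw [h, dist_eq_norm, norm_sub_sq_real]
  ring

/-- A Euclidean `d`-dimensional point set with `s ≥ 1` distances has at most `(d + 1) ^ s`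
points. -/
lemma card_le_of_distances {κ : Type*} [Fintype κ] [Nonempty κ] (hd : 1 ≤ d) (t : κ → ℝ)
    (ht : ∀ p, 0 < t p) (S : Finset (EuclideanSpace ℝ (Fin d)))
    (hS : ∀ x ∈ S, ∀ y ∈ S, x ≠ y → ∃ p, dist x y = t p) :
    S.card ≤ (d + 1) ^ Fintype.card κ := by
  obtain rfl | hne := S.eq_empty_or_nonempty
  · simp
  have hval : ∀ x ∈ S, ∀ y ∈ S, annihilator t x y = if x = y then 1 else 0 := by
    intro x hx y hy
    split_ifs with h
    · simp [annihilator, h]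
    · obtain ⟨p, hp⟩ := hS y hy x hx (Ne.symm h)
      exact Finset.prod_eq_zero (Finset.mem_univ p) (by simp [hp, (ht p).ne'])
  have heval : ∀ c : S → ℝ, ∀ y : S, (∑ x, c x • annihilator t x.1) y.1 = c y := by
    intro c y
    simp [Finset.sum_apply, fun x : S => hval x.1 x.2 y.1 y.2]
  have hli : LinearIndependent ℝ (fun x : S => annihilator t x.1) := by
    rw [Fintype.linearIndependent_iff]
    intro c hc y
    rw [← heval c y, hc, Pi.zero_apply]
  have hone : (1 : EuclideanSpace ℝ (Fin d) → ℝ) ∉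
      Submodule.span ℝ (Set.range fun x : S => annihilator t x.1) := by
    intro h
    obtain ⟨c, hc⟩ := (Submodule.mem_span_range_iff_exists_fun ℝ).1 h
    have hc1 : ∀ y, c y = 1 := fun y => by rw [← heval c y, hc, Pi.one_apply]
    simp only [hc1, one_smul] at hc
    have : Nonempty (Fin d) := ⟨⟨0, hd⟩⟩
    have : NoncompactSpace (EuclideanSpace ℝ (Fin d)) := NormedSpace.noncompactSpace ℝ _
    have hfar : ∀ᶠ z in cocompact (EuclideanSpace ℝ (Fin d)),
        ∀ x : S, ∀ p, 2 * t p ≤ dist z x.1 := by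
      rw [eventually_all]
      intro x
      rw [eventually_all]
      exact fun p => (tendsto_dist_right_cocompact_atTop x.1).eventually_ge_atTop _
    obtain ⟨z, hz⟩ := hfar.exists
    have hprod : ∀ x : S, 1 < (-1) ^ Fintype.card κ * annihilator t x.1 z := by
      intro x
      have hfac : ∀ p, 1 < dist z x.1 ^ 2 / t p ^ 2 - 1 := fun p => by
        have := hz x p
        have hp := ht p
        rw [lt_sub_iff_add_lt, lt_div_iff₀ (by positivity)]
        nlinarith
      have : (-1) ^ Fintype.card κ * annihilator t x.1 z =
          ∏ p, (dist z x.1 ^ 2 / t p ^ 2 - 1) := by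
        rw [annihilator, ← Finset.card_univ, ← Finset.prod_const, ← Finset.prod_mul_distrib]
        exact Finset.prod_congr rfl fun p _ => by ring
      rw [this]
      refine (Finset.prod_const_one (s := (Finset.univ : Finset κ))).symm.trans_lt ?_
      exact Finset.prod_lt_prod_of_nonempty (fun _ _ => one_pos) (fun p _ => hfac p)
        Finset.univ_nonempty
    obtain ⟨x₀, hx₀⟩ := hne
    have hsum : 1 < (-1) ^ Fintype.card κ * ∑ x : S, annihilator t x.1 z := by
      rw [Finset.mul_sum]
      exact (hprod ⟨x₀, hx₀⟩).trans_le (Finset.single_le_sum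
        (f := fun x : S => (-1) ^ Fintype.card κ * annihilator t x.1 z)
        (fun x _ => zero_le_one.trans (hprod x).le) (Finset.mem_univ _))
    have hz1 := congrFun hc z
    rw [Finset.sum_apply, Pi.one_apply] at hz1
    rw [hz1, mul_one] at hsum
    rcases neg_one_pow_eq_or ℝ (Fintype.card κ) with h | h <;> rw [h] at hsum <;> linarith
  have hcard := linearIndependent_le_span_aux' _ (linearIndependent_option'.2 ⟨hli, hone⟩)
    ((insert 1 (allProducts (fun i (z : EuclideanSpace ℝ (Fin d)) => z i) (fun z => ‖z‖ ^ 2)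
      (Fintype.card κ - 1)) : Finset (EuclideanSpace ℝ (Fin d) → ℝ)) :
        Set (EuclideanSpace ℝ (Fin d) → ℝ)) (by
      rintro _ ⟨_ | x, rfl⟩
      · exact Submodule.subset_span (Finset.mem_coe.2 (Finset.mem_insert_self _ _))
      · exact annihilator_mem_span t x.1)
  rw [Fintype.card_option, Fintype.card_coe] at hcard
  have h1 := hcard.trans ((Fintype.card_coe _).le.trans (Finset.card_insert_le _ _))
  refine (Nat.le_of_succ_le_succ h1).trans ((card_allProducts_le _ _ _).trans_eq ?_)
  rw [Nat.sub_add_cancel Fintype.card_pos]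

/-- If along a sequence of configurations all distances lie in `s` multiplicative intervals whose
relative lengths tend to `0`, then the configurations have at most `(d + 1) ^ s` points. -/
lemma card_le_of_nearDistances_tendsto (hd : 1 ≤ d) (s : ℕ) :
    ∀ (V ι : Type) [Fintype V] [Fintype ι], Fintype.card ι = s →
      ∀ (P : ℕ → V → EuclideanSpace ℝ (Fin d)) (t : ℕ → ι → ℝ) (ε : ℕ → ℝ),
        Tendsto ε atTop (𝓝 0) → (∀ N p, 0 < t N p) →
        (∀ᶠ N in atTop, ∀ i j, i ≠ j →
          ∃ p, dist (P N i) (P N j) ∈ Set.Icc (t N p) (t N p * (1 + ε N))) →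
        Fintype.card V ≤ (d + 1) ^ s := by
  induction s using Nat.strong_induction_on with
  | _ s ih =>
  intro V ι _ _ hs P t ε hε ht hP
  obtain hι | hι := isEmpty_or_nonempty ι
  · have : Subsingleton V := by
      obtain ⟨N, hN⟩ := hP.exists
      refine ⟨fun i j => by_contra fun hij => ?_⟩
      exact hι.elim (hN i j hij).choose
    exact (Fintype.card_le_one_iff_subsingleton.2 this).trans (Nat.one_le_pow _ _ d.succ_pos)
  obtain hV | ⟨⟨i₀⟩⟩ := isEmpty_or_nonempty V
  · simp
  have hnorm : ∀ N, 0 < ‖t N‖ := fun N =>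
    norm_pos_iff.2 fun h => (ht N hι.some).ne' (congrFun h _)
  -- Rescale so that the largest `t p` is `1` and the point `i₀` is at the origin.
  let f : ℕ → (ι → ℝ) × (V → EuclideanSpace ℝ (Fin d)) := fun N =>
    (‖t N‖⁻¹ • t N, fun i => ‖t N‖⁻¹ • (P N i - P N i₀))
  have hfdist : ∀ N i j, dist ((f N).2 i) ((f N).2 j) = ‖t N‖⁻¹ * dist (P N i) (P N j) := by
    intro N i j
    simp only [f]
    rw [dist_smul₀, dist_sub_right, Real.norm_of_nonneg (inv_nonneg.2 (hnorm N).le)]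
  have hfnorm : ∀ N, ‖(f N).1‖ = 1 := fun N => by
    simp only [f]
    rw [norm_smul, norm_inv, norm_norm, inv_mul_cancel₀ (hnorm N).ne']
  have hfpos : ∀ N p, 0 < (f N).1 p := fun N p => mul_pos (inv_pos.2 (hnorm N)) (ht N p)
  have hf : ∀ᶠ N in atTop, ∀ i j, i ≠ j →
      ∃ p, dist ((f N).2 i) ((f N).2 j) ∈ Set.Icc ((f N).1 p) ((f N).1 p * (1 + ε N)) := by
    filter_upwards [hP] with N hN i j hij
    obtain ⟨p, hp1, hp2⟩ := hN i j hij
    have hinv := inv_nonneg.2 (hnorm N).le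
    refine ⟨p, ?_, ?_⟩
    · rw [hfdist]
      exact mul_le_mul_of_nonneg_left hp1 hinv
    · rw [hfdist]
      refine (mul_le_mul_of_nonneg_left hp2 hinv).trans_eq ?_
      rw [← mul_assoc]
      rfl
  have hbdd : ∀ᶠ N in atTop, f N ∈ Metric.closedBall 0 2 := by
    filter_upwards [hf, hε.eventually_le_const one_pos] with N hN hεN
    rw [mem_closedBall_zero_iff]
    refine max_le ((hfnorm N).le.trans one_le_two)
      ((pi_norm_le_iff_of_nonneg zero_le_two).2 fun i => ?_)
    obtain rfl | hi := eq_or_ne i i₀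
    · simp [f]
    · obtain ⟨p, -, hp⟩ := hN i i₀ hi
      have h0 : (f N).2 i₀ = 0 := by simp [f]
      rw [h0, dist_zero_right] at hp
      have h1 : (f N).1 p ≤ 1 :=
        ((le_abs_self _).trans (norm_le_pi_norm (f N).1 p)).trans (hfnorm N).le
      nlinarith [hfpos N p]
  obtain ⟨⟨T, L⟩, -, φ, hφ, hlim⟩ :=
    tendsto_subseq_of_frequently_bounded Metric.isBounded_closedBall hbdd.frequently
  have hlimT : Tendsto (fun N => (f (φ N)).1) atTop (𝓝 T) := (continuous_fst.tendsto _).comp hlim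
  have hlimL : Tendsto (fun N => (f (φ N)).2) atTop (𝓝 L) := (continuous_snd.tendsto _).comp hlim
  have hlimε := hε.comp hφ.tendsto_atTop
  have hfφ := hφ.tendsto_atTop.eventually hf
  have hT : ∀ p, 0 ≤ T p := fun p =>
    ge_of_tendsto' (tendsto_pi_nhds.1 hlimT p) fun N => (hfpos (φ N) p).le
  have hTnorm : ‖T‖ = 1 :=
    tendsto_nhds_unique hlimT.norm (by simp only [hfnorm]; exact tendsto_const_nhds)
  obtain ⟨p₁, hp₁⟩ : ∃ p, T p ≠ 0 := by
    by_contra! h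
    rw [show T = 0 from funext h, norm_zero] at hTnorm
    exact zero_ne_one hTnorm
  have hsel : ∀ i j p, dist (L i) (L j) ≠ T p → ∀ᶠ N in atTop, dist ((f (φ N)).2 i)
      ((f (φ N)).2 j) ∉ Set.Icc ((f (φ N)).1 p) ((f (φ N)).1 p * (1 + ε (φ N))) := by
    intro i j p h
    have h1 := (tendsto_pi_nhds.1 hlimL i).dist (tendsto_pi_nhds.1 hlimL j)
    have h2 := tendsto_pi_nhds.1 hlimT p
    have h3 := h2.mul (hlimε.const_add 1)
    rw [add_zero, mul_one] at h3
    rcases h.lt_or_gt with h | h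
    · filter_upwards [h1.eventually_lt h2 h] with N hN hmem
      exact hN.not_ge hmem.1
    · filter_upwards [h3.eventually_lt h1 h] with N hN hmem
      exact hN.not_ge hmem.2
  have hsplit : Fintype.card {p // T p = 0} + Fintype.card {p // T p ≠ 0} = s := by
    rw [← hs, ← Fintype.card_sum]
    exact Fintype.card_congr (Equiv.sumCompl _)
  have hpos : 0 < Fintype.card {p // T p ≠ 0} := Fintype.card_pos_iff.2 ⟨⟨p₁, hp₁⟩⟩
  have himage : (Finset.univ.image L).card ≤ (d + 1) ^ Fintype.card {p // T p ≠ 0} := by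
    have : Nonempty {p // T p ≠ 0} := ⟨⟨p₁, hp₁⟩⟩
    refine card_le_of_distances hd (fun p : {p // T p ≠ 0} => T p)
      (fun p => (hT p).lt_of_ne' p.2) _ ?_
    simp only [Finset.mem_image, Finset.mem_univ, true_and]
    rintro _ ⟨i, rfl⟩ _ ⟨j, rfl⟩ hij
    by_contra! h
    have hall : ∀ p, dist (L i) (L j) ≠ T p := fun p => by
      by_cases hp : T p = 0
      · rw [hp]
        exact dist_ne_zero.2 hij
      · exact h ⟨p, hp⟩
    obtain ⟨N, hN1, hN2⟩ := ((eventually_all.2 fun p => hsel i j p (hall p)).and hfφ).exists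
    obtain ⟨p, hp⟩ := hN2 i j fun h => hij (congrArg L h)
    exact hN1 p hp
  have hfiber : ∀ y ∈ Finset.univ.image L,
      (Finset.univ.filter fun i => L i = y).card ≤ (d + 1) ^ Fintype.card {p // T p = 0} := by
    intro y _
    rw [← Fintype.card_subtype]
    refine ih _ (by omega) {i // L i = y} {p // T p = 0} rfl (fun N i => (f (φ N)).2 i)
      (fun N p => (f (φ N)).1 p) (ε ∘ φ) hlimε (fun N p => hfpos _ _) ?_
    have hev : ∀ᶠ N in atTop, ∀ i j : {i // L i = y}, ∀ p : {p // T p ≠ 0},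
        dist ((f (φ N)).2 i) ((f (φ N)).2 j) ∉
          Set.Icc ((f (φ N)).1 p) ((f (φ N)).1 p * (1 + ε (φ N))) := by
      simp only [eventually_all]
      intro i j p
      refine hsel i j p ?_
      rw [i.2, j.2, dist_self]
      exact p.2.symm
    filter_upwards [hev, hfφ] with N hN1 hN2 i j hij
    obtain ⟨p, hp⟩ := hN2 i j (Subtype.coe_ne_coe.2 hij)
    exact ⟨⟨p, by_contra fun h => hN1 i j ⟨p, h⟩ hp⟩, hp⟩
  calc Fintype.card V = (Finset.univ : Finset V).card := Finset.card_univ.symm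
    _ ≤ (d + 1) ^ Fintype.card {p // T p = 0} * (Finset.univ.image L).card :=
      Finset.card_le_mul_card_image _ _ hfiber
    _ ≤ (d + 1) ^ Fintype.card {p // T p = 0} * (d + 1) ^ Fintype.card {p // T p ≠ 0} :=
      Nat.mul_le_mul_left _ himage
    _ = (d + 1) ^ s := by rw [← pow_add, hsplit]

end distanceSets

/-- There are no `(d + 1) ^ k + 1` points whose distances all lie in `k` sufficiently short
multiplicative intervals. -/
lemma exists_pos_forall_not_nearDistances {d : ℕ} (hd : 1 ≤ d) (k : ℕ) :
    ∃ ε₀ : ℝ, 0 < ε₀ ∧ ∀ ε : ℝ, 0 < ε → ε < ε₀ →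
      ∀ (P : Fin ((d + 1) ^ k + 1) → EuclideanSpace ℝ (Fin d)) (t : Fin k → ℝ), (∀ p, 0 < t p) →
        ¬ ∀ i j, i ≠ j → ∃ p, dist (P i) (P j) ∈ Set.Icc (t p) (t p * (1 + ε)) := by
  by_contra! h
  choose ε hε0 hε P t ht hP using fun N : ℕ => h (1 / ((N : ℝ) + 1)) Nat.one_div_pos_of_nat
  have hlim : Filter.Tendsto ε Filter.atTop (nhds 0) :=
    squeeze_zero (fun N => (hε0 N).le) (fun N => (hε N).le) tendsto_one_div_add_atTop_nhds_zero_nat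
  have := card_le_of_nearDistances_tendsto hd k _ _ (Fintype.card_fin k) P t ε hlim ht
    (Filter.Eventually.of_forall hP)
  simp at this

lemma SimpleGraph.CliqueFree.card_edgeFinset_le_turanNum {n r : ℕ} (hr : 0 < r)
    {G : SimpleGraph (Fin n)} (hG : G.CliqueFree (r + 1)) :
    G.edgeFinset.card ≤ turanNum n (r + 1) := by
  have h := (isTuranMaximal_turanGraph (n := n) hr).2 hG
  rw [turanNum, Nat.add_sub_cancel]
  convert h

theorem count_pairs_in_k_multiplicative_intervals_le_turan
    (d k : ℕ) (hd : 1 ≤ d) (hk : 1 ≤ k) :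
    ∃ ε₀ : ℝ, 0 < ε₀ ∧
      ∀ ε : ℝ, 0 < ε → ε < ε₀ →
        ∀ (n : ℕ), 1 ≤ n →
          ∀ (P : Fin n → EuclideanSpace ℝ (Fin d)) (t : Fin k → ℝ),
            (∀ p, 0 < t p) →
            (Finset.univ.filter fun q : Fin n × Fin n => q.1 < q.2 ∧
                ∃ p, dist (P q.1) (P q.2) ∈
                  Set.Icc (t p) (t p * (1 + ε))).card
              ≤ turanNum n ((d + 1) ^ k + 1) := by
  obtain ⟨ε₀, hε₀, h⟩ := exists_pos_forall_not_nearDistances hd k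
  refine ⟨ε₀, hε₀, fun ε hε hεlt n _ P t ht => ?_⟩
  let G : SimpleGraph (Fin n) :=
    { Adj := fun i j => i ≠ j ∧ ∃ p, dist (P i) (P j) ∈ Set.Icc (t p) (t p * (1 + ε))
      symm := ⟨fun i j hij => ⟨hij.1.symm, by simpa only [dist_comm] using hij.2⟩⟩
      loopless := ⟨fun i hi => hi.1 rfl⟩ }
  have hfree : G.CliqueFree ((d + 1) ^ k + 1) := by
    by_contra hG
    let e := SimpleGraph.topEmbeddingOfNotCliqueFree hG
    exact h ε hε hεlt (P ∘ e) t ht fun i j hij => (e.map_rel_iff.2 hij).2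
  refine le_trans ?_ (hfree.card_edgeFinset_le_turanNum (Nat.pow_pos d.succ_pos))
  refine Finset.card_le_card_of_injOn (fun q => s(q.1, q.2)) ?_ ?_
  · intro q hq
    obtain ⟨-, hlt, hdist⟩ := Finset.mem_filter.1 hq
    have hadj : G.Adj q.1 q.2 := ⟨hlt.ne, hdist⟩
    simpa using hadj
  · rintro ⟨a, b⟩ hab ⟨a', b'⟩ hab' heq
    have h1 : a < b := (Finset.mem_filter.1 hab).2.1
    have h2 : a' < b' := (Finset.mem_filter.1 hab').2.1
    rcases Sym2.eq_iff.1 heq with ⟨rfl, rfl⟩ | ⟨rfl, rfl⟩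
    · rfl
    · exact absurd h1 h2.asymm
end

section
/- For all integers d ≥ 1 and k ≥ 1 there exists ε_{d,k} > 0 such that for every ε with 0 < ε < ε_{d,k}, every (ε, k)-distance set in Euclidean space R^d has cardinality at most (d + 1)^k. -/
/-- A finite subset `s` of Euclidean space `ℝ^d` is an `(ε, k)`-distance set if
there exist `t_1, ..., t_k > 0` such that every distance between two distinct
points of `s` lies in `⋃_{p} [t_p, t_p + ε · min {t_1, ..., t_k}]`. -/
def IsEpsKDistSet (d k : ℕ) (ε : ℝ)
    (s : Finset (EuclideanSpace ℝ (Fin d))) : Prop :=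
  ∃ t : Fin k → ℝ, (∀ p, 0 < t p) ∧
    ∀ x ∈ s, ∀ y ∈ s, x ≠ y →
      ∃ p, dist x y ∈ Set.Icc (t p) (t p + ε * ⨅ q, t q)

open Finset

lemma exists_prod_option_elim_eq_prod_pow {σ : Type*} [Fintype σ] (n : ℕ) (α : σ → ℕ)
    (hα : ∑ j, α j ≤ n) :
    ∃ w : Fin n → Option σ, ∀ x : σ → ℝ, ∏ i, (w i).elim 1 x = ∏ j, x j ^ α j := by
  classical
  induction n generalizing α with
  | zero =>
    have h0 : ∀ j, α j = 0 := by simpa using hα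
    exact ⟨Fin.elim0, fun x => by simp [h0]⟩
  | succ n ih =>
    by_cases h : ∃ j, α j ≠ 0
    · obtain ⟨j, hj⟩ := h
      have hle : (Pi.single j 1 : σ → ℕ) ≤ α := by
        intro i
        by_cases hij : i = j
        · subst hij
          simpa using Nat.one_le_iff_ne_zero.2 hj
        · simp [hij]
      obtain ⟨β, rfl⟩ : ∃ β : σ → ℕ, α = β + Pi.single j 1 := ⟨_, (tsub_add_cancel_of_le hle).symm⟩
      obtain ⟨w, hw⟩ := ih β (by simpa [sum_add_distrib] using hα)
      refine ⟨Fin.cons (some j) w, fun x => ?_⟩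
      have hs : ∏ i, x i ^ (Pi.single j 1 : σ → ℕ) i = x j := by
        rw [prod_eq_single j] <;> simp +contextual
      simp [Fin.prod_univ_succ, hw, pow_add, prod_mul_distrib, hs, mul_comm]
    · push Not at h
      exact ⟨fun _ => none, fun x => by simp [h]⟩

lemma exists_ne_zero_sum_mul_prod_pow_eq_zero {ι σ : Type*} [Fintype ι] [Fintype σ]
    (v : ι → σ → ℝ) (n : ℕ) (h : (Fintype.card σ + 1) ^ n < Fintype.card ι) :
    ∃ c : ι → ℝ, c ≠ 0 ∧ ∀ α : σ → ℕ, ∑ j, α j ≤ n → ∑ i, c i * ∏ j, v i j ^ α j = 0 := by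
  classical
  let M : Matrix (Fin n → Option σ) ι ℝ := .of fun w i => ∏ l, (w l).elim 1 (v i)
  have hker : LinearMap.ker M.mulVecLin ≠ ⊥ := by
    apply LinearMap.ker_ne_bot_of_finrank_lt
    simpa using h
  obtain ⟨c, hc, hc0⟩ := (Submodule.ne_bot_iff _).1 hker
  refine ⟨c, hc0, fun α hα => ?_⟩
  obtain ⟨w, hw⟩ := exists_prod_option_elim_eq_prod_pow n α hα
  have := congrFun (LinearMap.mem_ker.1 hc) w
  simpa [M, Matrix.mulVec, dotProduct, hw, mul_comm] using this

lemma sum_sum_mul_eval_eq_zero {ι σ : Type*} [Fintype ι] [Fintype σ]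
    (v : ι → σ → ℝ) (n : ℕ) (c : ι → ℝ)
    (hc : ∀ α : σ → ℕ, ∑ j, α j ≤ n → ∑ i, c i * ∏ j, v i j ^ α j = 0)
    (p : MvPolynomial (σ ⊕ σ) ℝ) (hp : p.totalDegree ≤ 2 * n) :
    ∑ i, ∑ j, c i * c j * MvPolynomial.eval (Sum.elim (v i) (v j)) p = 0 := by
  have key : ∀ m ∈ p.support, ∑ i, ∑ j, c i * c j *
      (p.coeff m * ∏ l, Sum.elim (v i) (v j) l ^ m l) = 0 := by
    intro m hm
    have hdeg : ∑ l, m (.inl l) + ∑ l, m (.inr l) ≤ 2 * n := by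
      have := (MvPolynomial.le_totalDegree hm).trans hp
      rwa [Finsupp.sum_fintype _ _ (fun _ => rfl), Fintype.sum_sum_type] at this
    have hfac : ∑ i, ∑ j, c i * c j * (p.coeff m * ∏ l, Sum.elim (v i) (v j) l ^ m l) =
        p.coeff m * ((∑ i, c i * ∏ l, v i l ^ m (.inl l)) *
          ∑ j, c j * ∏ l, v j l ^ m (.inr l)) := by
      rw [sum_mul_sum, mul_sum]
      refine sum_congr rfl fun i _ => ?_
      rw [mul_sum]
      refine sum_congr rfl fun j _ => ?_
      rw [Fintype.prod_sum_type]
      simp only [Sum.elim_inl, Sum.elim_inr]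
      ring
    rw [hfac]
    rcases le_or_gt (∑ l, m (.inl l)) n with h | h
    · rw [hc _ h]; ring
    · rw [hc (fun l => m (.inr l)) (by omega)]; ring
  simp only [MvPolynomial.eval_eq', mul_sum]
  calc _ = ∑ m ∈ p.support, ∑ i, ∑ j, c i * c j *
      (p.coeff m * ∏ l, Sum.elim (v i) (v j) l ^ m l) := by
        rw [sum_comm_cycle]
    _ = 0 := sum_eq_zero key

lemma sum_sum_mul_pos_of_near_diagonal {ι : Type*} [Fintype ι] (K : ι → ι → ℝ) (c : ι → ℝ)
    (hc : c ≠ 0) (D δ : ℝ) (hD : 0 < D) (hδ : 0 ≤ δ) (hδ' : δ * Fintype.card ι < 1)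
    (hdiag : ∀ i, K i i = D)
    (hoff : ∀ i j, i ≠ j → |K i j| ≤ δ * D) :
    0 < ∑ i, ∑ j, c i * c j * K i j := by
  classical
  have hlow : ∀ i j, (if i = j then D * c i ^ 2 else 0) - δ * D * (|c i| * |c j|)
      ≤ c i * c j * K i j := by
    intro i j
    by_cases hij : i = j
    · subst hij
      have : 0 ≤ δ * D * (|c i| * |c i|) := by positivity
      simp only [if_true, hdiag]
      nlinarith
    · have h1 : |c i * c j * K i j| ≤ (|c i| * |c j|) * (δ * D) := by
        rw [abs_mul, abs_mul]
        exact mul_le_mul_of_nonneg_left (hoff i j hij) (by positivity)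
      simp only [hij, if_false]
      linarith [neg_abs_le (c i * c j * K i j)]
  have hsum : D * ∑ i, c i ^ 2 - δ * D * (∑ i, |c i|) ^ 2 ≤ ∑ i, ∑ j, c i * c j * K i j := by
    calc _ = ∑ i, ∑ j, ((if i = j then D * c i ^ 2 else 0) - δ * D * (|c i| * |c j|)) := by
          simp only [sum_sub_distrib, sum_ite_eq, mem_univ, if_true, ← mul_sum, sq,
            ← sum_mul]
      _ ≤ _ := sum_le_sum fun i _ => sum_le_sum fun j _ => hlow i j
  have hcs : (∑ i, |c i|) ^ 2 ≤ Fintype.card ι * ∑ i, c i ^ 2 := by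
    simpa using sq_sum_le_card_mul_sum_sq (s := (univ : Finset ι)) (f := fun i => |c i|)
  have hpos : 0 < ∑ i, c i ^ 2 := by
    obtain ⟨i, hi⟩ := Function.ne_iff.1 hc
    exact sum_pos' (fun i _ => sq_nonneg _) ⟨i, mem_univ i, by simpa using pow_pos (abs_pos.2 hi) 2⟩
  have h1 : δ * D * (∑ i, |c i|) ^ 2 ≤ δ * D * (Fintype.card ι * ∑ i, c i ^ 2) :=
    mul_le_mul_of_nonneg_left hcs (by positivity)
  have h2 : 0 < D * (∑ i, c i ^ 2) * (1 - δ * Fintype.card ι) :=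
    mul_pos (by positivity) (by linarith)
  nlinarith

lemma exists_gap_or_forall_le (T : Finset ℝ) (hT : ∀ t ∈ T, 0 < t) :
    (∃ a ∈ T, (∀ t ∈ T, t ≤ a ∨ 3 * a < t) ∧ ∃ t ∈ T, 3 * a < t) ∨
      ∀ a ∈ T, ∀ t ∈ T, t ≤ 3 ^ (#T + 1) * a := by
  rw [or_iff_not_imp_left]
  intro hno
  have hno' : ∀ a ∈ T, (∃ t ∈ T, a < t ∧ t ≤ 3 * a) ∨ ∀ t ∈ T, t ≤ 3 * a := by
    intro a ha
    by_contra! h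
    exact hno ⟨a, ha, fun t ht => (le_or_gt t a).imp_right (h.1 t ht), h.2⟩
  have key : ∀ n : ℕ, ∀ a ∈ T, #{t ∈ T | a < t} ≤ n → ∀ t ∈ T, t ≤ 3 ^ (n + 1) * a := by
    intro n
    induction n with
    | zero =>
      intro a ha hcard t ht
      have : t ≤ a := by
        by_contra! h
        exact (card_pos.2 ⟨t, mem_filter.2 ⟨ht, h⟩⟩).not_ge hcard
      have := hT a ha
      norm_num
      linarith
    | succ n ih =>
      intro a ha hcard t ht
      have ha0 := hT a ha
      rcases hno' a ha with ⟨b, hb, hab, hb3⟩ | h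
      · have hlt : #{t ∈ T | b < t} < #{t ∈ T | a < t} := by
          refine card_lt_card (ssubset_iff_of_subset ?_ |>.2 ⟨b, by simp [hb, hab], by simp⟩)
          intro x hx
          simp only [mem_filter] at hx ⊢
          exact ⟨hx.1, hab.trans hx.2⟩
        calc t ≤ 3 ^ (n + 1) * b := ih b hb (by omega) t ht
          _ ≤ 3 ^ (n + 1) * (3 * a) := by gcongr
          _ = 3 ^ (n + 1 + 1) * a := by ring
      · calc t ≤ 3 * a := h t ht
          _ ≤ 3 ^ (n + 1 + 1) * a := by
            gcongr
            exact le_self_pow₀ (by norm_num) (by omega)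
  exact fun a ha => key _ a ha (card_le_card (filter_subset _ _))

lemma abs_prod_sq_sub_sq_le (T : Finset ℝ) (m ε R r p : ℝ) (hm : 0 < m) (hT : ∀ t ∈ T, m ≤ t)
    (hR : 1 ≤ R) (hTR : ∀ a ∈ T, ∀ t ∈ T, t ≤ R * a) (hε0 : 0 ≤ ε) (hε1 : ε ≤ 1)
    (hp : p ∈ T) (hr : r ∈ Set.Icc p (p + ε * m)) :
    |∏ t ∈ T, (t ^ 2 - r ^ 2)| ≤ 3 * ε * (5 * R ^ 2) ^ #T * ∏ t ∈ T, t ^ 2 := by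
  obtain ⟨hpr, hrp⟩ := hr
  have hmp := hT p hp
  have hεm : ε * m ≤ ε * p := by gcongr
  have hεp : ε * p ≤ p := mul_le_of_le_one_left (by linarith) hε1
  have hR2 : 1 ≤ R ^ 2 := one_le_pow₀ hR
  have hfar : ∀ t ∈ T, |t ^ 2 - r ^ 2| ≤ 5 * R ^ 2 * t ^ 2 := by
    intro t ht
    have ht0 := hT t ht
    have h1 : r ^ 2 ≤ (2 * (R * t)) ^ 2 :=
      pow_le_pow_left₀ (by linarith) (by linarith [hTR t ht p hp]) 2
    have h2 : 1 * t ^ 2 ≤ R ^ 2 * t ^ 2 := by gcongr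
    rw [abs_le]
    constructor <;> nlinarith [sq_nonneg r, sq_nonneg t]
  have hnear : |p ^ 2 - r ^ 2| ≤ 3 * ε * (5 * R ^ 2) * p ^ 2 := by
    have h1 : (r - p) * (r + p) ≤ ε * p * (3 * p) :=
      mul_le_mul (by linarith) (by linarith) (by linarith) (by nlinarith)
    have h2 : 3 * ε * p ^ 2 * 1 ≤ 3 * ε * p ^ 2 * (5 * R ^ 2) := by
      gcongr
      linarith
    rw [abs_sub_comm, abs_of_nonneg (by nlinarith)]
    linarith
  rw [abs_prod, ← mul_prod_erase T _ hp, ← mul_prod_erase T (fun t => t ^ 2) hp,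
    ← card_erase_add_one hp]
  calc _ ≤ 3 * ε * (5 * R ^ 2) * p ^ 2 * ∏ t ∈ T.erase p, (5 * R ^ 2 * t ^ 2) := by
        refine mul_le_mul hnear (prod_le_prod (fun _ _ => abs_nonneg _) fun t ht =>
          hfar t (mem_of_mem_erase ht)) (prod_nonneg fun _ _ => abs_nonneg _) (by positivity)
    _ = _ := by
        rw [prod_mul_distrib, prod_const]
        ring

/-- Every distance between distinct points of `s` lies in `⋃ t ∈ T, [t, t + η]`. -/
def HasDistancesNear {X : Type*} [MetricSpace X] (η : ℝ) (T : Finset ℝ) (s : Finset X) : Prop :=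
  ∀ x ∈ s, ∀ y ∈ s, x ≠ y → ∃ t ∈ T, dist x y ∈ Set.Icc t (t + η)

lemma HasDistancesNear.card_le_of_comparable {d : ℕ} {T : Finset ℝ} {m ε R : ℝ} (hm : 0 < m)
    (hT : ∀ t ∈ T, m ≤ t) (hR : 1 ≤ R) (hTR : ∀ a ∈ T, ∀ t ∈ T, t ≤ R * a) (hε0 : 0 ≤ ε)
    (hε1 : ε ≤ 1) (hε : 3 * ε * (5 * R ^ 2) ^ #T * ((d + 1) ^ #T + 1) < 1)
    {s : Finset (EuclideanSpace ℝ (Fin d))} (hs : HasDistancesNear (ε * m) T s) :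
    #s ≤ (d + 1) ^ #T := by
  by_contra! hcard
  obtain ⟨u, hus, hu⟩ := exists_subset_card_eq (Nat.succ_le_of_lt hcard)
  let v : u → Fin d → ℝ := fun x i => x.1 i
  obtain ⟨c, hc0, hc⟩ := exists_ne_zero_sum_mul_prod_pow_eq_zero v #T (by simp [hu])
  let p : MvPolynomial (Fin d ⊕ Fin d) ℝ := ∏ t ∈ T, (.C (t ^ 2) -
    ∑ j, (MvPolynomial.X (.inl j) - MvPolynomial.X (.inr j)) ^ 2)
  have hp : p.totalDegree ≤ 2 * #T := by
    refine (MvPolynomial.totalDegree_finsetProd _ _).trans ?_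
    rw [mul_comm, ← smul_eq_mul]
    refine sum_le_card_nsmul _ _ _ fun t _ => ?_
    refine (MvPolynomial.totalDegree_sub _ _).trans (max_le ?_ ?_)
    · rw [MvPolynomial.totalDegree_C]
      exact Nat.zero_le 2
    refine MvPolynomial.totalDegree_finsetSum_le fun j _ => ?_
    refine (MvPolynomial.totalDegree_pow _ _).trans ?_
    have : (MvPolynomial.X (.inl j) - MvPolynomial.X (.inr j) :
        MvPolynomial (Fin d ⊕ Fin d) ℝ).totalDegree ≤ 1 :=
      (MvPolynomial.totalDegree_sub _ _).trans (by simp)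
    omega
  have heval : ∀ x y : u, MvPolynomial.eval (Sum.elim (v x) (v y)) p =
      ∏ t ∈ T, (t ^ 2 - dist x.1 y.1 ^ 2) := by
    intro x y
    simp [p, v, EuclideanSpace.dist_sq_eq, Real.dist_eq]
  have hzero := sum_sum_mul_eval_eq_zero v #T c hc p hp
  refine (sum_sum_mul_pos_of_near_diagonal _ c hc0 (∏ t ∈ T, t ^ 2) (3 * ε * (5 * R ^ 2) ^ #T)
    (prod_pos fun t ht => pow_pos (hm.trans_le (hT t ht)) 2) (by positivity) ?_ ?_ ?_).ne' hzero
  · simpa [hu] using hε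
  · intro x
    simp [heval]
  · intro x y hxy
    obtain ⟨t, ht, htxy⟩ := hs x (hus x.2) y (hus y.2) (Subtype.coe_injective.ne hxy)
    rw [heval]
    exact abs_prod_sq_sub_sq_le T m ε R _ t hm hT hR hTR hε0 hε1 ht htxy

lemma exists_subset_separated_covering {X : Type*} [MetricSpace X] (s : Finset X) {r : ℝ}
    (hr : 0 ≤ r) :
    ∃ u ⊆ s, (∀ x ∈ u, ∀ y ∈ u, x ≠ y → r < dist x y) ∧ ∀ y ∈ s, ∃ x ∈ u, dist x y ≤ r := by
  classical
  obtain ⟨u, hu, hmax⟩ := exists_max_image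
    {u ∈ s.powerset | ∀ x ∈ u, ∀ y ∈ u, x ≠ y → r < dist x y} card ⟨∅, by simp⟩
  simp only [mem_filter, mem_powerset] at hu hmax
  refine ⟨u, hu.1, hu.2, fun y hy => ?_⟩
  by_contra! h
  have hyu : y ∉ u := fun hyu => by simpa [hr.not_gt] using h y hyu
  have := hmax (insert y u) ⟨insert_subset hy hu.1, ?_⟩
  · simp [hyu] at this
  · intro a ha b hb hab
    rw [mem_insert] at ha hb
    rcases ha with rfl | ha <;> rcases hb with rfl | hb
    · exact absurd rfl hab
    · rw [dist_comm]
      exact h b hb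
    · exact h a ha
    · exact hu.2 a ha b hb hab

lemma HasDistancesNear.card_le_of_gap {X : Type*} [MetricSpace X] {T : Finset ℝ} {a η : ℝ}
    (hη0 : 0 ≤ η) (hη : η ≤ a / 4) (ha : a ∈ T) (hgap : ∀ t ∈ T, t ≤ a ∨ 3 * a < t)
    (htop : ∃ t ∈ T, 3 * a < t) {q : ℕ}
    (ih : ∀ T' ⊂ T, ∀ s : Finset X, HasDistancesNear η T' s → #s ≤ q ^ #T')
    {s : Finset X} (hs : HasDistancesNear η T s) : #s ≤ q ^ #T := by
  classical
  have ha0 : 0 ≤ a := by linarith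
  obtain ⟨u, hus, hsep, hcov⟩ := exists_subset_separated_covering s (r := 5 * a / 4) (by linarith)
  have hlow : ({t ∈ T | t ≤ a} : Finset ℝ) ⊂ T := by
    obtain ⟨b, hb, hab⟩ := htop
    exact filter_ssubset.2 ⟨b, hb, by linarith⟩
  have hhigh : ({t ∈ T | ¬ t ≤ a} : Finset ℝ) ⊂ T := filter_ssubset.2 ⟨a, ha, by simp⟩
  have hu : #u ≤ q ^ #{t ∈ T | ¬ t ≤ a} := by
    refine ih _ hhigh u fun x hx y hy hxy => ?_
    obtain ⟨t, ht, htxy⟩ := hs x (hus hx) y (hus hy) hxy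
    refine ⟨t, mem_filter.2 ⟨ht, fun hta => ?_⟩, htxy⟩
    linarith [htxy.2, hsep x hx y hy hxy]
  have hball : ∀ x ∈ u, #{y ∈ s | dist x y ≤ 5 * a / 4} ≤ q ^ #{t ∈ T | t ≤ a} := by
    intro x _
    refine ih _ hlow _ fun y hy z hz hyz => ?_
    rw [mem_filter] at hy hz
    obtain ⟨t, ht, htyz⟩ := hs y hy.1 z hz.1 hyz
    refine ⟨t, mem_filter.2 ⟨ht, (hgap t ht).resolve_right fun h => ?_⟩, htyz⟩
    linarith [htyz.1, dist_triangle_left y z x]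
  calc #s ≤ #(u.biUnion fun x => {y ∈ s | dist x y ≤ 5 * a / 4}) := by
        refine card_le_card fun y hy => ?_
        obtain ⟨x, hx, hxy⟩ := hcov y hy
        exact mem_biUnion.2 ⟨x, hx, mem_filter.2 ⟨hy, hxy⟩⟩
    _ ≤ #u * q ^ #{t ∈ T | t ≤ a} := card_biUnion_le_card_mul _ _ _ hball
    _ ≤ q ^ #{t ∈ T | ¬ t ≤ a} * q ^ #{t ∈ T | t ≤ a} := Nat.mul_le_mul_right _ hu
    _ = q ^ #T := by
        rw [← pow_add, add_comm, card_filter_add_card_filter_not]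

lemma exists_pos_forall_hasDistancesNear_card_le (d k : ℕ) :
    ∃ ε₀ : ℝ, 0 < ε₀ ∧ ∀ ε : ℝ, 0 ≤ ε → ε < ε₀ → ∀ (m : ℝ) (T : Finset ℝ), 0 < m →
      (∀ t ∈ T, m ≤ t) → #T ≤ k → ∀ s : Finset (EuclideanSpace ℝ (Fin d)),
        HasDistancesNear (ε * m) T s → #s ≤ (d + 1) ^ #T := by
  let C : ℝ := 3 * (5 * (3 ^ (k + 1)) ^ 2) ^ k * ((d + 1) ^ k + 1)
  have hC : 0 < C := by positivity
  refine ⟨min (1 / 4) C⁻¹, by positivity, fun ε hε0 hε m T hm => ?_⟩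
  rw [lt_min_iff] at hε
  induction T using Finset.strongInduction with
  | H T ih =>
    intro hT hk s hs
    rcases exists_gap_or_forall_le T fun t ht => hm.trans_le (hT t ht) with
      ⟨a, ha, hgap, htop⟩ | hTR
    · refine hs.card_le_of_gap (by positivity) ?_ ha hgap htop fun T' hT' =>
        ih T' hT' (fun t ht => hT t (hT'.1 ht)) ((card_le_card hT'.1).trans hk)
      nlinarith [hT a ha]
    · refine hs.card_le_of_comparable hm hT (one_le_pow₀ (by norm_num)) hTR hε0 (by linarith) ?_
      calc 3 * ε * (5 * (3 ^ (#T + 1)) ^ 2) ^ #T * (((d : ℝ) + 1) ^ #T + 1)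
          ≤ 3 * ε * (5 * (3 ^ (k + 1)) ^ 2) ^ k * ((d + 1) ^ k + 1) := by
            have h5 : (5 * (3 ^ (#T + 1)) ^ 2 : ℝ) ^ #T ≤ (5 * (3 ^ (k + 1)) ^ 2) ^ k := by
              calc _ ≤ (5 * (3 ^ (k + 1)) ^ 2 : ℝ) ^ #T := by
                    gcongr
                    norm_num
                _ ≤ _ := pow_le_pow_right₀ (by
                    have : (1 : ℝ) ≤ (3 ^ (k + 1)) ^ 2 :=
                      one_le_pow₀ (one_le_pow₀ (by norm_num))
                    linarith) hk
            have hd : ((d : ℝ) + 1) ^ #T ≤ (d + 1) ^ k :=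
              pow_le_pow_right₀ (by linarith [Nat.cast_nonneg (α := ℝ) d]) hk
            gcongr
        _ = ε * C := by ring
        _ < 1 := by
            rw [← lt_div_iff₀ hC, one_div]
            exact hε.2

theorem eps_k_distance_set_card_le
    (d k : ℕ) (hd : 1 ≤ d) (hk : 1 ≤ k) :
    ∃ ε₀ : ℝ, 0 < ε₀ ∧
      ∀ ε : ℝ, 0 < ε → ε < ε₀ →
        ∀ s : Finset (EuclideanSpace ℝ (Fin d)),
          IsEpsKDistSet d k ε s → s.card ≤ (d + 1) ^ k := by
  obtain ⟨ε₀, hε₀, h⟩ := exists_pos_forall_hasDistancesNear_card_le d k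
  refine ⟨ε₀, hε₀, fun ε hε hlt s ⟨t, ht, hs⟩ => ?_⟩
  have : Nonempty (Fin k) := ⟨⟨0, hk⟩⟩
  have hm : 0 < ⨅ q, t q := by
    obtain ⟨q, hq⟩ := exists_eq_ciInf_of_finite (f := t)
    exact hq ▸ ht q
  have hcard : #(univ.image t) ≤ k := by simpa using card_image_le (s := univ) (f := t)
  refine (h ε hε.le hlt (⨅ q, t q) (univ.image t) hm ?_ hcard s fun x hx y hy hxy => ?_).trans
    (Nat.pow_le_pow_right (by omega) hcard)
  · simpa using fun q => ciInf_le (Set.finite_range t).bddBelow q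
  · obtain ⟨q, hq⟩ := hs x hx y hy hxy
    exact ⟨t q, mem_image_of_mem t (mem_univ q), hq⟩
end

section
/- Let P be a finite set of n real numbers such that |x − y| ≥ 1 for all distinct x, y ∈ P, and let 0 ≤ a ≤ b be real numbers. Then the number of unordered pairs {x, y} of distinct elements of P with |x − y| ∈ [a, b] is at most n·(⌊b − a⌋ + 1). -/
open scoped Classical

/-- A separated finite set of reals inside `[c, d]` has at most `⌊d - c⌋ + 1` elements. -/
theorem card_le_floor_add_one_of_separated {S : Finset ℝ} {c d : ℝ} (hcd : c ≤ d)
    (hsep : ∀ x ∈ S, ∀ y ∈ S, x ≠ y → 1 ≤ |x - y|) (hS : ∀ x ∈ S, x ∈ Set.Icc c d) :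
    (S.card : ℤ) ≤ ⌊d - c⌋ + 1 := by
  have hmaps : ∀ x ∈ S, ⌊x - c⌋ ∈ Finset.Icc 0 ⌊d - c⌋ := fun x hx => by
    obtain ⟨h₁, h₂⟩ := hS x hx
    exact Finset.mem_Icc.2 ⟨Int.floor_nonneg.2 (by linarith), Int.floor_mono (by linarith)⟩
  have hinj : ∀ x ∈ S, ∀ y ∈ S, ⌊x - c⌋ = ⌊y - c⌋ → x = y := fun x hx y hy h => by
    by_contra hne
    have hlt := Int.abs_sub_lt_one_of_floor_eq_floor h
    rw [sub_sub_sub_cancel_right] at hlt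
    exact (hsep x hx y hy hne).not_gt hlt
  have hcard := Finset.card_le_card_of_injOn (fun x => ⌊x - c⌋) hmaps hinj
  have hfloor : 0 ≤ ⌊d - c⌋ := Int.floor_nonneg.2 (by linarith)
  rw [Int.card_Icc] at hcard
  lia

theorem count_pairs_in_interval_on_line
    (P : Finset ℝ) (hsep : ∀ x ∈ P, ∀ y ∈ P, x ≠ y → 1 ≤ |x - y|)
    (a b : ℝ) (ha : 0 ≤ a) (hab : a ≤ b) :
    (((P ×ˢ P).filter fun q : ℝ × ℝ =>
        q.1 < q.2 ∧ |q.1 - q.2| ∈ Set.Icc a b).card : ℝ)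
      ≤ (P.card : ℝ) * ((⌊b - a⌋ : ℝ) + 1) := by
  have hfiber : ∀ x ∈ P,
      ((P.filter fun y => x < y ∧ |x - y| ∈ Set.Icc a b).card : ℝ) ≤ (⌊b - a⌋ : ℝ) + 1 := by
    intro x _
    have h := card_le_floor_add_one_of_separated
      (S := P.filter fun y => x < y ∧ |x - y| ∈ Set.Icc a b) (add_le_add_right hab x)
      (fun y hy z hz => hsep y (Finset.mem_filter.1 hy).1 z (Finset.mem_filter.1 hz).1)
      (fun y hy => by
        obtain ⟨-, hlt, h₁, h₂⟩ := Finset.mem_filter.1 hy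
        rw [abs_sub_comm, abs_of_pos (sub_pos.2 hlt)] at h₁ h₂
        constructor <;> linarith)
    rw [add_sub_add_left_eq_sub] at h
    exact_mod_cast h
  rw [Finset.card_filter, Finset.sum_product]
  simp only [← Finset.card_filter]
  push_cast
  simpa only [nsmul_eq_mul] using Finset.sum_le_card_nsmul P _ _ hfiber
end

section
/- Let d ≥ 1, k ≥ 2, and 1 ≤ ℓ ≤ k − 1 be integers, let ε > 0, and let t_1 ≤ t_2 ≤ ... ≤ t_k be positive real numbers with t_{ℓ+1} > 2(1 + ε)·t_ℓ. Suppose A and B are natural numbers such that every finite subset of Euclidean space R^d, all of whose distances between distinct points lie in ⋃_{p=1}^{ℓ} [t_p, t_p(1 + ε)], has at most A elements, and every finite subset of R^d, all of whose distances between distinct points lie in ⋃_{p=ℓ+1}^{k} [t_p, t_p(1 + ε)], has at most B elements. Then every finite subset P of R^d, all of whose distances between distinct points lie in ⋃_{p=1}^{k} [t_p, t_p(1 + ε)], has at most A·B elements. -/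
/-- Every finite set in a metric space has an `R`-separated subset that is also an `R`-net. -/
theorem Finset.exists_separated_net {α : Type*} [PseudoMetricSpace α] (s : Finset α)
    {R : ℝ} (hR : 0 ≤ R) :
    ∃ m ⊆ s, (∀ x ∈ m, ∀ y ∈ m, x ≠ y → R < dist x y) ∧ ∀ x ∈ s, ∃ y ∈ m, dist x y ≤ R := by
  classical
  obtain ⟨m, hm, hmax⟩ := Finset.exists_max_image
    (s.powerset.filter fun m => ∀ x ∈ m, ∀ y ∈ m, x ≠ y → R < dist x y) Finset.card
    ⟨∅, by simp⟩
  rw [Finset.mem_filter, Finset.mem_powerset] at hm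
  refine ⟨m, hm.1, hm.2, fun x hx => ?_⟩
  by_contra! hfar
  have hxm : x ∉ m := fun h => (hfar x h).not_ge (by simpa using hR)
  have hle := hmax (insert x m) <| by
    refine Finset.mem_filter.2 ⟨Finset.mem_powerset.2 (Finset.insert_subset hx hm.1), ?_⟩
    intro a ha b hb hab
    rcases Finset.mem_insert.1 ha with rfl | ham <;> rcases Finset.mem_insert.1 hb with rfl | hbm
    · exact absurd rfl hab
    · exact hfar b hbm
    · exact dist_comm b a ▸ hfar a ham
    · exact hm.2 a ham b hbm hab
  rw [Finset.card_insert_of_notMem hxm] at hle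
  omega

/-- If the distances in a finite set avoid the interval `(R, 2R]`, and `A` and `B` bound the sizes
of its subsets of diameter at most `R` and of its `R`-separated subsets respectively, then the set
has at most `A * B` elements. -/
theorem Finset.card_le_mul_of_dist_gap {α : Type*} [PseudoMetricSpace α] (s : Finset α)
    {R : ℝ} (hR : 0 ≤ R) {A B : ℕ}
    (hgap : ∀ x ∈ s, ∀ y ∈ s, dist x y ≤ 2 * R → dist x y ≤ R)
    (hA : ∀ u ⊆ s, (∀ x ∈ u, ∀ y ∈ u, dist x y ≤ R) → u.card ≤ A)
    (hB : ∀ u ⊆ s, (∀ x ∈ u, ∀ y ∈ u, x ≠ y → R < dist x y) → u.card ≤ B) :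
    s.card ≤ A * B := by
  classical
  obtain ⟨m, hms, hsep, hnet⟩ := s.exists_separated_net hR
  choose! f hfm hf using hnet
  refine (Finset.card_le_mul_card_image_of_maps_to hfm A fun b _ => ?_).trans
    (Nat.mul_le_mul_left A (hB m hms hsep))
  refine hA _ (Finset.filter_subset _ _) fun x hx y hy => ?_
  obtain ⟨hxs, hxb⟩ := Finset.mem_filter.1 hx
  obtain ⟨hys, hyb⟩ := Finset.mem_filter.1 hy
  refine hgap x hxs y hys ?_
  linarith [dist_triangle_right x y b, hxb ▸ hf x hxs, hyb ▸ hf y hys]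


theorem card_le_mul_of_split_distance_scales
    (d k ℓ : ℕ) (hd : 1 ≤ d) (hk : 2 ≤ k) (hℓ1 : 1 ≤ ℓ) (hℓk : ℓ ≤ k - 1)
    (ε : ℝ) (hε : 0 < ε) (t : ℕ → ℝ)
    (ht : ∀ p, 1 ≤ p → p ≤ k → 0 < t p)
    (hmono : ∀ p q, 1 ≤ p → p ≤ q → q ≤ k → t p ≤ t q)
    (hgap : 2 * (1 + ε) * t ℓ < t (ℓ + 1))
    (A B : ℕ)
    (hA : ∀ s : Finset (EuclideanSpace ℝ (Fin d)),
      (∀ x ∈ s, ∀ y ∈ s, x ≠ y → ∃ p, 1 ≤ p ∧ p ≤ ℓ ∧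
        dist x y ∈ Set.Icc (t p) (t p * (1 + ε))) → s.card ≤ A)
    (hB : ∀ s : Finset (EuclideanSpace ℝ (Fin d)),
      (∀ x ∈ s, ∀ y ∈ s, x ≠ y → ∃ p, ℓ + 1 ≤ p ∧ p ≤ k ∧
        dist x y ∈ Set.Icc (t p) (t p * (1 + ε))) → s.card ≤ B)
    (s : Finset (EuclideanSpace ℝ (Fin d)))
    (hs : ∀ x ∈ s, ∀ y ∈ s, x ≠ y → ∃ p, 1 ≤ p ∧ p ≤ k ∧
      dist x y ∈ Set.Icc (t p) (t p * (1 + ε))) :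
    s.card ≤ A * B := by
  have hsmall : ∀ p, 1 ≤ p → p ≤ ℓ → t p * (1 + ε) ≤ (1 + ε) * t ℓ := fun p h1 hp => by
    rw [mul_comm]
    exact mul_le_mul_of_nonneg_left (hmono p ℓ h1 hp (by omega)) (by linarith)
  have hlarge : ∀ p, ℓ + 1 ≤ p → p ≤ k → 2 * ((1 + ε) * t ℓ) < t p := fun p hp hpk => by
    linarith [hmono (ℓ + 1) p (by omega) hp hpk]
  have hR : 0 ≤ (1 + ε) * t ℓ := mul_nonneg (by linarith) (ht ℓ hℓ1 (by omega)).le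
  refine s.card_le_mul_of_dist_gap hR ?_ (fun u hu hdiam => hA u ?_) (fun u hu hsep => hB u ?_)
  · intro x hx y hy hxy
    rcases eq_or_ne x y with rfl | hne
    · simpa using hR
    obtain ⟨p, h1, hpk, hlo, hhi⟩ := hs x hx y hy hne
    rcases le_or_gt p ℓ with hp | hp
    · exact hhi.trans (hsmall p h1 hp)
    · linarith [hlarge p hp hpk]
  · intro x hx y hy hne
    obtain ⟨p, h1, hpk, hd⟩ := hs x (hu hx) y (hu hy) hne
    refine ⟨p, h1, ?_, hd⟩
    by_contra! hp
    linarith [hlarge p hp hpk, hd.1, hdiam x hx y hy]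
  · intro x hx y hy hne
    obtain ⟨p, h1, hpk, hd⟩ := hs x (hu hx) y (hu hy) hne
    refine ⟨p, ?_, hpk, hd⟩
    by_contra! hp
    linarith [hsmall p h1 (by omega), hd.2, hsep x hx y hy hne]
end

section
/- Let d ≥ 2 be an integer, let t_1, t_2, h > 0 be real numbers, and let Q_p, Q_1, Q_2 be points of Euclidean space R^d with Q_1 ≠ Q_2 and Q_1 ≠ Q_p, such that dist(Q_1, Q_2) ∈ [t_2, t_2 + h], dist(Q_2, Q_p) ∈ [t_2, t_2 + h], and dist(Q_1, Q_p) ∈ [t_1, t_1 + h]. Then the angle at Q_1 in the triangle Q_p Q_1 Q_2 satisfies |cos ∠(Q_p, Q_1, Q_2)| ≤ (4h(t_2 + h) + (t_1 + h)²) / (2 t_1 t_2). -/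
theorem abs_cos_angle_le_of_two_long_one_short
    (d : ℕ) (hd : 2 ≤ d) (t₁ t₂ h : ℝ)
    (ht₁ : 0 < t₁) (ht₂ : 0 < t₂) (hh : 0 < h)
    (Qp Q₁ Q₂ : EuclideanSpace ℝ (Fin d))
    (h12 : Q₁ ≠ Q₂) (h1p : Q₁ ≠ Qp)
    (hd12 : dist Q₁ Q₂ ∈ Set.Icc t₂ (t₂ + h))
    (hd2p : dist Q₂ Qp ∈ Set.Icc t₂ (t₂ + h))
    (hd1p : dist Q₁ Qp ∈ Set.Icc t₁ (t₁ + h)) :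
    |Real.cos (EuclideanGeometry.angle Qp Q₁ Q₂)| ≤
      (4 * h * (t₂ + h) + (t₁ + h) ^ 2) / (2 * t₁ * t₂) := by
  have law := EuclideanGeometry.law_cos Qp Q₁ Q₂
  rw [dist_comm Qp Q₂, dist_comm Qp Q₁, dist_comm Q₂ Q₁] at law
  obtain ⟨hb, hb'⟩ := hd12
  obtain ⟨hc, hc'⟩ := hd2p
  obtain ⟨ha, ha'⟩ := hd1p
  set a := dist Q₁ Qp
  set b := dist Q₁ Q₂
  set c := dist Q₂ Qp
  set x := Real.cos (EuclideanGeometry.angle Qp Q₁ Q₂)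
  have hab : t₁ * t₂ ≤ a * b := mul_le_mul ha hb ht₂.le (ht₁.le.trans ha)
  have ha2 : a ^ 2 ≤ (t₁ + h) ^ 2 := pow_le_pow_left₀ (ht₁.le.trans ha) ha' 2
  have hbc : |b ^ 2 - c ^ 2| ≤ h * (2 * (t₂ + h)) := by
    rw [sq_sub_sq, mul_comm, abs_mul, abs_of_nonneg (by linarith : 0 ≤ b + c)]
    exact mul_le_mul (abs_sub_le_iff.2 ⟨by linarith, by linarith⟩) (by linarith)
      (by linarith) hh.le
  rw [le_div_iff₀ (by positivity)]
  calc |x| * (2 * t₁ * t₂) = 2 * (|x| * (t₁ * t₂)) := by ring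
    _ ≤ 2 * (|x| * (a * b)) := by gcongr
    _ = |2 * a * b * x| := by
      rw [abs_mul, abs_of_nonneg (by positivity : 0 ≤ 2 * a * b)]; ring
    _ = |a ^ 2 + (b ^ 2 - c ^ 2)| := by congr 1; linarith
    _ ≤ a ^ 2 + |b ^ 2 - c ^ 2| := (abs_add_le _ _).trans_eq (by rw [abs_sq])
    _ ≤ 4 * h * (t₂ + h) + (t₁ + h) ^ 2 := by
      have : 0 < h * (t₂ + h) := by positivity
      linarith
end

section
/- Let e ≥ 1 and p ≥ 1 be integers with 2p ≤ e + 1, and let λ > 0 be a real number. Let S be the set of points of Euclidean space R^{e+1} having exactly p coordinates equal to λ/√2 and all remaining coordinates equal to 0. Then S has cardinality binomial(e+1, p), S is contained in the hyperplane {x ∈ R^{e+1} : x_1 + ... + x_{e+1} = p·λ/√2}, and the set of distances between pairs of distinct points of S equals {λ·√j : j = 1, ..., p}; in particular, the minimum distance between distinct points of S is λ and S determines exactly p distinct nonzero distances. -/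
open scoped Classical

/-- The vector equal to `c` on the coordinates in `s` and to `0` elsewhere. -/
noncomputable def scaledIndicator {ι : Type*} [DecidableEq ι] (c : ℝ) (s : Finset ι) :
    EuclideanSpace ℝ ι :=
  WithLp.toLp 2 fun i => if i ∈ s then c else 0

theorem scaledIndicator_apply {ι : Type*} [DecidableEq ι] (c : ℝ) (s : Finset ι) (i : ι) :
    scaledIndicator c s i = if i ∈ s then c else 0 := rfl

theorem scaledIndicator_injective {ι : Type*} [DecidableEq ι] {c : ℝ} (hc : c ≠ 0) :
    Function.Injective (scaledIndicator (ι := ι) c) := by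
  intro s t h
  ext i
  have hi := congrArg (fun x : EuclideanSpace ℝ ι => x i) h
  simp only [scaledIndicator_apply] at hi
  by_cases hs : i ∈ s <;> by_cases ht : i ∈ t <;> simp_all

theorem sum_scaledIndicator {ι : Type*} [Fintype ι] [DecidableEq ι] (c : ℝ) (s : Finset ι) :
    ∑ i, scaledIndicator c s i = s.card * c := by
  simp [scaledIndicator_apply, Finset.sum_ite_mem]

theorem setOf_card_eq_image_scaledIndicator {ι : Type*} [Fintype ι] [DecidableEq ι]
    {c : ℝ} (hc : c ≠ 0) (p : ℕ) :
    {x : EuclideanSpace ℝ ι | (Finset.univ.filter fun i => x i = c).card = p ∧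
      ∀ i, x i = c ∨ x i = 0} =
    scaledIndicator c '' (Finset.powersetCard p (Finset.univ : Finset ι) : Set (Finset ι)) := by
  ext x
  simp only [Set.mem_ofPred_eq, Set.mem_image, Finset.mem_coe, Finset.mem_powersetCard_univ]
  constructor
  · rintro ⟨hcard, hx⟩
    refine ⟨_, hcard, ?_⟩
    ext i
    rcases hx i with h | h <;> simp [scaledIndicator_apply, h, hc.symm]
  · rintro ⟨s, rfl, rfl⟩
    constructor
    · congr 1
      ext i
      simp [scaledIndicator_apply, hc.symm]
    · intro i
      rw [scaledIndicator_apply]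
      split_ifs <;> simp

theorem dist_scaledIndicator_sq {ι : Type*} [Fintype ι] [DecidableEq ι] (c : ℝ)
    (s t : Finset ι) :
    dist (scaledIndicator c s) (scaledIndicator c t) ^ 2 =
      ((s \ t).card + (t \ s).card) * c ^ 2 := by
  have h (i : ι) : dist (scaledIndicator c s i) (scaledIndicator c t i) ^ 2 =
      (if i ∈ s \ t then c ^ 2 else 0) + (if i ∈ t \ s then c ^ 2 else 0) := by
    rw [Real.dist_eq, sq_abs, scaledIndicator_apply, scaledIndicator_apply]
    by_cases hs : i ∈ s <;> by_cases ht : i ∈ t <;> simp [hs, ht]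
  rw [EuclideanSpace.dist_eq, Real.sq_sqrt (by positivity), Finset.sum_congr rfl fun i _ => h i,
    Finset.sum_add_distrib]
  simp only [Finset.sum_ite_mem, Finset.univ_inter, Finset.sum_const, nsmul_eq_mul]
  ring

theorem dist_scaledIndicator_of_card_eq {ι : Type*} [Fintype ι] [DecidableEq ι]
    {lam : ℝ} (hlam : 0 ≤ lam) {s t : Finset ι} (hst : s.card = t.card) :
    dist (scaledIndicator (lam / √2) s) (scaledIndicator (lam / √2) t) =
      lam * √((s \ t).card) := by
  rw [← sq_eq_sq₀ dist_nonneg (by positivity), dist_scaledIndicator_sq,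
    ← Finset.card_sdiff_comm hst, div_pow, mul_pow, Real.sq_sqrt (by positivity),
    Real.sq_sqrt (by positivity)]
  ring

theorem exists_card_eq_card_sdiff_eq {ι : Type*} [Fintype ι] [DecidableEq ι] {j p : ℕ}
    (hj : j ≤ p) (hp : p + j ≤ Fintype.card ι) :
    ∃ s t : Finset ι, s.card = p ∧ t.card = p ∧ (s \ t).card = j := by
  obtain ⟨s, -, hs⟩ := Finset.exists_subset_card_eq (s := (Finset.univ : Finset ι)) (n := p)
    (by rw [Finset.card_univ]; omega)
  obtain ⟨a, has, ha⟩ := Finset.exists_subset_card_eq (s := s) (n := j) (by omega)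
  obtain ⟨b, hbs, hb⟩ := Finset.exists_subset_card_eq (s := sᶜ) (n := j)
    (by rw [Finset.card_compl]; omega)
  have hdisj : Disjoint s b := (Finset.subset_compl_iff_disjoint_left).1 hbs
  refine ⟨s, (s \ a) ∪ b, hs, ?_, ?_⟩
  · rw [Finset.card_union_of_disjoint (hdisj.mono_left Finset.sdiff_subset),
      Finset.card_sdiff_of_subset has]
    omega
  · rw [← ha]
    congr 1
    ext i
    have : i ∈ s → i ∉ b := fun h => Finset.disjoint_left.1 hdisj h
    have : i ∈ a → i ∈ s := fun h => has h
    simp only [Finset.mem_sdiff, Finset.mem_union]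
    tauto

theorem ncard_setOf_mul_sqrt {lam : ℝ} (hlam : lam ≠ 0) (p : ℕ) :
    {r : ℝ | ∃ j : ℕ, 1 ≤ j ∧ j ≤ p ∧ r = lam * √j}.ncard = p := by
  have himage : {r : ℝ | ∃ j : ℕ, 1 ≤ j ∧ j ≤ p ∧ r = lam * √j} =
      (fun j : ℕ => lam * √j) '' (Finset.Icc 1 p : Set ℕ) := by
    ext r
    simp [and_assoc, eq_comm]
  have hinj : Function.Injective fun j : ℕ => lam * √j := by
    intro a b h
    have h' := mul_left_cancel₀ hlam h
    exact_mod_cast (Real.sqrt_inj (by positivity) (by positivity)).1 h'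
  rw [himage, Set.ncard_image_of_injective _ hinj, Set.ncard_coe_finset, Nat.card_Icc,
    Nat.add_sub_cancel]

theorem blokhuis_seidel_p_distance_simplex_set
    (e p : ℕ) (he : 1 ≤ e) (hp : 1 ≤ p) (hpe : 2 * p ≤ e + 1)
    (lam : ℝ) (hlam : 0 < lam) :
    let S : Set (EuclideanSpace ℝ (Fin (e + 1))) :=
      {x | (Finset.univ.filter fun i => x i = lam / Real.sqrt 2).card = p ∧
        ∀ i, x i = lam / Real.sqrt 2 ∨ x i = 0}
    S.ncard = Nat.choose (e + 1) p ∧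
    (∀ x ∈ S, ∑ i, x i = (p : ℝ) * lam / Real.sqrt 2) ∧
    {r : ℝ | ∃ x ∈ S, ∃ y ∈ S, x ≠ y ∧ r = dist x y} =
      {r : ℝ | ∃ j : ℕ, 1 ≤ j ∧ j ≤ p ∧ r = lam * Real.sqrt j} ∧
    (∀ x ∈ S, ∀ y ∈ S, x ≠ y → lam ≤ dist x y) ∧
    {r : ℝ | ∃ x ∈ S, ∃ y ∈ S, x ≠ y ∧ r = dist x y}.ncard = p := by
  intro S
  have hc : lam / √2 ≠ 0 := by positivity
  have hS : S = scaledIndicator (lam / √2) ''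
      (Finset.powersetCard p (Finset.univ : Finset (Fin (e + 1))) : Set (Finset (Fin (e + 1)))) :=
    setOf_card_eq_image_scaledIndicator hc p
  have hmem {x} : x ∈ S ↔ ∃ s : Finset (Fin (e + 1)), s.card = p ∧
      scaledIndicator (lam / √2) s = x := by
    simp [hS]
  have hdist : {r : ℝ | ∃ x ∈ S, ∃ y ∈ S, x ≠ y ∧ r = dist x y} =
      {r : ℝ | ∃ j : ℕ, 1 ≤ j ∧ j ≤ p ∧ r = lam * √j} := by
    ext r
    constructor
    · rintro ⟨x, hx, y, hy, hxy, rfl⟩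
      obtain ⟨s, hs, rfl⟩ := hmem.1 hx
      obtain ⟨t, ht, rfl⟩ := hmem.1 hy
      have hst := dist_scaledIndicator_of_card_eq hlam.le (hs.trans ht.symm)
      refine ⟨(s \ t).card, Nat.one_le_iff_ne_zero.2 fun h0 => hxy ?_,
        (Finset.card_le_card Finset.sdiff_subset).trans hs.le, hst⟩
      rw [← dist_eq_zero, hst, h0]
      simp
    · rintro ⟨j, hj1, hjp, rfl⟩
      obtain ⟨s, t, hs, ht, hst⟩ := exists_card_eq_card_sdiff_eq (ι := Fin (e + 1)) hjp
        (by rw [Fintype.card_fin]; omega)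
      refine ⟨_, hmem.2 ⟨s, hs, rfl⟩, _, hmem.2 ⟨t, ht, rfl⟩, fun h => ?_, ?_⟩
      · obtain rfl := scaledIndicator_injective hc h
        simp at hst
        omega
      · rw [dist_scaledIndicator_of_card_eq hlam.le (hs.trans ht.symm), hst]
  refine ⟨?_, ?_, hdist, ?_, ?_⟩
  · rw [hS, Set.ncard_image_of_injective _ (scaledIndicator_injective hc), Set.ncard_coe_finset,
      Finset.card_powersetCard, Finset.card_univ, Fintype.card_fin]
  · intro x hx
    obtain ⟨s, rfl, rfl⟩ := hmem.1 hx
    rw [sum_scaledIndicator, mul_div_assoc]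
  · intro x hx y hy hxy
    obtain ⟨j, hj, -, hr⟩ := hdist.subset ⟨x, hx, y, hy, hxy, rfl⟩
    rw [hr]
    exact le_mul_of_one_le_right hlam.le (Real.one_le_sqrt.2 (by exact_mod_cast hj))
  · rw [hdist, ncard_setOf_mul_sqrt hlam.ne']
end
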